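/- Let 0 < p < 1 − 1/e be fixed and m = ⌊p·N⌋. Then there is a sequence k = k(n) such that, with high probability as n → ∞, the equitable chromatic number satisfies χ_=(G_{n,m}) ∈ {k(n), k(n)+1}. -/

import Mathlib

open Filter
open scoped BigOperators Classical

noncomputable section

/-- The number of edges of a simple graph on `Fin n`. -/
def edgeCount {n : ℕ} (G : SimpleGraph (Fin n)) : ℕ := Nat.card G.edgeSet

/-- Probability of a graph property under the uniform random graph `G(n,m)`. -/
def Pm (n m : ℕ) (E : SimpleGraph (Fin n) → Prop) : ℝ :=
  (Nat.card {G : SimpleGraph (Fin n) // edgeCount G = m ∧ E G} : ℝ) /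
    (Nat.card {G : SimpleGraph (Fin n) // edgeCount G = m} : ℝ)

/-- Expectation of a real functional under the uniform random graph `G(n,m)`. -/
def Em (n m : ℕ) (X : SimpleGraph (Fin n) → ℝ) : ℝ :=
  (∑ᶠ G : {G : SimpleGraph (Fin n) // edgeCount G = m}, X G.1) /
    (Nat.card {G : SimpleGraph (Fin n) // edgeCount G = m} : ℝ)

/-- Probability of a graph property under the binomial random graph `G(n,p)`. -/
def Pp (n : ℕ) (p : ℝ) (E : SimpleGraph (Fin n) → Prop) : ℝ :=
  ∑ᶠ G : SimpleGraph (Fin n),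
    (if E G then (1 : ℝ) else 0) * p ^ edgeCount G * (1 - p) ^ (n.choose 2 - edgeCount G)

/-- Expectation of a real functional under the binomial random graph `G(n,p)`. -/
def Ep (n : ℕ) (p : ℝ) (X : SimpleGraph (Fin n) → ℝ) : ℝ :=
  ∑ᶠ G : SimpleGraph (Fin n),
    X G * p ^ edgeCount G * (1 - p) ^ (n.choose 2 - edgeCount G)

/-- `α₀(n) = 2 log_b n − 2 log_b log_b n + 2 log_b (e/2) + 1`. -/
def alpha0 (b : ℝ) (n : ℕ) : ℝ :=
  2 * Real.logb b n - 2 * Real.logb b (Real.logb b n) + 2 * Real.logb b (Real.exp 1 / 2) + 1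

/-- `α(n) = ⌊α₀(n)⌋`. -/
def alphaNat (b : ℝ) (n : ℕ) : ℕ := ⌊alpha0 b n⌋₊

/-- `μ_t = C(n,t) q^{C(t,2)}`, the expected number of independent `t`-sets. -/
def muExp (q : ℝ) (n t : ℕ) : ℝ := (n.choose t : ℝ) * q ^ t.choose 2

/-- A finset of vertices is independent in `G`. -/
def IndepFinset {n : ℕ} (G : SimpleGraph (Fin n)) (s : Finset (Fin n)) : Prop :=
  ∀ v ∈ s, ∀ w ∈ s, ¬ G.Adj v w

/-- `G` has a proper colouring with `k` colours, all colour classes of size at most `t`. -/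
def HasBoundedColouring {n : ℕ} (G : SimpleGraph (Fin n)) (t k : ℕ) : Prop :=
  ∃ C : Fin n → Fin k, (∀ v w, G.Adj v w → C v ≠ C w) ∧
    ∀ c : Fin k, (Finset.univ.filter fun v => C v = c).card ≤ t

/-- The `t`-bounded chromatic number `χ_t(G)`. -/
def chiBounded {n : ℕ} (G : SimpleGraph (Fin n)) (t : ℕ) : ℕ :=
  sInf {k | HasBoundedColouring G t k}

/-- `G` has an equitable proper colouring with `k` colours. -/
def HasEquitableColouring {n : ℕ} (G : SimpleGraph (Fin n)) (k : ℕ) : Prop :=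
  ∃ C : Fin n → Fin k, (∀ v w, G.Adj v w → C v ≠ C w) ∧
    ∀ c c' : Fin k,
      (Finset.univ.filter fun v => C v = c).card ≤
        (Finset.univ.filter fun v => C v = c').card + 1

/-- The equitable chromatic number `χ₌(G)`. -/
def chiEquitable {n : ℕ} (G : SimpleGraph (Fin n)) : ℕ :=
  sInf {k | HasEquitableColouring G k}

/-- The number of unordered `t`-bounded proper `k`-colourings of `G`, i.e. partitions of the
vertex set into exactly `k` nonempty independent sets, each of size at most `t`. -/
def numUnorderedColourings (n t k : ℕ) (G : SimpleGraph (Fin n)) : ℕ :=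
  Set.ncard {Q : Finset (Finset (Fin n)) | Q.card = k ∧
    (∀ s ∈ Q, s.Nonempty ∧ s.card ≤ t ∧ IndepFinset G s) ∧
    (∀ v : Fin n, ∃ s ∈ Q, v ∈ s) ∧
    ∀ s ∈ Q, ∀ s' ∈ Q, s ≠ s' → Disjoint s s'}

/-- `E_{n,k,t}`: the expected number of unordered `t`-bounded `k`-colourings of `G_{n,1/2}`. -/
def Enkt (n k t : ℕ) : ℝ := Ep n (1/2) fun G => (numUnorderedColourings n t k G : ℝ)

/-- The `t`-bounded first moment threshold `k_t(n)`. -/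
def fmThreshold (n t : ℕ) : ℕ := sInf {k | 1 ≤ Enkt n k t}

/-- `P` is a (possibly partial) `k`-colouring profile on `n` vertices. -/
def IsProfile (n k : ℕ) (P : ℕ → ℕ) : Prop :=
  (∀ u, u ∉ Finset.Icc 1 n → P u = 0) ∧
    (∑ u ∈ Finset.Icc 1 n, P u = k) ∧ (∑ u ∈ Finset.Icc 1 n, u * P u ≤ n)

/-- A colouring profile is complete if its classes use all `n` vertices. -/
def IsCompleteProfile (n : ℕ) (P : ℕ → ℕ) : Prop :=
  ∑ u ∈ Finset.Icc 1 n, u * P u = n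

/-- A colouring profile is `t`-bounded if it has no classes of size larger than `t`. -/
def IsBoundedProfile (t : ℕ) (P : ℕ → ℕ) : Prop := ∀ u, t < u → P u = 0

/-- The number of parts of a profile on `n` vertices. -/
def profileParts (n : ℕ) (P : ℕ → ℕ) : ℕ := ∑ u ∈ Finset.Icc 1 n, P u

/-- `X_k`: the number of ordered (partial) proper colourings of `G` with profile `P`:
ordered tuples of pairwise disjoint independent sets, decreasing in size, with exactly
`P u` parts of size `u` for every `u`. -/
def Xprofile {n : ℕ} (G : SimpleGraph (Fin n)) (P : ℕ → ℕ) : ℕ :=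
  Set.ncard {V : Fin (profileParts n P) → Finset (Fin n) |
    (∀ i j, i ≠ j → Disjoint (V i) (V j)) ∧
    (∀ i j, i ≤ j → (V j).card ≤ (V i).card) ∧
    (∀ u : ℕ, (Finset.univ.filter fun i => (V i).card = u).card = P u) ∧
    ∀ i, IndepFinset G (V i)}

/-- `X̄_k = X_k / ∏_u k_u!`: the number of unordered colourings with profile `P`. -/
def Xbar {n : ℕ} (G : SimpleGraph (Fin n)) (P : ℕ → ℕ) : ℝ :=
  (Xprofile G P : ℝ) / ∏ u ∈ Finset.Icc 1 n, ((P u).factorial : ℝ)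

/-- `κ = Σ_u κ_u` where `κ_u = u k_u / n`. -/
def kappaTot (n : ℕ) (P : ℕ → ℕ) : ℝ := ∑ u ∈ Finset.Icc 1 n, (u : ℝ) * P u / n

/-- `m = ⌊p N⌋` with `N = C(n,2)`. -/
def mFloor (p : ℝ) (n : ℕ) : ℕ := ⌊p * (n.choose 2 : ℝ)⌋₊

/-- Definition 2.2: a sequence `P` of complete `a`-bounded colouring profiles is tame. -/
def IsTame (p : ℝ) (a : ℕ → ℕ) (P : ℕ → ℕ → ℕ) : Prop :=
  (∃ C : ℝ, ∀ᶠ n in atTop, alpha0 (1/(1-p)) n - C ≤ (a n : ℝ)) ∧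
  (∀ᶠ n in atTop, a n ≤ alphaNat (1/(1-p)) n) ∧
  (∀ n, IsProfile n (profileParts n (P n)) (P n) ∧ IsCompleteProfile n (P n) ∧
      IsBoundedProfile (a n) (P n)) ∧
  ∃ c : ℝ, c ∈ Set.Ioo (0:ℝ) 1 ∧ ∃ γ : ℕ → ℝ, Monotone γ ∧ Tendsto γ atTop atTop ∧
    (∀ᶠ n in atTop, ∀ u, 1 ≤ u → u ≤ a n →
      (u : ℝ) * P n u / n <
        (1/(1-p)) ^ (-(((alphaNat (1/(1-p)) n - u : ℕ) : ℝ) *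
          γ (alphaNat (1/(1-p)) n - u)))) ∧
    ∀ ε : ℝ, 0 < ε → ∀ᶠ n : ℕ in atTop,
      Real.exp (-ε * (n : ℝ) ^ ((1:ℝ) - c)) ≤ Em n (mFloor p n) fun G => Xbar G (P n)

/-- The function `φ(κ)` from Lemma 3.3. -/
def phiProfile (p : ℝ) (n : ℕ) (P : ℕ → ℕ) : ℝ :=
  -(1 - kappaTot n P) * Real.log (1 - kappaTot n P) +
    Real.log (1/(1-p)) / 2 * ∑ u ∈ Finset.Icc 1 n,
      ((u : ℝ) * P u / n) * (alpha0 (1/(1-p)) n - 1 - 2 / Real.log (1/(1-p)) - (u : ℝ))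

/-- The function `φ̃_δ(x)` from Lemma 3.5. -/
def phiTilde (p δ x : ℝ) : ℝ :=
  -(1 - x) * Real.log (1 - x) - (1 - Real.log (1/(1-p)) / 2 * δ) * x

/-- `d_u = 2^{C(u,2)} u!`. -/
def dcoef (u : ℕ) : ℝ := 2 ^ u.choose 2 * (u.factorial : ℝ)

/-- `L_0(n,k,t)`: the supremum of `L_k` over real-valued `t`-bounded complete profiles. -/
def L0 (n k t : ℕ) : ℝ :=
  sSup {y : ℝ | ∃ f : ℕ → ℝ, (∀ u ∈ Finset.Icc 1 t, 0 ≤ f u) ∧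
    (∑ u ∈ Finset.Icc 1 t, f u = (k : ℝ)) ∧ (∑ u ∈ Finset.Icc 1 t, (u : ℝ) * f u = (n : ℝ)) ∧
    y = (n : ℝ) * Real.log n - (n : ℝ) + (k : ℝ) -
      ∑ u ∈ Finset.Icc 1 t, f u * Real.log (f u * dcoef u)}

/-- Membership in `P_{n,k,t}`: a `t`-bounded complete `k`-colouring profile on `n` vertices. -/
def IsKTProfile (n k t : ℕ) (P : ℕ → ℕ) : Prop :=
  (∀ u, u ∉ Finset.Icc 1 t → P u = 0) ∧
    (∑ u ∈ Finset.Icc 1 t, P u = k) ∧ (∑ u ∈ Finset.Icc 1 t, u * P u = n)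

/-- `E_{n,k,t}` written as the sum over profiles of `E_{1/2}[X̄_k]`. -/
def EnktSum (n k t : ℕ) : ℝ :=
  ∑ᶠ P : ℕ → ℕ, if IsKTProfile n k t P then Ep n (1/2) fun G => Xbar G P else 0


/-- all potential edges -/
def allE (n : ℕ) : Finset (Sym2 (Fin n)) := Finset.univ.filter fun e => ¬ e.IsDiag

/-- edge set as finset (classical) -/
def eF {n : ℕ} (G : SimpleGraph (Fin n)) : Finset (Sym2 (Fin n)) :=
  Finset.univ.filter fun e => e ∈ G.edgeSet

/-- pairs that are monochromatic in `C` -/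
def monoE {n : ℕ} {α : Type} (C : Fin n → α) : Finset (Sym2 (Fin n)) :=
  Finset.univ.filter fun e => ¬ e.IsDiag ∧ (e.map C).IsDiag

/-- properness -/
def Proper {n : ℕ} {α : Type} (G : SimpleGraph (Fin n)) (C : Fin n → α) : Prop :=
  ∀ v w, G.Adj v w → C v ≠ C w

theorem card_allE (n : ℕ) : (allE n).card = n.choose 2 := by
  have h := SimpleGraph.card_edgeFinset_top_eq_card_choose_two (V := Fin n)
  rw [Fintype.card_fin] at h
  rw [← h]
  congr 1
  ext e
  simp [allE]

theorem edgeCount_eq {n : ℕ} (G : SimpleGraph (Fin n)) : edgeCount G = (eF G).card := by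
  unfold edgeCount eF
  rw [Nat.card_eq_fintype_card, Fintype.card_subtype]

theorem eF_subset {n : ℕ} (G : SimpleGraph (Fin n)) : eF G ⊆ allE n := by
  intro e he
  simp only [eF, allE, Finset.mem_filter, Finset.mem_univ, true_and] at *
  exact G.not_isDiag_of_mem_edgeSet he

theorem eF_inj {n : ℕ} {G H : SimpleGraph (Fin n)} (h : eF G = eF H) : G = H := by
  rw [← SimpleGraph.edgeSet_inj]
  ext e
  have := Finset.ext_iff.1 h e
  simpa [eF] using this

theorem eF_surj {n : ℕ} {s : Finset (Sym2 (Fin n))} (h : s ⊆ allE n) :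
    ∃ G : SimpleGraph (Fin n), eF G = s := by
  refine ⟨SimpleGraph.fromEdgeSet (s : Set (Sym2 (Fin n))), ?_⟩
  ext e
  have := @h e
  simp only [eF, allE, Finset.mem_filter, Finset.mem_univ, true_and,
    SimpleGraph.edgeSet_fromEdgeSet] at *
  simp only [Set.mem_sdiff, Finset.mem_coe, Sym2.mem_diagSet]
  tauto

/-- graphs with m edges -/
def gS (n m : ℕ) : Finset (SimpleGraph (Fin n)) := Finset.univ.filter fun G => edgeCount G = m

theorem card_avoid (n m : ℕ) (F : Finset (Sym2 (Fin n))) (hF : F ⊆ allE n) :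
    ((gS n m).filter fun G => Disjoint (eF G) F).card = (n.choose 2 - F.card).choose m := by
  rw [← card_allE, ← Finset.card_sdiff_of_subset hF, ← Finset.card_powersetCard]
  refine Finset.card_bij (fun G _ => eF G) ?_ ?_ ?_
  · intro G hG
    simp only [gS, Finset.mem_filter, Finset.mem_univ, true_and] at hG
    rw [Finset.mem_powersetCard]
    refine ⟨?_, by rw [← edgeCount_eq]; exact hG.1⟩
    rw [Finset.subset_sdiff]
    exact ⟨eF_subset G, hG.2⟩
  · intro G _ H _ h
    exact eF_inj h
  · intro s hs
    rw [Finset.mem_powersetCard, Finset.subset_sdiff] at hs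
    obtain ⟨G, hG⟩ := eF_surj hs.1.1
    refine ⟨G, ?_, hG⟩
    simp only [gS, Finset.mem_filter, Finset.mem_univ, true_and]
    rw [edgeCount_eq, hG]
    exact ⟨hs.2, hs.1.2⟩

theorem card_gS (n m : ℕ) : (gS n m).card = (n.choose 2).choose m := by
  have := card_avoid n m ∅ (by simp)
  simpa using this

theorem Pm_eq (n m : ℕ) (E : SimpleGraph (Fin n) → Prop) :
    Pm n m E = (((gS n m).filter E).card : ℝ) / ((n.choose 2).choose m : ℕ) := by
  unfold Pm
  rw [← card_gS, Nat.card_eq_fintype_card, Nat.card_eq_fintype_card, Fintype.card_subtype,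
    Fintype.card_subtype, gS, Finset.filter_filter]

theorem monoE_subset {n : ℕ} {α : Type} (C : Fin n → α) : monoE C ⊆ allE n := by
  intro e he
  simp only [monoE, allE, Finset.mem_filter, Finset.mem_univ, true_and] at *
  exact he.1

theorem proper_iff {n : ℕ} {α : Type} (G : SimpleGraph (Fin n)) (C : Fin n → α) :
    Proper G C ↔ Disjoint (eF G) (monoE C) := by
  rw [Finset.disjoint_left]
  constructor
  · intro h e he hm
    induction e using Sym2.ind with
    | _ v w =>
      simp only [eF, monoE, Finset.mem_filter, Finset.mem_univ, true_and, SimpleGraph.mem_edgeSet,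
        Sym2.map_mk, Sym2.mk_isDiag_iff] at *
      exact h v w he hm.2
  · intro h v w hvw hC
    have := @h s(v, w) (by simpa [eF] using hvw)
    simp only [monoE, Finset.mem_filter, Finset.mem_univ, true_and,
        Sym2.map_mk, Sym2.mk_isDiag_iff] at this
    exact this ⟨hvw.ne, hC⟩

theorem card_monoE {n : ℕ} {α : Type} [Fintype α] [DecidableEq α] (C : Fin n → α) :
    (monoE C).card = ∑ c : α, (Finset.univ.filter fun v => C v = c).card.choose 2 := by
  have : monoE C = Finset.univ.biUnion fun c : α =>
      Finset.image (Function.uncurry Sym2.mk) (Finset.univ.filter fun v => C v = c).offDiag := by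
    ext e
    induction e using Sym2.ind with
    | _ v w =>
      simp only [monoE, Finset.mem_filter, Finset.mem_univ, true_and,
        Sym2.map_mk, Sym2.mk_isDiag_iff, Finset.mem_biUnion, Finset.mem_image, Finset.mem_offDiag,
        Prod.exists, Function.uncurry_apply_pair, Sym2.eq_iff]
      constructor
      · rintro ⟨h1, h2⟩
        exact ⟨C w, v, w, ⟨h2, rfl, h1⟩, Or.inl ⟨rfl, rfl⟩⟩
      · rintro ⟨c, x, y, ⟨h1, h2, h3⟩, h4⟩
        rcases h4 with ⟨rfl, rfl⟩ | ⟨rfl, rfl⟩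
        · exact ⟨h3, h1.trans h2.symm⟩
        · exact ⟨h3.symm, h2.trans h1.symm⟩
  rw [this, Finset.card_biUnion]
  · refine Finset.sum_congr rfl fun c _ => ?_
    exact Sym2.card_image_offDiag _
  · intro c _ c' _ hcc
    rw [Function.onFun, Finset.disjoint_left]
    intro e he he'
    induction e using Sym2.ind with
    | _ v w =>
      simp only [Finset.mem_filter, Finset.mem_univ, true_and, Finset.mem_image,
        Finset.mem_offDiag, Prod.exists, Function.uncurry_apply_pair, Sym2.eq_iff] at *
      grind

theorem monoE_inter {n : ℕ} {α β : Type} (C : Fin n → α) (C' : Fin n → β) :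
    monoE C ∩ monoE C' = monoE fun v => (C v, C' v) := by
  ext e
  induction e using Sym2.ind with
  | _ v w =>
    simp only [monoE, Finset.mem_inter, Finset.mem_filter, Finset.mem_univ, true_and,
        Sym2.map_mk, Sym2.mk_isDiag_iff, Prod.mk.injEq]
    tauto

/-- size of colour class -/
def szC {n k : ℕ} (C : Fin n → Fin k) (j : Fin k) : ℕ := (Finset.univ.filter fun v => C v = j).card

/-- number of monochromatic pairs -/
def fC {n k : ℕ} (C : Fin n → Fin k) : ℕ := ∑ j, (szC C j).choose 2

/-- overlap matrix -/
def rC {n k : ℕ} (C : Fin n → Fin k) (σ : Equiv.Perm (Fin n)) (i j : Fin k) : ℕ :=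
  (Finset.univ.filter fun v => C v = i ∧ C (σ v) = j).card

/-- common monochromatic pairs -/
def sC {n k : ℕ} (C : Fin n → Fin k) (σ : Equiv.Perm (Fin n)) : ℕ :=
  ∑ i, ∑ j, (rC C σ i j).choose 2

/-- number of permutations giving a proper colouring -/
def XC {n k : ℕ} (C : Fin n → Fin k) (G : SimpleGraph (Fin n)) : ℕ :=
  (Finset.univ.filter fun σ : Equiv.Perm (Fin n) => Proper G (C ∘ σ)).card

theorem card_fibre_comp {n k : ℕ} (C : Fin n → Fin k) (σ : Equiv.Perm (Fin n)) (j : Fin k) :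
    (Finset.univ.filter fun v => (C ∘ σ) v = j).card = szC C j := by
  refine Finset.card_bij (fun v _ => σ v) ?_ ?_ ?_
  · intro v hv; simpa using hv
  · intro v _ w _ h; exact σ.injective h
  · intro v hv; exact ⟨σ.symm v, by simpa using hv, by simp⟩

theorem card_mono_comp {n k : ℕ} (C : Fin n → Fin k) (σ : Equiv.Perm (Fin n)) :
    (monoE (C ∘ σ)).card = fC C := by
  rw [card_monoE, fC]
  exact Finset.sum_congr rfl fun j _ => by
    rw [← card_fibre_comp C σ j]

theorem card_mono_inter {n k : ℕ} (C : Fin n → Fin k) (σ τ : Equiv.Perm (Fin n)) :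
    (monoE (C ∘ σ) ∩ monoE (C ∘ τ)).card = sC C (τ * σ⁻¹) := by
  rw [monoE_inter, card_monoE, sC, Fintype.sum_prod_type]
  refine Finset.sum_congr rfl fun i _ => Finset.sum_congr rfl fun j _ => ?_
  congr 1
  rw [rC]
  refine Finset.card_bij (fun v _ => σ v) ?_ ?_ ?_
  · intro v hv
    have h1 := (Finset.mem_filter.1 hv).2
    rw [Finset.mem_filter]
    simpa using h1
  · intro v _ w _ h; exact σ.injective h
  · intro v hv
    refine ⟨σ.symm v, ?_, by simp⟩
    have h1 := (Finset.mem_filter.1 hv).2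
    apply Finset.mem_filter.2
    simpa using h1

theorem sC_le {n k : ℕ} (C : Fin n → Fin k) (σ : Equiv.Perm (Fin n)) : sC C σ ≤ fC C := by
  have := card_mono_inter C 1 σ
  rw [inv_one, mul_one] at this
  rw [← this, ← card_mono_comp C 1]
  exact Finset.card_le_card Finset.inter_subset_left

theorem sum_XC {n k : ℕ} (m : ℕ) (C : Fin n → Fin k) :
    ∑ G ∈ gS n m, XC C G = n.factorial * (n.choose 2 - fC C).choose m := by
  have h1 : ∀ G, XC C G = ∑ σ : Equiv.Perm (Fin n), if Disjoint (eF G) (monoE (C ∘ σ)) then 1 else 0 := by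
    intro G
    rw [XC, Finset.card_filter]
    exact Finset.sum_congr rfl fun σ _ => by simp only [proper_iff]
  simp_rw [h1]
  rw [Finset.sum_comm]
  simp_rw [← Finset.card_filter]
  rw [Finset.sum_congr rfl fun σ _ => by rw [card_avoid n m _ (monoE_subset _), card_mono_comp]]
  rw [Finset.sum_const, Finset.card_univ, Fintype.card_perm, Fintype.card_fin, smul_eq_mul]

theorem sum_XC_sq {n k : ℕ} (m : ℕ) (C : Fin n → Fin k) :
    ∑ G ∈ gS n m, XC C G ^ 2 =
      n.factorial * ∑ σ : Equiv.Perm (Fin n), (n.choose 2 - (2 * fC C - sC C σ)).choose m := by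
  have h1 : ∀ G, XC C G ^ 2 = ∑ σ : Equiv.Perm (Fin n), ∑ τ : Equiv.Perm (Fin n),
      if Disjoint (eF G) (monoE (C ∘ σ) ∪ monoE (C ∘ τ)) then 1 else 0 := by
    intro G
    rw [XC, Finset.card_filter, sq, Finset.sum_mul_sum]
    refine Finset.sum_congr rfl fun σ _ => Finset.sum_congr rfl fun τ _ => ?_
    simp only [proper_iff, Finset.disjoint_union_right]
    split_ifs <;> simp_all
  simp_rw [h1]
  rw [Finset.sum_comm]
  have h2 : ∀ σ : Equiv.Perm (Fin n), ∑ G ∈ gS n m, ∑ τ : Equiv.Perm (Fin n),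
      (if Disjoint (eF G) (monoE (C ∘ σ) ∪ monoE (C ∘ τ)) then 1 else 0)
      = ∑ τ : Equiv.Perm (Fin n), (n.choose 2 - (2 * fC C - sC C τ)).choose m := by
    intro σ
    rw [Finset.sum_comm]
    simp_rw [← Finset.card_filter]
    rw [← Equiv.sum_comp (Equiv.mulRight σ⁻¹) fun τ => (n.choose 2 - (2 * fC C - sC C τ)).choose m]
    refine Finset.sum_congr rfl fun τ _ => ?_
    rw [card_avoid n m _ (Finset.union_subset (monoE_subset _) (monoE_subset _))]
    congr 2
    have := Finset.card_union_add_card_inter (monoE (C ∘ σ)) (monoE (C ∘ τ))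
    rw [card_mono_inter, card_mono_comp, card_mono_comp] at this
    simp only [Equiv.coe_mulRight]
    omega
  rw [Finset.sum_congr rfl fun σ _ => h2 σ]
  rw [Finset.sum_const, Finset.card_univ, Fintype.card_perm, Fintype.card_fin, smul_eq_mul]

/-- Second moment inequality. -/
theorem second_moment {n k : ℕ} (m : ℕ) (C : Fin n → Fin k) :
    ((n.factorial : ℝ) * ((n.choose 2 - fC C).choose m : ℕ)) ^ 2 ≤
      (((gS n m).filter fun G => ∃ σ : Equiv.Perm (Fin n), Proper G (C ∘ σ)).card : ℝ) *
      ((n.factorial : ℝ) *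
        ∑ σ : Equiv.Perm (Fin n), ((n.choose 2 - (2 * fC C - sC C σ)).choose m : ℕ)) := by
  have h1 := sum_XC m C
  have h2 := sum_XC_sq m C
  set A := (gS n m).filter fun G => ∃ σ : Equiv.Perm (Fin n), Proper G (C ∘ σ) with hA
  have h3 : ∑ G ∈ A, XC C G = ∑ G ∈ gS n m, XC C G := by
    refine Finset.sum_subset (Finset.filter_subset _ _) ?_
    intro G hG hGA
    rw [XC, Finset.card_eq_zero, Finset.filter_eq_empty_iff]
    intro σ _ hσ
    exact hGA (by rw [hA, Finset.mem_filter]; exact ⟨hG, σ, hσ⟩)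
  have h4 : ∑ G ∈ A, XC C G ^ 2 ≤ ∑ G ∈ gS n m, XC C G ^ 2 :=
    Finset.sum_le_sum_of_subset (Finset.filter_subset _ _)
  have h5 := Finset.sum_mul_sq_le_sq_mul_sq A (fun _ => 1) (fun G => XC C G)
  simp only [one_mul, one_pow, Finset.sum_const, smul_eq_mul, mul_one] at h5
  have h6 : (n.factorial * (n.choose 2 - fC C).choose m) ^ 2 ≤ A.card *
      (n.factorial * ∑ σ : Equiv.Perm (Fin n), (n.choose 2 - (2 * fC C - sC C σ)).choose m) := by
    rw [← h1, ← h2, ← h3]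
    exact h5.trans (Nat.mul_le_mul_left _ h4)
  exact_mod_cast h6

theorem exists_perm_of_fibres {n k : ℕ} (f g : Fin n → Fin k) (h : ∀ j, szC f j = szC g j) :
    ∃ σ : Equiv.Perm (Fin n), f ∘ σ = g := by
  have e : ∀ j, Nonempty ({v // g v = j} ≃ {v // f v = j}) := by
    intro j
    refine ⟨Fintype.equivOfCardEq ?_⟩
    rw [Fintype.card_subtype, Fintype.card_subtype]
    exact (h j).symm
  let E : Fin n ≃ Fin n := (Equiv.sigmaFiberEquiv g).symm.trans
    ((Equiv.sigmaCongrRight fun j => (e j).some).trans (Equiv.sigmaFiberEquiv f))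
  refine ⟨E, ?_⟩
  funext v
  simp only [Function.comp_apply, E, Equiv.trans_apply]
  exact ((e (g v)).some ⟨v, rfl⟩).2

theorem card_stab {n k : ℕ} (C : Fin n → Fin k) :
    (Finset.univ.filter fun σ : Equiv.Perm (Fin n) => C ∘ σ = C).card = ∏ j, (szC C j).factorial := by
  have := DomMulAct.stabilizer_card C
  rw [Fintype.card_subtype] at this
  convert this using 2 with j
  rw [szC, Fintype.card_subtype]

theorem XC_lower {n k : ℕ} (C : Fin n → Fin k) (hC : Function.Surjective C)
    (G : SimpleGraph (Fin n)) (σ : Equiv.Perm (Fin n)) (hσ : Proper G (C ∘ σ)) :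
    (∏ j, (szC C j).factorial) *
      (Finset.univ.filter fun ρ : Equiv.Perm (Fin k) => szC C ∘ ρ = szC C).card ≤ XC C G := by
  set A := Finset.univ.filter fun ρ : Equiv.Perm (Fin k) => szC C ∘ ρ = szC C with hA
  have key : ∀ ρ ∈ A, (Finset.univ.filter fun τ : Equiv.Perm (Fin n) =>
      C ∘ τ = ρ ∘ C ∘ σ).card = ∏ j, (szC C j).factorial := by
    intro ρ hρ
    have hρ' : szC C ∘ ρ = szC C := by simpa [hA] using hρ
    obtain ⟨τ, hτ⟩ := exists_perm_of_fibres C (ρ ∘ C ∘ σ) (by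
      intro j
      have h1 : szC (ρ ∘ C ∘ σ) j = szC C (ρ.symm j) := by
        rw [← card_fibre_comp C σ, szC]
        congr 1
        ext v
        simp only [Finset.mem_filter, Finset.mem_univ, true_and, Function.comp_apply]
        exact (Equiv.eq_symm_apply ρ).symm
      rw [h1]
      have := congrFun hρ' (ρ.symm j)
      simpa using this)
    rw [← card_stab]
    refine Finset.card_bij (fun τ' _ => τ' * τ⁻¹) ?_ ?_ ?_
    · intro τ' h
      simp only [Finset.mem_filter, Finset.mem_univ, true_and] at *
      rw [← hτ] at h
      funext v
      have := congrFun h (τ⁻¹ v)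
      simpa using this
    · intro a _ b _ h
      exact mul_right_cancel h
    · intro g hg
      refine ⟨g * τ, ?_, by simp⟩
      simp only [Finset.mem_filter, Finset.mem_univ, true_and] at *
      rw [← hτ]
      funext v
      have := congrFun hg (τ v)
      simpa using this
  have h2 : (A.biUnion fun ρ => Finset.univ.filter fun τ : Equiv.Perm (Fin n) =>
      C ∘ τ = ρ ∘ C ∘ σ) ⊆ Finset.univ.filter fun τ : Equiv.Perm (Fin n) => Proper G (C ∘ τ) := by
    intro τ hτ
    simp only [Finset.mem_biUnion, Finset.mem_filter, Finset.mem_univ, true_and] at *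
    obtain ⟨ρ, _, h⟩ := hτ
    rw [h]
    intro v w hvw he
    exact hσ v w hvw (ρ.injective he)
  have h3 := Finset.card_le_card h2
  rw [Finset.card_biUnion, Finset.sum_congr rfl key, Finset.sum_const, smul_eq_mul, mul_comm] at h3
  · exact h3
  · intro ρ _ ρ' _ hne
    rw [Function.onFun, Finset.disjoint_left]
    intro τ h h'
    simp only [Finset.mem_filter, Finset.mem_univ, true_and] at *
    apply hne
    ext j
    obtain ⟨v, rfl⟩ := (hC.comp σ.surjective) j
    have := congrFun (h.symm.trans h') v
    simp only [Function.comp_apply] at this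
    simp [this]

/-- First moment inequality. -/
theorem first_moment {n k : ℕ} (m : ℕ) (C : Fin n → Fin k) (hC : Function.Surjective C) :
    (((gS n m).filter fun G => ∃ σ : Equiv.Perm (Fin n), Proper G (C ∘ σ)).card : ℝ) *
    (((∏ j, (szC C j).factorial : ℕ) : ℝ) *
      ((Finset.univ.filter fun ρ : Equiv.Perm (Fin k) => szC C ∘ ρ = szC C).card : ℕ)) ≤
    (n.factorial : ℝ) * ((n.choose 2 - fC C).choose m : ℕ) := by
  have h1 := sum_XC m C
  set A := (gS n m).filter fun G => ∃ σ : Equiv.Perm (Fin n), Proper G (C ∘ σ) with hA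
  have h2 : ∑ G ∈ A, XC C G ≤ ∑ G ∈ gS n m, XC C G :=
    Finset.sum_le_sum_of_subset (Finset.filter_subset _ _)
  have h3 : A.card * ((∏ j, (szC C j).factorial) *
      (Finset.univ.filter fun ρ : Equiv.Perm (Fin k) => szC C ∘ ρ = szC C).card) ≤
      ∑ G ∈ A, XC C G := by
    rw [← smul_eq_mul, ← Finset.sum_const]
    refine Finset.sum_le_sum fun G hG => ?_
    obtain ⟨_, σ, hσ⟩ := Finset.mem_filter.1 hG
    exact XC_lower C hC G σ hσ
  have h4 := h3.trans h2
  rw [h1] at h4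
  exact_mod_cast h4

/-- the balanced colouring -/
def C0 (n k : ℕ) (hk : 0 < k) : Fin n → Fin k := fun v => ⟨v % k, Nat.mod_lt _ hk⟩

theorem szC_C0 (n k : ℕ) (hk : 0 < k) (j : Fin k) :
    szC (C0 n k hk) j = n / k + if (j : ℕ) < n % k then 1 else 0 := by
  have h := Nat.count_modEq_card n hk j
  rw [Nat.mod_eq_of_lt j.2, Nat.count_eq_card_filter_range] at h
  rw [← h, szC]
  refine Finset.card_bij (fun v _ => (v : ℕ)) ?_ ?_ ?_
  · intro v hv
    have h1 := congrArg Fin.val (Finset.mem_filter.1 hv).2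
    rw [Finset.mem_filter, Finset.mem_range]
    refine ⟨v.2, ?_⟩
    rw [Nat.ModEq, Nat.mod_eq_of_lt j.2, ← h1]
    rfl
  · intro v _ w _ h; exact Fin.ext h
  · intro v hv
    rw [Finset.mem_filter, Finset.mem_range] at hv
    refine ⟨⟨v, hv.1⟩, ?_, rfl⟩
    have := hv.2
    rw [Nat.ModEq, Nat.mod_eq_of_lt j.2] at this
    exact Finset.mem_filter.2 ⟨Finset.mem_univ _, Fin.ext this⟩

theorem C0_surj (n k : ℕ) (hk : 0 < k) (hkn : k ≤ n) : Function.Surjective (C0 n k hk) := by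
  intro j
  refine ⟨⟨j, lt_of_lt_of_le j.2 hkn⟩, ?_⟩
  ext
  simp [C0, Nat.mod_eq_of_lt j.2]

theorem card_lt_fin (k t : ℕ) (h : t ≤ k) :
    (Finset.univ.filter fun j : Fin k => (j : ℕ) < t).card = t := by
  have : (Finset.univ.filter fun j : Fin k => (j : ℕ) < t) =
      (Finset.univ : Finset (Fin t)).map (Fin.castLEEmb h) := by
    ext j
    simp only [Finset.mem_filter, Finset.mem_univ, true_and, Finset.mem_map]
    constructor
    · intro hj; exact ⟨⟨j, hj⟩, rfl⟩
    · rintro ⟨i, rfl⟩; exact i.2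
  rw [this, Finset.card_map, Finset.card_univ, Fintype.card_fin]

theorem card_not_lt_fin (k t : ℕ) (h : t ≤ k) :
    (Finset.univ.filter fun j : Fin k => ¬ (j : ℕ) < t).card = k - t := by
  have := Finset.card_filter_add_card_filter_not (s := (Finset.univ : Finset (Fin k))) (p := fun j : Fin k => (j : ℕ) < t)
  rw [card_lt_fin k t h, Finset.card_univ, Fintype.card_fin] at this
  omega

/-- type of a class: `1` if large. -/
def tyC (n k : ℕ) (j : Fin k) : Fin 2 := if (j : ℕ) < n % k then 1 else 0

theorem card_ty1 (n k : ℕ) (hk : 0 < k) : szC (tyC n k) 1 = n % k := by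
  rw [szC]
  conv_rhs => rw [← card_lt_fin k (n % k) (Nat.mod_lt _ hk).le]
  congr 1
  ext j
  simp [tyC]

theorem card_ty0 (n k : ℕ) (hk : 0 < k) : szC (tyC n k) 0 = k - n % k := by
  rw [szC]
  conv_rhs => rw [← card_not_lt_fin k (n % k) (Nat.mod_lt _ hk).le]
  congr 1
  ext j
  simp [tyC]

/-- number of pairs inside classes -/
def fk (n k : ℕ) : ℕ := (k - n % k) * (n / k).choose 2 + n % k * (n / k + 1).choose 2

theorem prod_ty {M : Type} [CommMonoid M] (n k : ℕ) (hk : 0 < k) (x y : M) :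
    (∏ j : Fin k, if (j : ℕ) < n % k then x else y) = x ^ (n % k) * y ^ (k - n % k) := by
  rw [Finset.prod_ite, Finset.prod_const, Finset.prod_const, card_lt_fin _ _ (Nat.mod_lt _ hk).le,
    card_not_lt_fin _ _ (Nat.mod_lt _ hk).le]

theorem fC_C0 (n k : ℕ) (hk : 0 < k) : fC (C0 n k hk) = fk n k := by
  rw [fC, fk]
  have : ∀ j : Fin k, (szC (C0 n k hk) j).choose 2 =
      if (j : ℕ) < n % k then (n / k + 1).choose 2 else (n / k).choose 2 := by
    intro j
    rw [szC_C0]; split_ifs <;> simp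
  simp_rw [this]
  rw [Finset.sum_ite, Finset.sum_const, Finset.sum_const, card_lt_fin _ _ (Nat.mod_lt _ hk).le,
    card_not_lt_fin _ _ (Nat.mod_lt _ hk).le]
  simp only [smul_eq_mul]; ring

theorem stab_sz (n k : ℕ) (hk : 0 < k) :
    (Finset.univ.filter fun ρ : Equiv.Perm (Fin k) => szC (C0 n k hk) ∘ ρ = szC (C0 n k hk)).card
      = (k - n % k).factorial * (n % k).factorial := by
  have h1 : ∀ ρ : Equiv.Perm (Fin k), szC (C0 n k hk) ∘ ρ = szC (C0 n k hk) ↔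
      tyC n k ∘ ρ = tyC n k := by
    intro ρ
    rw [funext_iff, funext_iff]
    refine forall_congr' fun j => ?_
    simp only [Function.comp_apply, szC_C0, tyC]
    split_ifs <;> simp
  simp_rw [h1]
  rw [card_stab, Fin.prod_univ_two, card_ty0 n k hk, card_ty1 n k hk]

theorem prod_sz_fact (n k : ℕ) (hk : 0 < k) :
    ∏ j, (szC (C0 n k hk) j).factorial =
      ((n / k + 1).factorial) ^ (n % k) * ((n / k).factorial) ^ (k - n % k) := by
  rw [← prod_ty n k hk]
  refine Finset.prod_congr rfl fun j _ => ?_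
  rw [szC_C0]; split_ifs <;> simp

theorem sum_sz {n k : ℕ} (C : Fin n → Fin k) : ∑ j, szC C j = n := by
  have := Finset.card_eq_sum_card_fiberwise (s := (Finset.univ : Finset (Fin n))) (t := Finset.univ)
    (f := C) (fun _ _ => Finset.mem_coe.2 (Finset.mem_univ _))
  rw [Finset.card_univ, Fintype.card_fin] at this
  exact this.symm

theorem equitable_sizes {n k : ℕ} (hk : 0 < k) (C : Fin n → Fin k)
    (hC : ∀ c c', szC C c ≤ szC C c' + 1) :
    ∃ ρ : Equiv.Perm (Fin k), szC C ∘ ρ = szC (C0 n k hk) := by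
  have : Nonempty (Fin k) := ⟨⟨0, hk⟩⟩
  obtain ⟨j0, hj0⟩ := Finite.exists_min (szC C)
  set μ := szC C j0 with hμ
  have hval : ∀ j, szC C j = μ + if szC C j = μ + 1 then 1 else 0 := by
    intro j
    have := hj0 j
    have := hC j j0
    split_ifs with h <;> omega
  set t := (Finset.univ.filter fun j => szC C j = μ + 1).card with ht
  have hsum := sum_sz C
  rw [Finset.sum_congr rfl fun j _ => hval j, Finset.sum_add_distrib, Finset.sum_const,
    Finset.card_univ, Fintype.card_fin, smul_eq_mul, ← Finset.card_filter] at hsum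
  have htk : t < k := by
    have h1 : t < (Finset.univ : Finset (Fin k)).card := by
      apply Finset.card_lt_card
      rw [Finset.ssubset_univ_iff]
      intro h
      have := Finset.mem_univ j0
      rw [← h] at this
      simp only [Finset.mem_filter, Finset.mem_univ, true_and] at this
      omega
    simpa using h1
  have hdiv : n / k = μ := by
    rw [← hsum, Nat.add_comm, Nat.add_mul_div_left _ _ hk, Nat.div_eq_of_lt htk, zero_add]
  have hmod : n % k = t := by
    rw [← hsum, Nat.add_comm, Nat.add_mul_mod_self_left, Nat.mod_eq_of_lt htk]
  let g : Fin k → Fin 2 := fun j => if szC C j = μ + 1 then 1 else 0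
  have hg1 : szC g 1 = t := by
    rw [szC, ht]; congr 1; ext j; simp [g]
  have hg0 : szC g 0 = k - t := by
    have := sum_sz g
    rw [Fin.sum_univ_two] at this
    omega
  obtain ⟨ρ, hρ⟩ := exists_perm_of_fibres g (tyC n k) (by
    intro j
    fin_cases j
    · simp only [Fin.zero_eta]; rw [card_ty0 n k hk, hg0, hmod]
    · simp only [Fin.mk_one]; rw [card_ty1 n k hk, hg1, hmod])
  refine ⟨ρ, ?_⟩
  funext j
  have h1 := congrFun hρ j
  simp only [Function.comp_apply, g, tyC] at h1 ⊢
  rw [szC_C0, hval, hdiv]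
  congr 1
  by_cases p1 : szC C (ρ j) = μ + 1 <;> by_cases p2 : (j : ℕ) < n % k
  · rw [if_pos p1, if_pos p2]
  · rw [if_pos p1, if_neg p2] at h1; exact absurd h1 (by decide)
  · rw [if_neg p1, if_pos p2] at h1; exact absurd h1 (by decide)
  · rw [if_neg p1, if_neg p2]

theorem equitable_iff {n k : ℕ} (hk : 0 < k) (G : SimpleGraph (Fin n)) :
    HasEquitableColouring G k ↔ ∃ σ : Equiv.Perm (Fin n), Proper G (C0 n k hk ∘ σ) := by
  constructor
  · rintro ⟨C, h1, h2⟩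
    obtain ⟨ρ, hρ⟩ := equitable_sizes hk C h2
    obtain ⟨σ, hσ⟩ := exists_perm_of_fibres (C0 n k hk) (ρ.symm ∘ C) (by
      intro j
      rw [← hρ]
      simp only [Function.comp_apply, szC]
      congr 1
      ext v
      simp only [Finset.mem_filter, Finset.mem_univ, true_and]
      exact (Equiv.symm_apply_eq ρ).symm)
    refine ⟨σ, ?_⟩
    rw [hσ]
    intro v w hvw he
    exact h1 v w hvw (ρ.symm.injective he)
  · rintro ⟨σ, hσ⟩
    refine ⟨C0 n k hk ∘ σ, hσ, ?_⟩
    intro c c'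
    have h1 := card_fibre_comp (C0 n k hk) σ c
    have h2 := card_fibre_comp (C0 n k hk) σ c'
    rw [h1, h2, szC_C0, szC_C0]
    split_ifs <;> omega

/-- first moment of unordered colourings -/
def Dk (n k : ℕ) : ℕ := ((n / k + 1).factorial) ^ (n % k) * ((n / k).factorial) ^ (k - n % k) *
  ((k - n % k).factorial * (n % k).factorial)

/-- probability of properness -/
def Pk (n m k : ℕ) : ℝ := ((n.choose 2 - fk n k).choose m : ℕ) / ((n.choose 2).choose m : ℕ)

/-- expected number of unordered equitable colourings -/
def Ebar (n m k : ℕ) : ℝ := (n.factorial : ℝ) * Pk n m k / (Dk n k : ℝ)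

theorem Dk_pos (n k : ℕ) : 0 < Dk n k := by
  unfold Dk; positivity

theorem Pm_le_Ebar (n m k : ℕ) (hk : 0 < k) (hkn : k ≤ n) :
    Pm n m (fun G => HasEquitableColouring G k) ≤ Ebar n m k := by
  rw [Pm_eq]
  have h := first_moment m (C0 n k hk) (C0_surj n k hk hkn)
  rw [fC_C0, prod_sz_fact, stab_sz] at h
  have e : (gS n m).filter (fun G => HasEquitableColouring G k) =
    (gS n m).filter (fun G => ∃ σ : Equiv.Perm (Fin n), Proper G (C0 n k hk ∘ σ)) := by
    refine Finset.filter_congr fun G _ => equitable_iff hk G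
  rw [e, Ebar, Pk, mul_div_assoc', div_right_comm]
  refine div_le_div_of_nonneg_right ?_ (Nat.cast_nonneg _)
  rw [le_div_iff₀ (by exact_mod_cast Dk_pos n k)]
  refine le_trans (le_of_eq ?_) h
  rw [Dk]; push_cast; ring

/-- second moment ratio as a function of overlap -/
def Rk (n m k s : ℕ) : ℝ := ((n.choose 2 - (2 * fk n k - s)).choose m : ℕ) *
  ((n.choose 2).choose m : ℕ) / (((n.choose 2 - fk n k).choose m : ℕ) : ℝ) ^ 2

theorem Pm_ge (n m k : ℕ) (hk : 0 < k) (hm : 0 < (n.choose 2 - fk n k).choose m) (δ : ℝ)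
    (hR : (∑ σ : Equiv.Perm (Fin n), Rk n m k (sC (C0 n k hk) σ)) ≤ (1 + δ) * n.factorial) :
    1 - δ ≤ Pm n m (fun G => HasEquitableColouring G k) := by
  rw [Pm_eq]
  have h := second_moment m (C0 n k hk)
  rw [fC_C0] at h
  have e : (gS n m).filter (fun G => HasEquitableColouring G k) =
    (gS n m).filter (fun G => ∃ σ : Equiv.Perm (Fin n), Proper G (C0 n k hk ∘ σ)) := by
    refine Finset.filter_congr fun G _ => equitable_iff hk G
  rw [e]
  set A := (((gS n m).filter fun G => ∃ σ : Equiv.Perm (Fin n), Proper G (C0 n k hk ∘ σ)).card : ℝ)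
  unfold Rk at hR
  rw [← Finset.sum_div, ← Finset.sum_mul] at hR
  set S : ℝ := ∑ σ : Equiv.Perm (Fin n),
    (((n.choose 2 - (2 * fk n k - sC (C0 n k hk) σ)).choose m : ℕ) : ℝ)
  set c : ℝ := (((n.choose 2 - fk n k).choose m : ℕ) : ℝ)
  have hc : 0 < c := Nat.cast_pos.2 hm
  set M : ℝ := (((n.choose 2).choose m : ℕ) : ℝ)
  have hM : 0 < M := by
    have : (n.choose 2 - fk n k).choose m ≤ (n.choose 2).choose m :=
      Nat.choose_le_choose _ (Nat.sub_le _ _)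
    have : 0 < (n.choose 2).choose m := by omega
    exact Nat.cast_pos.2 this
  have hn : (0:ℝ) < n.factorial := by exact_mod_cast n.factorial_pos
  have hA : 0 ≤ A := Nat.cast_nonneg _
  rw [div_le_iff₀ (by positivity)] at hR
  push_cast at h
  have h' : n.factorial * c ^ 2 ≤ A * S := by
    have : (n.factorial : ℝ) * (n.factorial * c ^ 2) ≤ n.factorial * (A * S) := by
      calc _ = ((n.factorial : ℝ) * c) ^ 2 := by ring
        _ ≤ _ := h
        _ = _ := by ring
    exact le_of_mul_le_mul_left this hn
  have h2 : M * (n.factorial * c ^ 2) ≤ A * ((1 + δ) * n.factorial * c ^ 2) := by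
    calc _ ≤ M * (A * S) := by gcongr
      _ = A * (S * M) := by ring
      _ ≤ _ := by gcongr
  have h3 : M ≤ A * (1 + δ) := by
    have : (n.factorial * c ^ 2) * M ≤ (n.factorial * c ^ 2) * (A * (1 + δ)) := by
      nlinarith [h2]
    exact le_of_mul_le_mul_left this (by positivity)
  have hAM : A ≤ M := by
    have h1 := Finset.card_filter_le (gS n m) (fun G => ∃ σ : Equiv.Perm (Fin n), Proper G (C0 n k hk ∘ σ))
    rw [card_gS] at h1
    exact Nat.cast_le.2 h1
  have h4 : 1 ≤ A / M * (1 + δ) := by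
    rw [div_mul_eq_mul_div, le_div_iff₀ hM]; linarith
  have h5 : A / M ≤ 1 := (div_le_one hM).2 hAM
  have h6 : 0 ≤ A / M := by positivity
  set x := A / M
  by_cases hδ : 0 ≤ δ
  · nlinarith
  · exfalso
    have hx : 0 < x := by
      rcases h6.lt_or_eq with h | h
      · exact h
      · rw [← h] at h4; linarith
    nlinarith [mul_pos hx (not_le.1 hδ |> neg_pos.2)]

theorem Pm_le_one (n m : ℕ) (E : SimpleGraph (Fin n) → Prop) : Pm n m E ≤ 1 := by
  rw [Pm_eq]
  apply div_le_one_of_le₀ _ (Nat.cast_nonneg _)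
  rw [← card_gS]
  exact_mod_cast Finset.card_filter_le _ _

/-- Combination: two point concentration from moment bounds. -/
theorem two_point_finite (n m K : ℕ) (hn : 0 < n) (hK : K ≤ n) (ε δ : ℝ) (hε : 0 ≤ ε)
    (h1 : ∀ k, 0 < k → k < K → Ebar n m k ≤ ε)
    (h2 : 1 - δ ≤ Pm n m (fun G => HasEquitableColouring G (K + 1))) :
    1 - δ - n * ε ≤ Pm n m (fun G => chiEquitable G = K ∨ chiEquitable G = K + 1) := by
  have hsub : (gS n m).filter (fun G => HasEquitableColouring G (K + 1)) ⊆
      (gS n m).filter (fun G => chiEquitable G = K ∨ chiEquitable G = K + 1) ∪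
      (Finset.Ioo 0 K).biUnion fun k => (gS n m).filter (fun G => HasEquitableColouring G k) := by
    intro G hG
    rw [Finset.mem_filter] at hG
    rw [Finset.mem_union, Finset.mem_filter, Finset.mem_biUnion]
    by_cases h : ∃ k ∈ Finset.Ioo 0 K, HasEquitableColouring G k
    · right
      obtain ⟨k, hk, hk'⟩ := h
      exact ⟨k, hk, Finset.mem_filter.2 ⟨hG.1, hk'⟩⟩
    · left
      refine ⟨hG.1, ?_⟩
      have hle : chiEquitable G ≤ K + 1 := Nat.sInf_le hG.2
      have hmem : HasEquitableColouring G (chiEquitable G) :=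
        Nat.sInf_mem (s := {k | HasEquitableColouring G k}) ⟨K + 1, hG.2⟩
      have h0 : 0 < chiEquitable G := by
        rcases Nat.eq_zero_or_pos (chiEquitable G) with h0 | h0
        · rw [h0] at hmem
          obtain ⟨C, _⟩ := hmem
          exact (C ⟨0, hn⟩).elim0
        · exact h0
      by_contra hcon
      exact h ⟨chiEquitable G, Finset.mem_Ioo.2 ⟨h0, by omega⟩, hmem⟩
  have hc := (Finset.card_le_card hsub).trans (Finset.card_union_le _ _)
  have hc2 := hc.trans (Nat.add_le_add_left (Finset.card_biUnion_le) _)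
  have hc3 : (((gS n m).filter (fun G => HasEquitableColouring G (K + 1))).card : ℝ) ≤
      ((gS n m).filter (fun G => chiEquitable G = K ∨ chiEquitable G = K + 1)).card +
      ∑ k ∈ Finset.Ioo 0 K, (((gS n m).filter (fun G => HasEquitableColouring G k)).card : ℝ) := by
    exact_mod_cast hc2
  have hc4 := div_le_div_of_nonneg_right hc3 (Nat.cast_nonneg ((n.choose 2).choose m) : (0:ℝ) ≤ _)
  rw [add_div, Finset.sum_div] at hc4
  simp_rw [← Pm_eq] at hc4
  have hs : ∑ k ∈ Finset.Ioo 0 K, Pm n m (fun G => HasEquitableColouring G k) ≤ n * ε := by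
    calc _ ≤ ∑ k ∈ Finset.Ioo 0 K, ε := by
            refine Finset.sum_le_sum fun k hk => ?_
            rw [Finset.mem_Ioo] at hk
            exact (Pm_le_Ebar n m k hk.1 (by omega)).trans (h1 k hk.1 hk.2)
      _ = (K - 0 - 1 : ℕ) * ε := by rw [Finset.sum_const, Nat.card_Ioo, nsmul_eq_mul]
      _ ≤ n * ε := by
        gcongr
        omega
  rw [Pm_eq n m (fun G => chiEquitable G = K ∨ chiEquitable G = K + 1)]
  have e : (gS n m).filter (fun G => chiEquitable G = K ∨ chiEquitable G = K + 1) =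
    @Finset.filter _ (fun G => chiEquitable G = K ∨ chiEquitable G = K + 1)
      (fun _ => Classical.propDecidable _) (gS n m) := by
    congr!
  rw [e] at hc4
  linarith

/-- single-edge factor -/
def gq (N m i : ℕ) : ℝ := ((N:ℝ) - m - i) / ((N:ℝ) - i)

theorem gq_pos {N m i : ℕ} (h : i + m < N) : 0 < gq N m i := by
  have h1 : (i:ℝ) + m < N := by exact_mod_cast h
  have h2 : (0:ℝ) ≤ m := Nat.cast_nonneg _
  unfold gq
  apply div_pos <;> linarith

theorem gq_nonneg {N m i : ℕ} (h : i + m ≤ N) : 0 ≤ gq N m i := by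
  have h1 : (i:ℝ) + m ≤ N := by exact_mod_cast h
  have h2 : (0:ℝ) ≤ m := Nat.cast_nonneg _
  unfold gq
  apply div_nonneg <;> linarith

theorem gq_anti {N m i j : ℕ} (hij : i ≤ j) (h : j + m < N) : gq N m j ≤ gq N m i := by
  have h1 : (j:ℝ) + m < N := by exact_mod_cast h
  have h2 : (0:ℝ) ≤ m := Nat.cast_nonneg _
  have h3 : (i:ℝ) ≤ j := by exact_mod_cast hij
  unfold gq
  rw [div_le_div_iff₀ (by linarith) (by linarith)]
  nlinarith

theorem choose_ratio (N m : ℕ) : ∀ j, j + m < N + 1 →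
    (((N - j).choose m : ℕ) : ℝ) = (N.choose m : ℕ) * ∏ i ∈ Finset.range j, gq N m i := by
  intro j
  induction j with
  | zero => simp
  | succ j ih =>
    intro h
    rw [Finset.prod_range_succ, ← mul_assoc, ← ih (by omega)]
    have h1 := Nat.choose_mul_succ_eq (N - (j + 1)) m
    have e1 : N - (j + 1) + 1 = N - j := by omega
    rw [e1] at h1
    have h2 : (((N - (j+1)).choose m : ℕ) : ℝ) * ((N:ℝ) - j) = ((N - j).choose m : ℕ) * ((N:ℝ) - m - j) := by
      have h3 : (((N - (j+1)).choose m : ℕ) : ℝ) * ((N - j : ℕ) : ℝ) =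
        ((N - j).choose m : ℕ) * ((N - j - m : ℕ) : ℝ) := by exact_mod_cast h1
      rw [Nat.cast_sub (by omega), Nat.cast_sub (by omega), Nat.cast_sub (by omega)] at h3
      rw [h3]; ring
    have h4 : (0:ℝ) < (N:ℝ) - j := by
      have : ((j:ℕ):ℝ) + 1 ≤ N := by exact_mod_cast (by omega : j + 1 ≤ N)
      linarith
    rw [gq, mul_div_assoc', eq_div_iff h4.ne', h2]

theorem choose_pos' {N m f : ℕ} (h : f + m ≤ N) : 0 < (N - f).choose m :=
  Nat.choose_pos (by omega)

theorem Pk_eq (n m k : ℕ) (h : fk n k + m ≤ n.choose 2) :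
    Pk n m k = ∏ i ∈ Finset.range (fk n k), gq (n.choose 2) m i := by
  rw [Pk, choose_ratio _ _ _ (by omega), mul_div_cancel_left₀]
  exact_mod_cast (Nat.choose_pos (by omega)).ne'

theorem Rk_eq (n m k s : ℕ) (h : 2 * fk n k + m < n.choose 2) (hs : s ≤ fk n k) :
    Rk n m k s = (∏ j ∈ Finset.range (fk n k - s), gq (n.choose 2) m (fk n k + j)) /
      ∏ i ∈ Finset.range (fk n k), gq (n.choose 2) m i := by
  set f := fk n k
  set N := n.choose 2
  have h1 := choose_ratio N m (2 * f - s) (by omega)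
  have h2 := choose_ratio N m f (by omega)
  have e : 2 * f - s = f + (f - s) := by omega
  rw [Rk, h1, h2, e, Finset.prod_range_add]
  have hP : 0 < ∏ i ∈ Finset.range f, gq N m i := Finset.prod_pos fun i hi => gq_pos (by
    rw [Finset.mem_range] at hi; omega)
  have hN : (0:ℝ) < (N.choose m : ℕ) := by exact_mod_cast (Nat.choose_pos (by omega))
  change _ * _ * ((N.choose m : ℕ) : ℝ) / _ = _
  field_simp

/-- the two bases -/
def bp (n m k : ℕ) : ℝ := 1 / gq (n.choose 2) m (fk n k)

/-- drift -/
def mu (n m k : ℕ) : ℝ := (fk n k : ℝ) * m / (((n.choose 2 : ℕ) - m : ℝ) * (n.choose 2 : ℕ))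

/-- upper base -/
def bB (n m k : ℕ) : ℝ := bp n m k * Real.exp (mu n m k)

theorem Rk_le2 (n m k s : ℕ) (h : 2 * fk n k + m < n.choose 2) (hs : s ≤ fk n k) :
    Rk n m k s ≤ bp n m k ^ s / (Pk n m k * bp n m k ^ fk n k) := by
  rw [Rk_eq n m k s h hs, Pk_eq n m k (by omega)]
  set f := fk n k
  set N := n.choose 2
  have hP : 0 < ∏ i ∈ Finset.range f, gq N m i := Finset.prod_pos fun i hi => gq_pos (by
    rw [Finset.mem_range] at hi; omega)
  have hg : 0 < gq N m f := gq_pos (by omega)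
  have h1 : (∏ j ∈ Finset.range (f - s), gq N m (f + j)) ≤ gq N m f ^ (f - s) := by
    calc _ ≤ ∏ j ∈ Finset.range (f - s), gq N m f := by
          refine Finset.prod_le_prod (fun j hj => ?_) fun j hj => ?_
          · rw [Finset.mem_range] at hj; exact gq_nonneg (by omega)
          · rw [Finset.mem_range] at hj; exact gq_anti (by omega) (by omega)
      _ = _ := by simp
  have h2 : bp n m k ^ s / bp n m k ^ f = gq N m f ^ (f - s) := by
    have : f = s + (f - s) := by omega
    conv_lhs => rw [this, pow_add]
    rw [show bp n m k = (gq N m f)⁻¹ from one_div _, inv_pow, inv_pow]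
    field_simp
  rw [mul_comm, ← div_div, h2]
  gcongr

theorem Rk_le1 (n m k s : ℕ) (h : 2 * fk n k + m < n.choose 2) (hs : s ≤ fk n k) :
    Rk n m k s ≤ Real.exp (-(mu n m k * fk n k)) * bB n m k ^ s := by
  rw [Rk_eq n m k s h hs, bB, bp]
  unfold mu
  set f := fk n k
  set N := n.choose 2
  set μ : ℝ := (f:ℝ) * m / (((N:ℕ) - m : ℝ) * (N:ℕ)) with hμ
  have hP : ∀ i, i ≤ f → 0 < gq N m i := fun i hi => gq_pos (by omega)
  have hg : 0 < gq N m f := gq_pos (by omega)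
  have e : f = (f - s) + s := by omega
  have e1 : ∏ i ∈ Finset.range f, gq N m i = (∏ i ∈ Finset.range (f - s), gq N m i) *
      ∏ i ∈ Finset.range s, gq N m (f - s + i) := by
    conv_lhs => rw [e, Finset.prod_range_add]
  rw [e1, ← div_div, ← Finset.prod_div_distrib]
  have h1 : ∏ j ∈ Finset.range (f - s), (gq N m (f + j) / gq N m j) ≤ Real.exp (-μ) ^ (f - s) := by
    calc _ ≤ ∏ j ∈ Finset.range (f - s), Real.exp (-μ) := by
          refine Finset.prod_le_prod (fun j hj => ?_) fun j hj => ?_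
          · rw [Finset.mem_range] at hj
            exact div_nonneg (gq_nonneg (by omega)) (gq_nonneg (by omega))
          · rw [Finset.mem_range] at hj
            have h2 : (2 * (f:ℝ)) + m < N := by exact_mod_cast h
            have h3 : (j:ℝ) < f := by exact_mod_cast (by omega : j < f)
            have h4 : (0:ℝ) ≤ m := Nat.cast_nonneg _
            have h5 : (0:ℝ) ≤ j := Nat.cast_nonneg _
            refine le_trans ?_ (Real.add_one_le_exp _)
            unfold gq
            push_cast
            rw [div_div_div_eq, div_le_iff₀ (by apply mul_pos <;> linarith)]
            have h6 : μ * (((N:ℝ) - (f + j)) * ((N:ℝ) - m - j)) ≤ f * m := by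
              rw [hμ, div_mul_eq_mul_div, div_le_iff₀ (by apply mul_pos <;> linarith)]
              apply mul_le_mul_of_nonneg_left _ (by positivity)
              rw [mul_comm]
              apply mul_le_mul <;> linarith
            nlinarith
      _ = _ := by simp
  have h2 : gq N m f ^ s ≤ ∏ i ∈ Finset.range s, gq N m (f - s + i) := by
    calc gq N m f ^ s = ∏ i ∈ Finset.range s, gq N m f := by simp
      _ ≤ _ := by
        refine Finset.prod_le_prod (fun j hj => hg.le) fun j hj => ?_
        rw [Finset.mem_range] at hj
        exact gq_anti (by omega) (by omega)
  calc _ ≤ Real.exp (-μ) ^ (f - s) / gq N m f ^ s := by gcongr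
    _ = _ := by
      have e3 : Real.exp (-μ) ^ (f - s) = Real.exp (-(μ * f)) * Real.exp μ ^ s := by
        rw [← Real.exp_nat_mul, ← Real.exp_nat_mul, ← Real.exp_add, Nat.cast_sub hs]
        congr 1; ring
      rw [e3, mul_pow, one_div, inv_pow]; field_simp

theorem Pk_le (n m k : ℕ) (h : 2 * fk n k + m < n.choose 2) :
    Pk n m k ≤ gq (n.choose 2) m 0 ^ fk n k := by
  rw [Pk_eq n m k (by omega)]
  calc _ ≤ ∏ i ∈ Finset.range (fk n k), gq (n.choose 2) m 0 := by
        refine Finset.prod_le_prod (fun j hj => ?_) fun j hj => ?_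
        · rw [Finset.mem_range] at hj; exact gq_nonneg (by omega)
        · rw [Finset.mem_range] at hj; exact gq_anti (by omega) (by omega)
    _ = _ := by simp

theorem Pk_ge (n m k : ℕ) (h : 2 * fk n k + m < n.choose 2) :
    (1 / bp n m k) ^ fk n k ≤ Pk n m k := by
  rw [Pk_eq n m k (by omega)]
  calc _ = ∏ i ∈ Finset.range (fk n k), gq (n.choose 2) m (fk n k) := by simp [bp]
    _ ≤ _ := by
        refine Finset.prod_le_prod (fun j hj => gq_nonneg (by omega)) fun j hj => ?_
        rw [Finset.mem_range] at hj
        exact gq_anti (by omega) (by omega)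

theorem Pk_pos (n m k : ℕ) (h : 2 * fk n k + m < n.choose 2) : 0 < Pk n m k := by
  rw [Pk_eq n m k (by omega)]
  exact Finset.prod_pos fun i hi => gq_pos (by rw [Finset.mem_range] at hi; omega)

theorem card_perm_agree {n : ℕ} {K : Type} [Fintype K] (x y : K → Fin n)
    (hx : Function.Injective x) :
    (Finset.univ.filter fun σ : Equiv.Perm (Fin n) => ∀ κ, σ (x κ) = y κ).card ≤
      (n - Fintype.card K).factorial := by
  by_cases h : ∃ σ0 : Equiv.Perm (Fin n), ∀ κ, σ0 (x κ) = y κ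
  · obtain ⟨σ0, h0⟩ := h
    have hc : Fintype.card {v : Fin n // ¬ v ∈ Set.range x} = n - Fintype.card K := by
      rw [Fintype.card_subtype_compl, Fintype.card_fin]
      congr 1
      exact Set.card_range_of_injective hx
    rw [← hc, ← Fintype.card_perm, Fintype.card_congr
      (Equiv.Perm.subtypeEquivSubtypePerm fun v : Fin n => ¬ v ∈ Set.range x)]
    rw [← Fintype.card_coe]
    refine Fintype.card_le_of_injective (fun σ => ⟨σ0⁻¹ * σ.1, ?_⟩) ?_
    · intro a ha
      rw [not_not] at ha
      obtain ⟨κ, rfl⟩ := ha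
      have := (Finset.mem_filter.1 σ.2).2 κ
      rw [Equiv.Perm.mul_apply, this, ← h0]
      simp
    · intro σ τ hst
      have := congrArg Subtype.val hst
      exact Subtype.ext (mul_left_cancel this)
  · rw [Finset.card_eq_zero.2]
    · exact Nat.zero_le _
    · rw [Finset.filter_eq_empty_iff]
      intro σ _ hσ
      exact h ⟨σ, hσ⟩

theorem lemma4 {n k : ℕ} (C : Fin n → Fin k) (T : Fin k × Fin k → ℕ) :
    (∑ σ : Equiv.Perm (Fin n), ∏ p : Fin k × Fin k, (rC C σ p.1 p.2).descFactorial (T p)) *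
      n.descFactorial (∑ p, T p) ≤
    n.factorial * ∏ p : Fin k × Fin k,
      (szC C p.1).descFactorial (T p) * (szC C p.2).descFactorial (T p) := by
  let XX := ∀ p : Fin k × Fin k, (Fin (T p) ↪ {v : Fin n // C v = p.1})
  let YY := ∀ p : Fin k × Fin k, (Fin (T p) ↪ {v : Fin n // C v = p.2})
  let K := Σ p : Fin k × Fin k, Fin (T p)
  have hK : Fintype.card K = ∑ p, T p := by simp [K]
  let fx : XX → K → Fin n := fun x κ => (x κ.1 κ.2).1
  let fy : YY → K → Fin n := fun x κ => (x κ.1 κ.2).1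
  let Z : Equiv.Perm (Fin n) → Type := fun σ =>
    ∀ p : Fin k × Fin k, (Fin (T p) ↪ {v : Fin n // C v = p.1 ∧ C (σ v) = p.2})
  have hZ : ∀ σ, Fintype.card (Z σ) = ∏ p : Fin k × Fin k, (rC C σ p.1 p.2).descFactorial (T p) := by
    intro σ
    simp only [Z]
    rw [Fintype.card_pi]
    refine Finset.prod_congr rfl fun p _ => ?_
    rw [Fintype.card_embedding_eq, Fintype.card_fin, Fintype.card_subtype, rC]
  have hX : Fintype.card XX = ∏ p : Fin k × Fin k, (szC C p.1).descFactorial (T p) := by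
    simp only [XX]
    rw [Fintype.card_pi]
    refine Finset.prod_congr rfl fun p _ => ?_
    rw [Fintype.card_embedding_eq, Fintype.card_fin, Fintype.card_subtype, szC]
  have hY : Fintype.card YY = ∏ p : Fin k × Fin k, (szC C p.2).descFactorial (T p) := by
    simp only [YY]
    rw [Fintype.card_pi]
    refine Finset.prod_congr rfl fun p _ => ?_
    rw [Fintype.card_embedding_eq, Fintype.card_fin, Fintype.card_subtype, szC]
  let good : Equiv.Perm (Fin n) → XX × YY → Prop := fun σ q =>
    Function.Injective (fx q.1) ∧ ∀ κ, σ (fx q.1 κ) = fy q.2 κ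
  have h1 : ∀ σ, Fintype.card (Z σ) ≤ (Finset.univ.filter (good σ)).card := by
    intro σ
    rw [← Finset.card_univ]
    refine Finset.card_le_card_of_injOn (fun z : Z σ =>
      ((fun p => ⟨fun t => ⟨(z p t).1, (z p t).2.1⟩, fun a b hab => (z p).injective
          (Subtype.ext (congrArg (fun w : {v : Fin n // C v = p.1} => w.1) hab))⟩ : XX),
       (fun p => ⟨fun t => ⟨σ (z p t).1, (z p t).2.2⟩, fun a b hab => (z p).injective
          (Subtype.ext (σ.injective (congrArg (fun w : {v : Fin n // C v = p.2} => w.1) hab)))⟩ : YY))) ?_ ?_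
    · intro z _
      simp only [Finset.coe_filter, Finset.mem_univ, true_and, Set.mem_ofPred_eq]
      refine ⟨?_, fun κ => rfl⟩
      rintro ⟨p, t⟩ ⟨p', t'⟩ h
      have h : (z p t).1 = (z p' t').1 := h
      have hp : p = p' := by
        have a1 := (z p t).2
        have a2 := (z p' t').2
        rw [h] at a1
        exact Prod.ext (a1.1.symm.trans a2.1) (a1.2.symm.trans a2.2)
      subst hp
      have := (z p).injective (Subtype.ext h)
      rw [this]
    · intro z _ z' _ h
      funext p
      ext t : 1
      have := congrFun (congrArg Prod.fst h) p
      have := congrArg (fun e : (Fin (T p) ↪ {v : Fin n // C v = p.1}) => (e t).1) this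
      exact Subtype.ext this
  by_cases hKn : ∑ p, T p ≤ n
  · have h2 : ∑ σ : Equiv.Perm (Fin n), Fintype.card (Z σ) ≤
        Fintype.card XX * Fintype.card YY * (n - ∑ p, T p).factorial := by
      calc _ ≤ ∑ σ : Equiv.Perm (Fin n), (Finset.univ.filter (good σ)).card :=
            Finset.sum_le_sum fun σ _ => h1 σ
        _ = ∑ q : XX × YY, (Finset.univ.filter fun σ => good σ q).card := by
            simp_rw [Finset.card_filter]
            rw [Finset.sum_comm]
        _ ≤ ∑ q : XX × YY, (n - ∑ p, T p).factorial := by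
            refine Finset.sum_le_sum fun q _ => ?_
            by_cases hq : Function.Injective (fx q.1)
            · rw [← hK]
              refine le_trans (le_of_eq ?_) (card_perm_agree (fx q.1) (fy q.2) hq)
              congr 1
              ext σ
              simp [good, hq]
            · rw [Finset.card_eq_zero.2]
              · exact Nat.zero_le _
              · rw [Finset.filter_eq_empty_iff]
                intro σ _ hσ
                exact hq hσ.1
        _ = _ := by
            rw [Finset.sum_const, Finset.card_univ, Fintype.card_prod, smul_eq_mul]
    rw [Finset.sum_congr rfl fun σ _ => hZ σ] at h2
    calc _ ≤ Fintype.card XX * Fintype.card YY * (n - ∑ p, T p).factorial * n.descFactorial (∑ p, T p) :=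
          Nat.mul_le_mul_right _ h2
      _ = _ := by
          rw [mul_assoc, Nat.factorial_mul_descFactorial hKn, hX, hY, ← Finset.prod_mul_distrib,
            mul_comm]
  · rw [Nat.descFactorial_of_lt (by omega : n < ∑ p, T p), mul_zero]
    exact Nat.zero_le _

/-- coefficients for small entries -/
def bt (β : ℝ) (t : ℕ) : ℝ :=
  if t = 0 then 1 else if t = 1 then 0 else if t = 2 then β - 1 else β ^ t.choose 2

theorem bt_nonneg {β : ℝ} (hβ : 1 ≤ β) (t : ℕ) : 0 ≤ bt β t := by
  unfold bt; split_ifs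
  · norm_num
  · norm_num
  · linarith
  · positivity

theorem bt_expand {β : ℝ} (hβ : 1 ≤ β) (r τ : ℕ) (h : r ≤ τ) :
    β ^ r.choose 2 ≤ ∑ t ∈ Finset.range (τ + 1), bt β t * (r.choose t : ℝ) := by
  have hnn : ∀ t, 0 ≤ bt β t * (r.choose t : ℝ) := fun t =>
    mul_nonneg (bt_nonneg hβ t) (Nat.cast_nonneg _)
  have h0 : ({0, r} : Finset ℕ) ⊆ Finset.range (τ + 1) := by
    intro x hx; simp at hx ⊢; omega
  refine le_trans ?_ (Finset.sum_le_sum_of_subset_of_nonneg h0 fun t _ _ => hnn t)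
  by_cases hr0 : r = 0
  · subst hr0; simp [bt]
  · rw [Finset.sum_pair (by omega)]
    by_cases hr1 : r = 1
    · subst hr1; simp [bt]
    · by_cases hr2 : r = 2
      · subst hr2; simp [bt]
      · have : bt β r = β ^ r.choose 2 := by simp [bt, hr0, hr1, hr2]
        rw [this]; simp [bt]

/-- type of data for one row -/
abbrev RowD (k : ℕ) := Option (Fin k × ℕ)

/-- summation range -/
def rowR {k : ℕ} (τ : ℕ) (o : RowD k) (j : Fin k) : Finset ℕ :=
  match o with
  | none => Finset.range (τ + 1)
  | some (j', ρ) => {if j = j' then ρ else 0}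

/-- coefficient -/
def rowC {k : ℕ} (β : ℝ) (a : ℕ) (o : RowD k) (j : Fin k) (t : ℕ) : ℝ :=
  match o with
  | none => bt β t
  | some (j', ρ) => if j = j' then β ^ (ρ.choose 2 + (a - ρ).choose 2) else 1

/-- the permutation has given data -/
def HasData {n k : ℕ} (C : Fin n → Fin k) (τ : ℕ) (σ : Equiv.Perm (Fin n))
    (D : Fin k → RowD k) : Prop :=
  ∀ i, match D i with
    | none => ∀ j, rC C σ i j ≤ τ
    | some (j, ρ) => rC C σ i j = ρ

theorem rowC_nonneg {k : ℕ} {β : ℝ} (hβ : 1 ≤ β) (a : ℕ) (o : RowD k) (j : Fin k) (t : ℕ) :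
    0 ≤ rowC β a o j t := by
  unfold rowC
  split
  · exact bt_nonneg hβ t
  · split_ifs <;> positivity

theorem sum_rC {n k : ℕ} (C : Fin n → Fin k) (σ : Equiv.Perm (Fin n)) (i : Fin k) :
    ∑ j, rC C σ i j = szC C i := by
  have := Finset.card_eq_sum_card_fiberwise (s := Finset.univ.filter fun v => C v = i)
    (t := Finset.univ) (f := fun v => C (σ v)) (fun _ _ => Finset.mem_coe.2 (Finset.mem_univ _))
  rw [szC, this]
  refine Finset.sum_congr rfl fun j _ => ?_
  rw [rC, Finset.filter_filter]

theorem sum_rC' {n k : ℕ} (C : Fin n → Fin k) (σ : Equiv.Perm (Fin n)) (j : Fin k) :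
    ∑ i, rC C σ i j = szC C j := by
  have := Finset.card_eq_sum_card_fiberwise (s := Finset.univ.filter fun v => C (σ v) = j)
    (t := Finset.univ) (f := fun v => C v) (fun _ _ => Finset.mem_coe.2 (Finset.mem_univ _))
  rw [← card_fibre_comp C σ j]
  simp only [Function.comp_apply]
  rw [this]
  refine Finset.sum_congr rfl fun i _ => ?_
  rw [rC, Finset.filter_filter]
  congr 1
  ext v
  simp [and_comm]

theorem choose_two_superadd (x y : ℕ) : x.choose 2 + y.choose 2 ≤ (x + y).choose 2 := by
  rw [Nat.add_choose_eq]
  simp [Finset.Nat.antidiagonal_succ]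
  omega

theorem sum_choose_two_le {ι : Type} (s : Finset ι) (r : ι → ℕ) :
    ∑ i ∈ s, (r i).choose 2 ≤ (∑ i ∈ s, r i).choose 2 := by
  induction s using Finset.induction_on with
  | empty => simp
  | insert i s hi ih =>
    rw [Finset.sum_insert hi, Finset.sum_insert hi]
    exact (Nat.add_le_add_left ih _).trans (choose_two_superadd _ _)

theorem pointwise {n k : ℕ} (C : Fin n → Fin k) (τ : ℕ) (β : ℝ) (hβ : 1 ≤ β)
    (σ : Equiv.Perm (Fin n)) (D : Fin k → RowD k) (h : HasData C τ σ D) :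
    β ^ sC C σ ≤ ∏ p : Fin k × Fin k, ∑ t ∈ rowR τ (D p.1) p.2,
      rowC β (szC C p.1) (D p.1) p.2 t * ((rC C σ p.1 p.2).choose t : ℝ) := by
  rw [Fintype.prod_prod_type, sC, ← Finset.prod_pow_eq_pow_sum]
  refine Finset.prod_le_prod (fun i _ => by positivity) fun i _ => ?_
  have hi := h i
  cases hD : D i with
  | none =>
    rw [hD] at hi
    simp only at hi
    rw [← Finset.prod_pow_eq_pow_sum]
    refine Finset.prod_le_prod (fun j _ => by positivity) fun j _ => ?_
    have := bt_expand hβ _ _ (hi j)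
    simpa only [hD, rowR, rowC] using this
  | some q =>
    obtain ⟨j', ρ⟩ := q
    rw [hD] at hi
    simp only at hi
    simp only [hD, rowR, rowC, Finset.sum_singleton]
    rw [Fintype.prod_eq_single j']
    · simp only [if_true, hi, Nat.choose_self, Nat.cast_one, mul_one]
      refine pow_le_pow_right₀ hβ ?_
      rw [← Finset.add_sum_erase _ _ (Finset.mem_univ j'), hi]
      refine Nat.add_le_add_left ((sum_choose_two_le _ _).trans ?_) _
      have := sum_rC C σ i
      rw [← Finset.add_sum_erase _ _ (Finset.mem_univ j'), hi] at this
      rw [← this]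
      simp
    · intro j hj
      simp [hj]

/-- mass of fixed rows -/
def rowM {k : ℕ} (o : RowD k) : ℕ := match o with
  | none => 0
  | some (_, ρ) => ρ

/-- weight of a row -/
def rowW {n k : ℕ} (C : Fin n → Fin k) (β : ℝ) (τ : ℕ) (y : ℝ) (o : RowD k) (i : Fin k) : ℝ :=
  match o with
  | none => ∏ j, ∑ t ∈ Finset.range (τ + 1),
      bt β t * ((szC C i).descFactorial t : ℝ) * ((szC C j).descFactorial t : ℝ) / (t.factorial : ℝ) * y ^ t
  | some (j, ρ) => β ^ (ρ.choose 2 + (szC C i - ρ).choose 2) * ((szC C i).descFactorial ρ : ℝ)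
      * ((szC C j).descFactorial ρ : ℝ) / (ρ.factorial : ℝ)

/-- available mass -/
def rowU {n k : ℕ} (C : Fin n → Fin k) (o : RowD k) (i : Fin k) : ℕ := match o with
  | none => szC C i
  | some _ => 0

/-- free mass of T in a row -/
def rowT {k : ℕ} (o : RowD k) (x : ℕ) : ℕ := match o with
  | none => x
  | some _ => 0

theorem expand_sum {n k : ℕ} (C : Fin n → Fin k) (τ : ℕ) (β y : ℝ)
    (D : Fin k → RowD k) :
    ∑ T ∈ Fintype.piFinset fun p : Fin k × Fin k => rowR τ (D p.1) p.2,
      (∏ p : Fin k × Fin k, rowC β (szC C p.1) (D p.1) p.2 (T p) *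
        ((szC C p.1).descFactorial (T p) : ℝ) * ((szC C p.2).descFactorial (T p) : ℝ) /
          ((T p).factorial : ℝ)) * y ^ (∑ p : Fin k × Fin k, rowT (D p.1) (T p))
    = ∏ i, rowW C β τ y (D i) i := by
  simp_rw [← Finset.prod_pow_eq_pow_sum, ← Finset.prod_mul_distrib]
  rw [← Finset.prod_univ_sum (fun p : Fin k × Fin k => rowR τ (D p.1) p.2) (fun p t =>
    rowC β (szC C p.1) (D p.1) p.2 t *
        ((szC C p.1).descFactorial t : ℝ) * ((szC C p.2).descFactorial t : ℝ) /
          (t.factorial : ℝ) * y ^ rowT (D p.1) t)]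
  rw [Fintype.prod_prod_type]
  refine Finset.prod_congr rfl fun i _ => ?_
  cases hD : D i with
  | none => simp [hD, rowW, rowR, rowC, rowT]
  | some q =>
    obtain ⟨j', ρ⟩ := q
    simp only [hD, rowR, rowC, Finset.sum_singleton, rowT, pow_zero, mul_one, rowW]
    rw [Fintype.prod_eq_single j']
    · simp
    · intro j hj; simp [hj]

theorem main_term {n k : ℕ} (C : Fin n → Fin k) (τ : ℕ) (β : ℝ) (hβ : 1 ≤ β)
    (D : Fin k → RowD k) (K1 K2 y1 y2 : ℝ)
    (hRu : ∑ i, rowM (D i) + ∑ i, rowU C (D i) i ≤ n)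
    (hK : ∀ T ≤ ∑ i, rowU C (D i) i,
      1 ≤ ((n - ∑ i, rowM (D i)).descFactorial T : ℝ) * (K1 * y1 ^ T + K2 * y2 ^ T))
    (hK1 : 0 ≤ K1) (hK2 : 0 ≤ K2) (hy1 : 0 ≤ y1) (hy2 : 0 ≤ y2) :
    ∑ σ ∈ Finset.univ.filter (fun σ : Equiv.Perm (Fin n) => HasData C τ σ D), β ^ sC C σ ≤
    (n.factorial : ℝ) / (n.descFactorial (∑ i, rowM (D i)) : ℝ) *
      (K1 * ∏ i, rowW C β τ y1 (D i) i + K2 * ∏ i, rowW C β τ y2 (D i) i) := by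
  set R := ∑ i, rowM (D i) with hR
  set u := ∑ i, rowU C (D i) i with hu
  set PP := Fintype.piFinset fun p : Fin k × Fin k => rowR τ (D p.1) p.2 with hPP
  set Q := PP.filter fun T => ∑ p : Fin k × Fin k, rowT (D p.1) (T p) ≤ u with hQ
  -- weights
  set cc : (Fin k × Fin k → ℕ) → ℝ := fun T => ∏ p : Fin k × Fin k,
    rowC β (szC C p.1) (D p.1) p.2 (T p) with hcc
  have hcc0 : ∀ T, 0 ≤ cc T := fun T => Finset.prod_nonneg fun p _ => rowC_nonneg hβ _ _ _ _
  have step1 : ∀ σ ∈ Finset.univ.filter (fun σ : Equiv.Perm (Fin n) => HasData C τ σ D),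
      β ^ sC C σ ≤ ∑ T ∈ Q, cc T * ∏ p : Fin k × Fin k, ((rC C σ p.1 p.2).choose (T p) : ℝ) := by
    intro σ hσ
    refine (pointwise C τ β hβ σ D (Finset.mem_filter.1 hσ).2).trans (le_of_eq ?_)
    rw [Finset.prod_univ_sum]
    simp_rw [Finset.prod_mul_distrib]
    rw [hQ, Finset.sum_filter_of_ne]
    intro T hT hne
    by_contra hlt
    rw [not_le] at hlt
    apply hne
    have : ∃ p : Fin k × Fin k, rC C σ p.1 p.2 < T p := by
      by_contra hall
      push Not at hall
      have : ∑ p : Fin k × Fin k, rowT (D p.1) (T p) ≤ u := by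
        rw [Fintype.sum_prod_type, hu]
        refine Finset.sum_le_sum fun i _ => ?_
        cases hD : D i with
        | none =>
          simp only [hD, rowT, rowU]
          rw [← sum_rC C σ i]
          exact Finset.sum_le_sum fun j _ => hall (i, j)
        | some q => simp [hD, rowT]
      omega
    obtain ⟨p, hp⟩ := this
    apply mul_eq_zero_of_right
    apply Finset.prod_eq_zero (Finset.mem_univ p)
    rw [Nat.choose_eq_zero_of_lt hp, Nat.cast_zero]
  have hRdesc : (0:ℝ) < n.descFactorial R := by
    exact_mod_cast Nat.descFactorial_pos.2 (by omega : R ≤ n)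
  -- sums of T
  have hsumT : ∀ T ∈ PP, ∑ p, T p = R + ∑ p : Fin k × Fin k, rowT (D p.1) (T p) := by
    intro T hT
    rw [hPP, Fintype.mem_piFinset] at hT
    rw [Fintype.sum_prod_type, Fintype.sum_prod_type, hR, ← Finset.sum_add_distrib]
    refine Finset.sum_congr rfl fun i _ => ?_
    cases hD : D i with
    | none => simp [hD, rowM, rowT]
    | some q =>
      obtain ⟨j', ρ⟩ := q
      simp only [hD, rowM, rowT, Finset.sum_const_zero, add_zero]
      rw [Fintype.sum_eq_single j']
      · have := hT (i, j'); simp only [hD, rowR] at this; simpa using this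
      · intro j hj
        have := hT (i, j); simp only [hD, rowR] at this; simpa [hj] using this
  set gg : (Fin k × Fin k → ℕ) → ℝ := fun T => ∏ p : Fin k × Fin k,
    (rowC β (szC C p.1) (D p.1) p.2 (T p) *
        ((szC C p.1).descFactorial (T p) : ℝ) * ((szC C p.2).descFactorial (T p) : ℝ) /
          ((T p).factorial : ℝ)) with hgg
  have hgg0 : ∀ T, 0 ≤ gg T := fun T => Finset.prod_nonneg fun p _ => by
    have := rowC_nonneg hβ (szC C p.1) (D p.1) p.2 (T p)
    positivity
  have step2 : ∀ T ∈ Q, cc T * ∑ σ : Equiv.Perm (Fin n),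
      ∏ p : Fin k × Fin k, ((rC C σ p.1 p.2).choose (T p) : ℝ) ≤
      (n.factorial : ℝ) / (n.descFactorial R : ℝ) * (gg T *
        (K1 * y1 ^ (∑ p : Fin k × Fin k, rowT (D p.1) (T p)) +
         K2 * y2 ^ (∑ p : Fin k × Fin k, rowT (D p.1) (T p)))) := by
    intro T hT
    rw [hQ, Finset.mem_filter] at hT
    obtain ⟨hT1, hT2⟩ := hT
    have hs := hsumT T hT1
    set tt := ∑ p : Fin k × Fin k, rowT (D p.1) (T p) with htt
    have h4 := lemma4 C T
    rw [hs] at h4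
    have hdesc : n.descFactorial (R + tt) = n.descFactorial R * (n - R).descFactorial tt := by
      have := Nat.descFactorial_mul_descFactorial (n := n) (k := R) (m := R + tt) (by omega)
      rw [Nat.add_sub_cancel_left] at this
      rw [← this, mul_comm]
    rw [hdesc] at h4
    have h4' : (∑ σ : Equiv.Perm (Fin n), ∏ p : Fin k × Fin k,
        ((rC C σ p.1 p.2).descFactorial (T p) : ℝ)) *
        ((n.descFactorial R : ℝ) * ((n - R).descFactorial tt : ℝ)) ≤
        n.factorial * ∏ p : Fin k × Fin k,
          ((szC C p.1).descFactorial (T p) : ℝ) * ((szC C p.2).descFactorial (T p) : ℝ) := by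
      exact_mod_cast h4
    have hch : ∀ σ : Equiv.Perm (Fin n), ∏ p : Fin k × Fin k, ((rC C σ p.1 p.2).choose (T p) : ℝ) =
        (∏ p : Fin k × Fin k, ((rC C σ p.1 p.2).descFactorial (T p) : ℝ)) /
          ∏ p : Fin k × Fin k, ((T p).factorial : ℝ) := by
      intro σ
      rw [← Finset.prod_div_distrib]
      refine Finset.prod_congr rfl fun p _ => ?_
      rw [Nat.descFactorial_eq_factorial_mul_choose, Nat.cast_mul, mul_div_cancel_left₀]
      exact_mod_cast (Nat.factorial_pos _).ne'
    simp_rw [hch]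
    rw [← Finset.sum_div]
    have hggcc : gg T = cc T * (∏ p : Fin k × Fin k,
          ((szC C p.1).descFactorial (T p) : ℝ) * ((szC C p.2).descFactorial (T p) : ℝ)) /
          ∏ p : Fin k × Fin k, ((T p).factorial : ℝ) := by
      rw [hgg, hcc]
      simp only
      rw [← Finset.prod_mul_distrib, ← Finset.prod_div_distrib]
      exact Finset.prod_congr rfl fun p _ => by ring
    rw [hggcc]
    set F : ℝ := ∏ p : Fin k × Fin k, ((T p).factorial : ℝ) with hF
    have hFpos : 0 < F := Finset.prod_pos fun p _ => by exact_mod_cast Nat.factorial_pos _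
    set S : ℝ := ∑ σ : Equiv.Perm (Fin n), ∏ p : Fin k × Fin k,
        ((rC C σ p.1 p.2).descFactorial (T p) : ℝ) with hS
    set A : ℝ := ∏ p : Fin k × Fin k,
          ((szC C p.1).descFactorial (T p) : ℝ) * ((szC C p.2).descFactorial (T p) : ℝ)
    set dR : ℝ := (n.descFactorial R : ℝ)
    set dt : ℝ := ((n - R).descFactorial tt : ℝ)
    have hkk := hK tt hT2
    set kk : ℝ := K1 * y1 ^ tt + K2 * y2 ^ tt
    have hkk0 : 0 ≤ kk := by positivity
    have hS0 : 0 ≤ S := Finset.sum_nonneg fun σ _ => Finset.prod_nonneg fun p _ => Nat.cast_nonneg _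
    have hSb : S ≤ n.factorial / dR * (A * kk) := by
      rw [div_mul_eq_mul_div, le_div_iff₀ hRdesc]
      calc S * dR ≤ S * dR * (dt * kk) := le_mul_of_one_le_right (by positivity) hkk
        _ = (S * (dR * dt)) * kk := by ring
        _ ≤ (n.factorial * A) * kk := by gcongr
        _ = _ := by ring
    calc cc T * (S / F) ≤ cc T * ((n.factorial / dR * (A * kk)) / F) := by
          have := hcc0 T
          gcongr
      _ = _ := by ring
  calc _ ≤ ∑ σ ∈ Finset.univ.filter (fun σ : Equiv.Perm (Fin n) => HasData C τ σ D),
        ∑ T ∈ Q, cc T * ∏ p : Fin k × Fin k, ((rC C σ p.1 p.2).choose (T p) : ℝ) :=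
        Finset.sum_le_sum step1
    _ ≤ ∑ σ : Equiv.Perm (Fin n),
        ∑ T ∈ Q, cc T * ∏ p : Fin k × Fin k, ((rC C σ p.1 p.2).choose (T p) : ℝ) := by
        refine Finset.sum_le_sum_of_subset_of_nonneg (Finset.filter_subset _ _) fun σ _ _ => ?_
        exact Finset.sum_nonneg fun T _ => mul_nonneg (hcc0 T)
          (Finset.prod_nonneg fun p _ => Nat.cast_nonneg _)
    _ = ∑ T ∈ Q, cc T * ∑ σ : Equiv.Perm (Fin n),
          ∏ p : Fin k × Fin k, ((rC C σ p.1 p.2).choose (T p) : ℝ) := by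
        rw [Finset.sum_comm]
        exact Finset.sum_congr rfl fun T _ => by rw [Finset.mul_sum]
    _ ≤ ∑ T ∈ Q, (n.factorial : ℝ) / (n.descFactorial R : ℝ) * (gg T *
        (K1 * y1 ^ (∑ p : Fin k × Fin k, rowT (D p.1) (T p)) +
         K2 * y2 ^ (∑ p : Fin k × Fin k, rowT (D p.1) (T p)))) := Finset.sum_le_sum step2
    _ ≤ ∑ T ∈ PP, (n.factorial : ℝ) / (n.descFactorial R : ℝ) * (gg T *
        (K1 * y1 ^ (∑ p : Fin k × Fin k, rowT (D p.1) (T p)) +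
         K2 * y2 ^ (∑ p : Fin k × Fin k, rowT (D p.1) (T p)))) := by
        refine Finset.sum_le_sum_of_subset_of_nonneg (Finset.filter_subset _ _) fun T _ _ => ?_
        have := hgg0 T
        positivity
    _ = _ := by
        rw [← Finset.mul_sum, ← expand_sum, ← expand_sum]
        congr 1
        rw [Finset.mul_sum, Finset.mul_sum, ← Finset.sum_add_distrib]
        refine Finset.sum_congr rfl fun T _ => ?_
        rw [hgg]
        ring

theorem pow_self_step (x : ℕ) : ((x:ℝ) + 1) ^ x ≤ Real.exp 1 * (x:ℝ) ^ x := by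
  rcases Nat.eq_zero_or_pos x with h | h
  · subst h; simpa using Real.one_le_exp (by norm_num : (0:ℝ) ≤ 1)
  · have hx : (0:ℝ) < x := by exact_mod_cast h
    have h1 : (x:ℝ) + 1 ≤ x * Real.exp (1 / x) := by
      have := Real.add_one_le_exp (1 / (x:ℝ))
      calc (x:ℝ) + 1 = x * (1 / x + 1) := by field_simp; ring
        _ ≤ _ := by gcongr
    calc ((x:ℝ) + 1) ^ x ≤ (x * Real.exp (1 / x)) ^ x := by gcongr
      _ = _ := by
        rw [mul_pow, ← Real.exp_nat_mul, mul_one_div_cancel hx.ne']; ring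

theorem desc_aux (n : ℕ) : ∀ R, R ≤ n →
    (n:ℝ) ^ n * Real.exp (-(R:ℝ)) ≤ n.descFactorial R * ((n - R : ℕ) : ℝ) ^ (n - R) := by
  intro R
  induction R with
  | zero => intro _; simp
  | succ R ih =>
    intro h
    have ih := ih (by omega)
    obtain ⟨x, hx⟩ : ∃ x, n - R = x + 1 := ⟨n - R - 1, by omega⟩
    have hx' : n - (R + 1) = x := by omega
    rw [Nat.descFactorial_succ, hx', hx]
    rw [hx] at ih
    have hs := pow_self_step x
    have he : Real.exp (-((R + 1 : ℕ) : ℝ)) = Real.exp (-(R:ℝ)) * Real.exp (-1) := by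
      rw [← Real.exp_add]; congr 1; push_cast; ring
    rw [he]
    have he1 : Real.exp (-1) * Real.exp 1 = 1 := by rw [← Real.exp_add]; simp
    push_cast at ih ⊢
    calc (n:ℝ) ^ n * (Real.exp (-(R:ℝ)) * Real.exp (-1)) =
        ((n:ℝ) ^ n * Real.exp (-(R:ℝ))) * Real.exp (-1) := by ring
      _ ≤ (n.descFactorial R * ((x:ℝ) + 1) ^ (x + 1)) * Real.exp (-1) := by gcongr
      _ = (n.descFactorial R * ((x:ℝ) + 1) * Real.exp (-1)) * ((x:ℝ) + 1) ^ x := by ring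
      _ ≤ (n.descFactorial R * ((x:ℝ) + 1) * Real.exp (-1)) * (Real.exp 1 * (x:ℝ) ^ x) := by gcongr
      _ = n.descFactorial R * ((x:ℝ) + 1) * (Real.exp (-1) * Real.exp 1) * (x:ℝ) ^ x := by ring
      _ = _ := by rw [he1]; ring

/-- lower bound for falling factorials -/
theorem desc_lower (n R : ℕ) (h : R ≤ n) :
    (n:ℝ) ^ R * Real.exp (-((R:ℝ) ^ 2 / n)) ≤ n.descFactorial R := by
  rcases Nat.eq_zero_or_pos n with h0 | h0
  · subst h0
    have : R = 0 := by omega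
    subst this; simp
  have hn : (0:ℝ) < n := by exact_mod_cast h0
  have h1 := desc_aux n R h
  have h2 : ((n - R : ℕ) : ℝ) ≤ n * Real.exp (-((R:ℝ) / n)) := by
    have := Real.add_one_le_exp (-((R:ℝ) / n))
    rw [Nat.cast_sub h]
    calc (n:ℝ) - R = n * (-((R:ℝ) / n) + 1) := by field_simp; ring
      _ ≤ _ := by gcongr
  have h3 : ((n - R : ℕ) : ℝ) ^ (n - R) ≤ (n:ℝ) ^ (n - R) * Real.exp (-((R:ℝ) / n) * (n - R)) := by
    calc _ ≤ (n * Real.exp (-((R:ℝ) / n))) ^ (n - R) := by gcongr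
      _ = _ := by
        rw [mul_pow, ← Real.exp_nat_mul, Nat.cast_sub h]; ring_nf
  have h4 : (n:ℝ) ^ n = n ^ R * n ^ (n - R) := by rw [← pow_add]; congr 1; omega
  have h5 : (n:ℝ) ^ R * n ^ (n - R) * Real.exp (-(R:ℝ)) ≤
      n.descFactorial R * ((n:ℝ) ^ (n - R) * Real.exp (-((R:ℝ) / n) * (n - R))) := by
    rw [← h4]; exact h1.trans (by gcongr)
  have h6 : Real.exp (-(R:ℝ)) = Real.exp (-((R:ℝ)^2 / n)) * Real.exp (-((R:ℝ) / n) * (n - R)) := by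
    rw [← Real.exp_add]; congr 1; field_simp; ring
  rw [h6] at h5
  have hp : 0 < (n:ℝ) ^ (n - R) * Real.exp (-((R:ℝ) / n) * (n - R)) := by positivity
  refine le_of_mul_le_mul_right ?_ hp
  calc _ = _ := by ring
    _ ≤ _ := h5

theorem desc_lower' (n R : ℕ) (h : R ≤ n) : ((n:ℝ) / Real.exp 1) ^ R ≤ n.descFactorial R := by
  refine le_trans ?_ (desc_lower n R h)
  rw [div_pow, div_eq_mul_inv, ← Real.exp_nat_mul, ← Real.exp_neg]
  gcongr
  rcases Nat.eq_zero_or_pos n with h0 | h0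
  · subst h0; have : R = 0 := by omega
    subst this; simp
  have hn : (0:ℝ) < n := by exact_mod_cast h0
  rw [mul_one, div_le_iff₀ hn, sq]
  gcongr

theorem fact_lower (n : ℕ) : ((n:ℝ) / Real.exp 1) ^ n ≤ n.factorial := by
  have := desc_lower' n n le_rfl
  rwa [Nat.descFactorial_self] at this

/-- tail bound -/
theorem tail_sum (β x : ℝ) (hβ : 1 ≤ β) (hx : 0 ≤ x) (τ : ℕ) (hc : β ^ (τ + 2) * x ^ 2 ≤ 1 / 4) :
    ∑ t ∈ Finset.range (τ + 1), (if 3 ≤ t then β ^ t.choose 2 * x ^ t else 0) ≤ 2 * β ^ 3 * x ^ 3 := by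
  have key : ∀ s, s + 3 ≤ τ → β ^ (s + 3).choose 2 * x ^ (s + 3) ≤ β ^ 3 * x ^ 3 * (1 / 2) ^ s := by
    intro s hs
    have h1 : 2 * (s + 3).choose 2 = 6 + s * (s + 5) := by
      rw [Nat.choose_two_right, Nat.mul_div_cancel' (Nat.even_mul_pred_self _).two_dvd]
      simp only [Nat.add_sub_cancel, show s + 3 - 1 = s + 2 by omega]; ring
    refine le_of_sq_le_sq ?_ (by positivity)
    have e1 : (β ^ (s + 3).choose 2 * x ^ (s + 3)) ^ 2 = (β ^ 3 * x ^ 3) ^ 2 * (β ^ (s + 5) * x ^ 2) ^ s := by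
      rw [mul_pow, ← pow_mul, mul_comm _ 2, h1]; ring
    have e2 : (β ^ 3 * x ^ 3 * (1 / 2) ^ s) ^ 2 = (β ^ 3 * x ^ 3) ^ 2 * (1 / 4) ^ s := by
      rw [mul_pow, ← pow_mul, mul_comm s 2, pow_mul]; norm_num
    rw [e1, e2]
    have : β ^ (s + 5) * x ^ 2 ≤ 1 / 4 := by
      refine le_trans ?_ hc
      have : β ^ (s + 5) ≤ β ^ (τ + 2) := pow_le_pow_right₀ hβ (by omega)
      gcongr
    gcongr
  by_cases hτ : τ < 3
  · rw [Finset.sum_eq_zero]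
    · positivity
    · intro t ht; rw [if_neg]; simp at ht; omega
  · obtain ⟨q, rfl⟩ : ∃ q, τ = q + 2 := ⟨τ - 2, by omega⟩
    rw [show q + 2 + 1 = 3 + q by omega, Finset.sum_range_add]
    have z : ∑ t ∈ Finset.range 3, (if 3 ≤ t then β ^ t.choose 2 * x ^ t else 0) = 0 := by
      apply Finset.sum_eq_zero; intro t ht; rw [if_neg]; simp at ht; omega
    rw [z, zero_add]
    calc _ ≤ ∑ s ∈ Finset.range q, β ^ 3 * x ^ 3 * (1 / 2) ^ s := by
          refine Finset.sum_le_sum fun s hs => ?_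
          rw [if_pos (by omega), add_comm 3 s]
          exact key s (by simp at hs; omega)
      _ = β ^ 3 * x ^ 3 * ∑ s ∈ Finset.range q, (1 / 2 : ℝ) ^ s := by rw [Finset.mul_sum]
      _ ≤ β ^ 3 * x ^ 3 * 2 := by
          gcongr
          rw [geom_sum_eq (by norm_num)]
          have : (0:ℝ) < (1 / 2) ^ q := by positivity
          rw [div_le_iff_of_neg (by norm_num)]; linarith
      _ = _ := by ring

theorem rowW_none_le {n k : ℕ} (C : Fin n → Fin k) (β y : ℝ) (hβ : 1 ≤ β) (hy : 0 ≤ y) (τ A : ℕ)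
    (hA : ∀ j, szC C j ≤ A) (hc : β ^ (τ + 2) * ((A:ℝ) ^ 2 * y) ^ 2 ≤ 1 / 4) (i : Fin k) :
    rowW C β τ y none i ≤ Real.exp (2 * (β - 1) * (szC C i).choose 2 * fC C * y ^ 2 +
      k * (2 * β ^ 3 * ((A:ℝ) ^ 2 * y) ^ 3)) := by
  have hexp : Real.exp (2 * (β - 1) * (szC C i).choose 2 * fC C * y ^ 2 +
      k * (2 * β ^ 3 * ((A:ℝ) ^ 2 * y) ^ 3)) = ∏ j : Fin k,
      Real.exp (2 * (β - 1) * (szC C i).choose 2 * (szC C j).choose 2 * y ^ 2 + 2 * β ^ 3 * ((A:ℝ) ^ 2 * y) ^ 3) := by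
    rw [← Real.exp_sum, Finset.sum_add_distrib, fC]
    congr 1
    push_cast
    rw [Finset.mul_sum, Finset.sum_mul]
    simp
  rw [hexp]
  simp only [rowW]
  refine Finset.prod_le_prod (fun j _ => Finset.sum_nonneg fun t _ => ?_) fun j _ => ?_
  · have := bt_nonneg hβ t
    positivity
  · refine le_trans ?_ (Real.add_one_le_exp _)
    set x := (A:ℝ) ^ 2 * y with hx
    have hx0 : 0 ≤ x := by positivity
    have hterm : ∀ t ∈ Finset.range (τ + 1), bt β t * ((szC C i).descFactorial t : ℝ) *
        ((szC C j).descFactorial t : ℝ) / (t.factorial : ℝ) * y ^ t ≤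
        (if t = 0 then 1 else 0) +
        (if t = 2 then 2 * (β - 1) * (szC C i).choose 2 * (szC C j).choose 2 * y ^ 2 else 0) +
        (if 3 ≤ t then β ^ t.choose 2 * x ^ t else 0) := by
      intro t _
      match t with
      | 0 => simp [bt]
      | 1 => simp [bt]
      | 2 =>
        simp only [bt, Nat.descFactorial_eq_factorial_mul_choose]
        apply le_of_eq
        simp
        left
        ring
      | (s + 3) =>
        have : bt β (s + 3) = β ^ (s + 3).choose 2 := by simp [bt]
        rw [this, if_neg (by omega), if_neg (by omega), if_pos (by omega), zero_add, zero_add]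
        have h1 : ((szC C i).descFactorial (s + 3) : ℝ) ≤ (A:ℝ) ^ (s + 3) := by
          exact_mod_cast (Nat.descFactorial_le_pow _ _).trans (Nat.pow_le_pow_left (hA i) _)
        have h2 : ((szC C j).descFactorial (s + 3) : ℝ) ≤ (A:ℝ) ^ (s + 3) := by
          exact_mod_cast (Nat.descFactorial_le_pow _ _).trans (Nat.pow_le_pow_left (hA j) _)
        have h3 : (1:ℝ) ≤ ((s + 3).factorial : ℝ) := by exact_mod_cast Nat.factorial_pos _
        calc _ ≤ β ^ (s + 3).choose 2 * (A:ℝ) ^ (s + 3) * (A:ℝ) ^ (s + 3) / 1 * y ^ (s + 3) := by gcongr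
          _ = _ := by rw [hx]; ring
    refine (Finset.sum_le_sum hterm).trans ?_
    rw [Finset.sum_add_distrib, Finset.sum_add_distrib]
    have s1 : ∑ t ∈ Finset.range (τ + 1), (if t = 0 then (1:ℝ) else 0) = 1 := by
      rw [Finset.sum_ite_eq']; simp
    have s2 : ∑ t ∈ Finset.range (τ + 1), (if t = 2 then 2 * (β - 1) * (szC C i).choose 2 * (szC C j).choose 2 * y ^ 2 else 0) ≤
        2 * (β - 1) * (szC C i).choose 2 * (szC C j).choose 2 * y ^ 2 := by
      rw [Finset.sum_ite_eq']
      have : 0 ≤ β - 1 := by linarith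
      split_ifs
      · exact le_rfl
      · positivity
    have s3 := tail_sum β x hβ hx0 τ hc
    linarith

/-- the data of a permutation -/
def dat {n k : ℕ} (C : Fin n → Fin k) (τ : ℕ) (σ : Equiv.Perm (Fin n)) (i : Fin k) : RowD k :=
  if h : ∃ j, τ < rC C σ i j then some (h.choose, rC C σ i h.choose) else none

theorem dat_hasData {n k : ℕ} (C : Fin n → Fin k) (τ : ℕ) (σ : Equiv.Perm (Fin n)) :
    HasData C τ σ (dat C τ σ) := by
  intro i
  by_cases h : ∃ j, τ < rC C σ i j
  · simp [dat, h]
  · simp only [dat, h, dite_false]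
    push Not at h; exact h

theorem rC_le_row {n k : ℕ} (C : Fin n → Fin k) (σ : Equiv.Perm (Fin n)) (i j : Fin k) :
    rC C σ i j ≤ szC C i := by
  rw [← sum_rC C σ i]
  exact Finset.single_le_sum (f := fun j => rC C σ i j) (fun _ _ => Nat.zero_le _) (Finset.mem_univ j)

theorem rC_le_col {n k : ℕ} (C : Fin n → Fin k) (σ : Equiv.Perm (Fin n)) (i j : Fin k) :
    rC C σ i j ≤ szC C j := by
  rw [← sum_rC' C σ j]
  exact Finset.single_le_sum (f := fun i => rC C σ i j) (fun _ _ => Nat.zero_le _) (Finset.mem_univ i)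

theorem dat_some {n k : ℕ} (C : Fin n → Fin k) (τ : ℕ) (σ : Equiv.Perm (Fin n)) (i j : Fin k) (ρ : ℕ)
    (h : dat C τ σ i = some (j, ρ)) : rC C σ i j = ρ ∧ τ < ρ ∧ ρ ≤ szC C i ∧ ρ ≤ szC C j := by
  unfold dat at h
  split_ifs at h with hh
  simp only [Option.some.injEq, Prod.mk.injEq] at h
  obtain ⟨h1, h2⟩ := h
  have := hh.choose_spec
  rw [h1] at h2 this
  subst h2
  exact ⟨rfl, this, rC_le_row _ _ _ _, rC_le_col _ _ _ _⟩

/-- columns of big entries are distinct -/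
theorem dat_inj {n k : ℕ} (C : Fin n → Fin k) (τ : ℕ) (hτ : ∀ j, szC C j < 2 * (τ + 1))
    (σ : Equiv.Perm (Fin n)) (i i' j : Fin k) (ρ ρ' : ℕ)
    (h : dat C τ σ i = some (j, ρ)) (h' : dat C τ σ i' = some (j, ρ')) : i = i' := by
  by_contra hne
  have h1 := dat_some C τ σ i j ρ h
  have h2 := dat_some C τ σ i' j ρ' h'
  have := sum_rC' C σ j
  have h3 : ∑ x ∈ ({i, i'} : Finset (Fin k)), rC C σ x j ≤ ∑ x, rC C σ x j :=
    Finset.sum_le_sum_of_subset (Finset.subset_univ _)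
  rw [Finset.sum_pair hne, this] at h3
  have := hτ j
  omega

/-- range of data -/
def someR {n k : ℕ} (C : Fin n → Fin k) (τ : ℕ) (i : Fin k) : Finset (RowD k) :=
  ((Finset.univ : Finset (Fin k)) ×ˢ Finset.Icc (τ + 1) (szC C i)).image some

def datR {n k : ℕ} (C : Fin n → Fin k) (τ : ℕ) (i : Fin k) : Finset (RowD k) :=
  insert none (someR C τ i)

theorem dat_mem {n k : ℕ} (C : Fin n → Fin k) (τ : ℕ) (σ : Equiv.Perm (Fin n)) :
    dat C τ σ ∈ Fintype.piFinset (datR C τ) := by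
  rw [Fintype.mem_piFinset]
  intro i
  rw [datR, Finset.mem_insert]
  rcases h : dat C τ σ i with _ | ⟨j, ρ⟩
  · left; rfl
  · right
    have := dat_some C τ σ i j ρ h
    rw [someR, Finset.mem_image]
    exact ⟨(j, ρ), by simp; omega, rfl⟩

/-- rows with a big entry -/
def domD {k : ℕ} (D : Fin k → RowD k) : Finset (Fin k) := Finset.univ.filter fun i => D i ≠ none

theorem sum_dat {n k : ℕ} (C : Fin n → Fin k) (τ : ℕ) (P : (Fin k → RowD k) → Prop)
    (g : Equiv.Perm (Fin n) → ℝ) (hg : ∀ σ, 0 ≤ g σ) :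
    ∑ σ ∈ Finset.univ.filter (fun σ => P (dat C τ σ)), g σ ≤
    ∑ D ∈ (Fintype.piFinset (datR C τ)).filter P,
      ∑ σ ∈ Finset.univ.filter (fun σ => HasData C τ σ D), g σ := by
  rw [← Finset.sum_fiberwise_of_maps_to (t := (Fintype.piFinset (datR C τ)).filter P) (g := dat C τ)]
  · refine Finset.sum_le_sum fun D _ => ?_
    refine Finset.sum_le_sum_of_subset_of_nonneg ?_ fun σ _ _ => hg σ
    intro σ hσ
    simp only [Finset.mem_filter, Finset.mem_univ, true_and] at hσ ⊢
    rw [← hσ.2]; exact dat_hasData C τ σ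
  · intro σ hσ
    simp only [Finset.mem_filter, Finset.mem_univ, true_and] at hσ ⊢
    exact ⟨dat_mem C τ σ, hσ⟩

theorem sum_dom {n k : ℕ} (C : Fin n → Fin k) (τ : ℕ) (P : Finset (Fin k) → Prop)
    (G : Finset (Fin k) → ℝ) (hG : ∀ I, 0 ≤ G I) (F : Fin k → RowD k → ℝ) (hF : ∀ i o, 0 ≤ F i o) :
    ∑ D ∈ (Fintype.piFinset (datR C τ)).filter (fun D => P (domD D)),
      G (domD D) * ∏ i ∈ domD D, F i (D i) ≤
    ∑ I ∈ (Finset.univ : Finset (Finset (Fin k))).filter P,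
      G I * ∏ i ∈ I, ∑ o ∈ someR C τ i, F i o := by
  rw [← Finset.sum_fiberwise_of_maps_to
    (t := (Finset.univ : Finset (Finset (Fin k))).filter P) (g := domD)]
  · refine Finset.sum_le_sum fun I _ => ?_
    set F' : Fin k → RowD k → ℝ := fun i o => if i ∈ I then F i o else 1 with hF'
    set RR : Fin k → Finset (RowD k) := fun i => if i ∈ I then someR C τ i else {none} with hRR
    have h1 : ∏ i ∈ I, ∑ o ∈ someR C τ i, F i o = ∏ i, ∑ o ∈ RR i, F' i o := by
      rw [← Finset.prod_subset (Finset.subset_univ I)]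
      · refine Finset.prod_congr rfl fun i hi => ?_
        simp [hRR, hF', hi]
      · intro i _ hi
        simp [hRR, hF', hi]
    rw [h1, Finset.prod_univ_sum, Finset.mul_sum]
    have h2 : ∀ D ∈ ((Fintype.piFinset (datR C τ)).filter (fun D => P (domD D))).filter
        (fun D => domD D = I), G (domD D) * ∏ i ∈ domD D, F i (D i) = G I * ∏ i, F' i (D i) := by
      intro D hD
      have hI := (Finset.mem_filter.1 hD).2
      rw [hI]
      congr 1
      rw [← Finset.prod_subset (Finset.subset_univ I)]
      · refine Finset.prod_congr rfl fun i hi => ?_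
        simp [hF', hi]
      · intro i _ hi
        simp [hF', hi]
    rw [Finset.sum_congr rfl h2]
    refine Finset.sum_le_sum_of_subset_of_nonneg ?_ fun D _ _ => ?_
    · intro D hD
      simp only [Finset.mem_filter, Fintype.mem_piFinset] at hD ⊢
      obtain ⟨⟨hD1, -⟩, hD3⟩ := hD
      intro i
      by_cases hi : i ∈ I
      · have : D i ≠ none := by
          rw [← hD3] at hi; exact (Finset.mem_filter.1 hi).2
        have h := hD1 i
        rw [datR, Finset.mem_insert] at h
        simp only [hRR, hi, if_true]
        tauto
      · have : D i = none := by
          by_contra hne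
          exact hi (hD3 ▸ Finset.mem_filter.2 ⟨Finset.mem_univ _, hne⟩)
        simp [hRR, hi, this]
    · refine mul_nonneg (hG I) (Finset.prod_nonneg fun i _ => ?_)
      simp only [hF']
      split_ifs
      · exact hF _ _
      · norm_num
  · intro D hD
    simp only [Finset.mem_filter, Finset.mem_univ, true_and] at hD ⊢
    exact hD.2

theorem rowW_nonneg {n k : ℕ} (C : Fin n → Fin k) (β : ℝ) (hβ : 1 ≤ β) (τ : ℕ) (y : ℝ) (hy : 0 ≤ y)
    (o : RowD k) (i : Fin k) : 0 ≤ rowW C β τ y o i := by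
  unfold rowW
  split
  · refine Finset.prod_nonneg fun j _ => Finset.sum_nonneg fun t _ => ?_
    have := bt_nonneg hβ t
    positivity
  · positivity

theorem prod_rowW_le {n k : ℕ} (C : Fin n → Fin k) (β y : ℝ) (hβ : 1 ≤ β) (hy : 0 ≤ y) (τ A : ℕ)
    (hA : ∀ j, szC C j ≤ A) (hc : β ^ (τ + 2) * ((A:ℝ) ^ 2 * y) ^ 2 ≤ 1 / 4) (D : Fin k → RowD k) :
    ∏ i, rowW C β τ y (D i) i ≤ (∏ i ∈ domD D, rowW C β τ 0 (D i) i) *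
      Real.exp (∑ i ∈ (domD D)ᶜ, (2 * (β - 1) * (szC C i).choose 2 * fC C * y ^ 2 +
      k * (2 * β ^ 3 * ((A:ℝ) ^ 2 * y) ^ 3))) := by
  rw [← Finset.prod_mul_prod_compl (domD D), Real.exp_sum]
  refine mul_le_mul (le_of_eq ?_) ?_ (Finset.prod_nonneg fun i _ => rowW_nonneg C β hβ τ y hy _ _)
    (Finset.prod_nonneg fun i _ => rowW_nonneg C β hβ τ 0 le_rfl _ _)
  · refine Finset.prod_congr rfl fun i hi => ?_
    have : D i ≠ none := (Finset.mem_filter.1 hi).2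
    cases hD : D i with
    | none => exact absurd hD this
    | some q => simp [rowW]
  · refine Finset.prod_le_prod (fun i _ => rowW_nonneg C β hβ τ y hy _ _) fun i hi => ?_
    have : D i = none := by
      by_contra hne
      exact (Finset.mem_compl.1 hi) (Finset.mem_filter.2 ⟨Finset.mem_univ _, hne⟩)
    rw [this]
    exact rowW_none_le C β y hβ hy τ A hA hc i

theorem prod_rowW_le' {n k : ℕ} (C : Fin n → Fin k) (β y : ℝ) (hβ : 1 ≤ β) (hy : 0 ≤ y) (τ A : ℕ)
    (hA : ∀ j, szC C j ≤ A) (hc : β ^ (τ + 2) * ((A:ℝ) ^ 2 * y) ^ 2 ≤ 1 / 4) (D : Fin k → RowD k) :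
    ∏ i, rowW C β τ y (D i) i ≤ (∏ i ∈ domD D, rowW C β τ 0 (D i) i) *
      Real.exp (2 * (β - 1) * (fC C) ^ 2 * y ^ 2 + (k:ℝ) ^ 2 * (2 * β ^ 3 * ((A:ℝ) ^ 2 * y) ^ 3)) := by
  refine (prod_rowW_le C β y hβ hy τ A hA hc D).trans ?_
  have h0 := Finset.prod_nonneg fun i (_ : i ∈ domD D) => rowW_nonneg C β hβ τ 0 le_rfl (D i) i
  refine mul_le_mul_of_nonneg_left (Real.exp_le_exp.2 ?_) h0
  have hb : 0 ≤ β - 1 := by linarith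
  calc _ ≤ ∑ i, (2 * (β - 1) * (szC C i).choose 2 * fC C * y ^ 2 +
      k * (2 * β ^ 3 * ((A:ℝ) ^ 2 * y) ^ 3)) := by
        refine Finset.sum_le_sum_of_subset_of_nonneg (Finset.subset_univ _) fun i _ _ => ?_
        positivity
    _ = _ := by
        rw [Finset.sum_add_distrib, ← Finset.sum_mul, ← Finset.sum_mul, ← Finset.mul_sum]
        have : (∑ i, ((szC C i).choose 2 : ℝ)) = fC C := by rw [fC]; push_cast; rfl
        rw [this]
        simp
        ring

theorem datR_RU {n k : ℕ} (C : Fin n → Fin k) (τ : ℕ) (D : Fin k → RowD k)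
    (hD : D ∈ Fintype.piFinset (datR C τ)) :
    ∑ i, rowM (D i) + ∑ i, rowU C (D i) i ≤ n := by
  have h : ∀ i, rowM (D i) + rowU C (D i) i ≤ szC C i := by
    intro i
    have := (Fintype.mem_piFinset.1 hD) i
    rw [datR, Finset.mem_insert] at this
    rcases this with h | h
    · rw [h]; simp [rowM, rowU]
    · rw [someR, Finset.mem_image] at h
      obtain ⟨⟨j, ρ⟩, h1, h2⟩ := h
      rw [← h2]
      simp at h1
      simp [rowM, rowU, h1]
  rw [← Finset.sum_add_distrib]
  calc _ ≤ ∑ i, szC C i := Finset.sum_le_sum fun i _ => h i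
    _ = n := sum_sz C

/-- bound for fixed data, version 1 -/
theorem br1 {n k : ℕ} (C : Fin n → Fin k) (β : ℝ) (hβ : 1 ≤ β) (τ A : ℕ) (hA : ∀ j, szC C j ≤ A)
    (D : Fin k → RowD k) (hD : D ∈ Fintype.piFinset (datR C τ)) (ν T0 : ℝ) (hν : 0 < ν)
    (hT0 : 0 ≤ T0)
    (hνn : ν ≤ ((n - ∑ i, rowM (D i) : ℕ) : ℝ))
    (hc : β ^ (τ + 2) * ((A:ℝ) ^ 2 * (Real.exp 2 / ν)) ^ 2 ≤ 1 / 4) :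
    ∑ σ ∈ Finset.univ.filter (fun σ : Equiv.Perm (Fin n) => HasData C τ σ D), β ^ sC C σ ≤
    (n.factorial : ℝ) / (n.descFactorial (∑ i, rowM (D i)) : ℝ) *
      (∏ i ∈ domD D, rowW C β τ 0 (D i) i) *
      (Real.exp (T0 ^ 2 / ν + 2 * (β - 1) * (fC C) ^ 2 * (1 / ((n - ∑ i, rowM (D i) : ℕ) : ℝ)) ^ 2 +
          (k:ℝ) ^ 2 * (2 * β ^ 3 * ((A:ℝ) ^ 2 * (1 / ν)) ^ 3)) +
       Real.exp (- T0 + 2 * (β - 1) * (fC C) ^ 2 * (Real.exp 2 / ν) ^ 2 +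
          (k:ℝ) ^ 2 * (2 * β ^ 3 * ((A:ℝ) ^ 2 * (Real.exp 2 / ν)) ^ 3))) := by
  set n' := n - ∑ i, rowM (D i) with hn'
  have hRU := datR_RU C τ D hD
  have hn'0 : (0:ℝ) < n' := lt_of_lt_of_le hν hνn
  have he2 : 1 ≤ Real.exp 2 := Real.one_le_exp (by norm_num)
  have hinv : 1 / (n':ℝ) ≤ 1 / ν := one_div_le_one_div_of_le hν hνn
  have hinv2 : Real.exp 2 / (n':ℝ) ≤ Real.exp 2 / ν := by gcongr
  have hinv3 : 1 / (n':ℝ) ≤ Real.exp 2 / ν := hinv.trans (by gcongr)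
  have main := main_term C τ β hβ D (Real.exp (T0 ^ 2 / ν)) (Real.exp (-T0)) (1 / n') (Real.exp 2 / n')
    hRU (by
      intro T hT
      have hTn : T ≤ n' := by omega
      by_cases hTT : (T:ℝ) ≤ T0
      · have h1 := desc_lower n' T hTn
        have h2 : (1:ℝ) ≤ ((n').descFactorial T : ℝ) * (Real.exp (T0 ^ 2 / ν) * (1 / n') ^ T) := by
          calc (1:ℝ) = (n':ℝ) ^ T * Real.exp (-((T:ℝ) ^ 2 / n')) * (Real.exp ((T:ℝ) ^ 2 / n') * (1 / n') ^ T) := by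
                have : Real.exp (-((T:ℝ) ^ 2 / n')) * Real.exp ((T:ℝ) ^ 2 / n') = 1 := by
                  rw [← Real.exp_add]; simp
                calc (1:ℝ) = (n':ℝ) ^ T * (1 / n') ^ T * 1 := by
                      rw [← mul_pow, mul_one_div_cancel hn'0.ne']; simp
                  _ = _ := by rw [← this]; ring
            _ ≤ ((n').descFactorial T : ℝ) * (Real.exp (T0 ^ 2 / ν) * (1 / n') ^ T) := by gcongr
        refine h2.trans ?_
        gcongr
        exact le_add_of_nonneg_right (by positivity)
      · have h1 := desc_lower' n' T hTn
        have h2 : (1:ℝ) ≤ ((n').descFactorial T : ℝ) * (Real.exp (-T0) * (Real.exp 2 / n') ^ T) := by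
          calc (1:ℝ) ≤ Real.exp (T - T0) := Real.one_le_exp (by linarith)
            _ = ((n':ℝ) / Real.exp 1) ^ T * (Real.exp (-T0) * (Real.exp 2 / n') ^ T) := by
                have : ((n':ℝ) / Real.exp 1) ^ T * (Real.exp 2 / n') ^ T = Real.exp T := by
                  rw [← mul_pow]
                  have : (n':ℝ) / Real.exp 1 * (Real.exp 2 / n') = Real.exp 1 := by
                    have : Real.exp 2 = Real.exp 1 * Real.exp 1 := by rw [← Real.exp_add]; norm_num
                    rw [this]; field_simp
                  rw [this, ← Real.exp_nat_mul, mul_one]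
                rw [sub_eq_add_neg, Real.exp_add, ← this]; ring
            _ ≤ _ := by gcongr
        refine h2.trans ?_
        gcongr
        exact le_add_of_nonneg_left (by positivity))
    (by positivity) (by positivity) (by positivity) (by positivity)
  refine main.trans ?_
  rw [mul_assoc]
  have hb : 0 ≤ β - 1 := by linarith
  refine mul_le_mul_of_nonneg_left ?_ (by positivity)
  have h0 := Finset.prod_nonneg fun i (_ : i ∈ domD D) => rowW_nonneg C β hβ τ 0 le_rfl (D i) i
  set W := ∏ i ∈ domD D, rowW C β τ 0 (D i) i
  have p1 := prod_rowW_le' C β (1 / n') hβ (by positivity) τ A hA (by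
    refine le_trans ?_ hc; gcongr) D
  have p2 := prod_rowW_le' C β (Real.exp 2 / n') hβ (by positivity) τ A hA (by
    refine le_trans ?_ hc; gcongr) D
  rw [mul_add]
  refine add_le_add ?_ ?_
  · calc _ ≤ Real.exp (T0 ^ 2 / ν) * (W * Real.exp (2 * (β - 1) * (fC C) ^ 2 * (1 / n') ^ 2 + (k:ℝ) ^ 2 * (2 * β ^ 3 * ((A:ℝ) ^ 2 * (1 / n')) ^ 3))) := by gcongr
      _ = W * Real.exp (T0 ^ 2 / ν + 2 * (β - 1) * (fC C) ^ 2 * (1 / n') ^ 2 + (k:ℝ) ^ 2 * (2 * β ^ 3 * ((A:ℝ) ^ 2 * (1 / n')) ^ 3)) := by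
          rw [add_assoc, Real.exp_add (T0 ^ 2 / ν)]; ring
      _ ≤ _ := by gcongr
  · calc _ ≤ Real.exp (-T0) * (W * Real.exp (2 * (β - 1) * (fC C) ^ 2 * (Real.exp 2 / n') ^ 2 + (k:ℝ) ^ 2 * (2 * β ^ 3 * ((A:ℝ) ^ 2 * (Real.exp 2 / n')) ^ 3))) := by gcongr
      _ = W * Real.exp (-T0 + 2 * (β - 1) * (fC C) ^ 2 * (Real.exp 2 / n') ^ 2 + (k:ℝ) ^ 2 * (2 * β ^ 3 * ((A:ℝ) ^ 2 * (Real.exp 2 / n')) ^ 3)) := by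
          rw [add_assoc (-T0), Real.exp_add (-T0)]; ring
      _ ≤ _ := by gcongr

/-- weight of a class -/
def wA (β : ℝ) (A : ℕ) : ℝ := β ^ A.choose 2 * A.factorial

theorem choose_two_split (ρ d : ℕ) : (ρ + d).choose 2 = ρ.choose 2 + d.choose 2 + ρ * d := by
  rw [Nat.add_choose_eq]
  simp [Finset.Nat.antidiagonal_succ]
  ring

theorem wt_le1 (β : ℝ) (hβ : 1 ≤ β) (n a τ A A' ρ : ℕ) (hA : A ≤ a + 1) (hA' : A' ≤ a + 1)
    (hAA : A' ≤ A + 1) (hτ : τ < ρ) (hρ : ρ ≤ A)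
    (hn : (n:ℝ) * (a + 1) ≤ β ^ (τ + 1)) :
    β ^ (ρ.choose 2 + (A - ρ).choose 2) * (A.descFactorial ρ : ℝ) * (A'.descFactorial ρ : ℝ) / ρ.factorial
      * (n:ℝ) ^ (A - ρ) ≤ (a + 1) * wA β A := by
  by_cases hρ' : A' < ρ
  · rw [Nat.descFactorial_eq_zero_iff_lt.2 hρ']
    unfold wA
    simp
    positivity
  rw [not_lt] at hρ'
  obtain ⟨d, rfl⟩ : ∃ d, A = ρ + d := ⟨A - ρ, by omega⟩
  rw [Nat.add_sub_cancel_left]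
  have h1 : ((ρ + d).descFactorial ρ : ℝ) ≤ (ρ + d).factorial := by
    have := Nat.factorial_mul_descFactorial (n := ρ + d) (k := ρ) (by omega)
    rw [← this]; push_cast
    refine le_mul_of_one_le_left (by positivity) ?_
    exact_mod_cast Nat.factorial_pos _
  have h2 : (A'.descFactorial ρ : ℝ) / ρ.factorial ≤ ((a:ℝ) + 1) ^ (d + 1) := by
    rw [Nat.descFactorial_eq_factorial_mul_choose, Nat.cast_mul, mul_div_cancel_left₀ _ (by positivity)]
    rw [← Nat.choose_symm hρ']
    calc ((A'.choose (A' - ρ) : ℕ) : ℝ) ≤ (A' ^ (A' - ρ) : ℕ) := by exact_mod_cast Nat.choose_le_pow _ _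
      _ = (A':ℝ) ^ (A' - ρ) := by push_cast; rfl
      _ ≤ ((a:ℝ) + 1) ^ (A' - ρ) := by
          gcongr; exact_mod_cast hA'
      _ ≤ _ := by
          apply pow_le_pow_right₀
          · have : (0:ℝ) ≤ a := Nat.cast_nonneg _
            linarith
          · omega
  have h3 : ((n:ℝ) * (a + 1)) ^ d ≤ β ^ (ρ * d) := by
    calc _ ≤ (β ^ (τ + 1)) ^ d := by gcongr
      _ = β ^ ((τ + 1) * d) := by rw [pow_mul]
      _ ≤ _ := pow_le_pow_right₀ hβ (Nat.mul_le_mul_right _ hτ)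
  rw [wA, choose_two_split]
  calc _ = β ^ (ρ.choose 2 + d.choose 2) * ((ρ + d).descFactorial ρ : ℝ) * ((A'.descFactorial ρ : ℝ) / ρ.factorial)
      * (n:ℝ) ^ d := by ring
    _ ≤ β ^ (ρ.choose 2 + d.choose 2) * ((ρ + d).factorial : ℝ) * ((a:ℝ) + 1) ^ (d + 1) * (n:ℝ) ^ d := by gcongr
    _ = β ^ (ρ.choose 2 + d.choose 2) * ((ρ + d).factorial : ℝ) * ((a:ℝ) + 1) * ((n:ℝ) * (a + 1)) ^ d := by rw [mul_pow]; ring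
    _ ≤ β ^ (ρ.choose 2 + d.choose 2) * ((ρ + d).factorial : ℝ) * ((a:ℝ) + 1) * β ^ (ρ * d) := by gcongr
    _ = _ := by ring

theorem sum_some_le (n k : ℕ) (hk : 0 < k) (hn0 : 0 < n) (β : ℝ) (hβ : 1 ≤ β) (τ : ℕ)
    (hn : (n:ℝ) * ((n / k : ℕ) + 1) ≤ β ^ (τ + 1)) (i : Fin k) :
    ∑ o ∈ someR (C0 n k hk) τ i, (rowW (C0 n k hk) β τ 0 o i * ((n:ℝ) ^ rowM o)⁻¹) ≤
      k * (((n / k : ℕ) : ℝ) + 1) ^ 2 * (wA β (szC (C0 n k hk) i) * ((n:ℝ) ^ szC (C0 n k hk) i)⁻¹) := by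
  set a := n / k with ha
  set C := C0 n k hk with hC
  have hsz : ∀ j, a ≤ szC C j ∧ szC C j ≤ a + 1 := by
    intro j; rw [hC, szC_C0]; split_ifs <;> omega
  have hnp : (0:ℝ) < n := by exact_mod_cast hn0
  have hterm : ∀ o ∈ someR C τ i, rowW C β τ 0 o i * ((n:ℝ) ^ rowM o)⁻¹≤
      (a + 1) * (wA β (szC C i) * ((n:ℝ) ^ szC C i)⁻¹) := by
    intro o ho
    rw [someR, Finset.mem_image] at ho
    obtain ⟨⟨j, ρ⟩, h1, rfl⟩ := ho
    simp at h1
    have := wt_le1 β hβ n a τ (szC C i) (szC C j) ρ (hsz i).2 (hsz j).2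
      (by have := hsz i; have := hsz j; omega) (by omega) h1.2 hn
    simp only [rowW, rowM]
    rw [← div_eq_mul_inv, div_le_iff₀ (by positivity)]
    have hp : (n:ℝ) ^ szC C i = n ^ (szC C i - ρ) * n ^ ρ := by rw [← pow_add]; congr 1; omega
    rw [hp]
    calc _ = (β ^ (ρ.choose 2 + (szC C i - ρ).choose 2) * ((szC C i).descFactorial ρ : ℝ) * ((szC C j).descFactorial ρ : ℝ) / ρ.factorial
        * (n:ℝ) ^ (szC C i - ρ)) * ((n:ℝ) ^ (szC C i - ρ))⁻¹ := by field_simp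
      _ ≤ ((a + 1) * wA β (szC C i)) * ((n:ℝ) ^ (szC C i - ρ))⁻¹ := by gcongr
      _ = _ := by field_simp
  refine (Finset.sum_le_card_nsmul _ _ _ hterm).trans ?_
  have hcard : (someR C τ i).card ≤ k * (a + 1) := by
    refine Finset.card_image_le.trans ?_
    rw [Finset.card_product]
    simp
    have := (hsz i).2
    exact Nat.mul_le_mul_left _ (by omega)
  rw [nsmul_eq_mul]
  have hw : 0 ≤ wA β (szC C i) := by unfold wA; positivity
  calc _ ≤ ((k * (a + 1) : ℕ) : ℝ) * ((a + 1) * (wA β (szC C i) * ((n:ℝ) ^ szC C i)⁻¹)) := by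
        gcongr
    _ = _ := by push_cast; ring

theorem sz_bounds (n k : ℕ) (hk : 0 < k) (j : Fin k) :
    n / k ≤ szC (C0 n k hk) j ∧ szC (C0 n k hk) j ≤ n / k + 1 := by
  rw [szC_C0]; split_ifs <;> omega

/-- expected mass -/
def Rex {n k : ℕ} (C : Fin n → Fin k) (I : Finset (Fin k)) : ℕ := ∑ i ∈ I, szC C i

theorem rowM_sum_dom {k : ℕ} (D : Fin k → RowD k) : ∑ i, rowM (D i) = ∑ i ∈ domD D, rowM (D i) := by
  symm
  refine Finset.sum_subset (Finset.subset_univ _) fun i _ hi => ?_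
  have : D i = none := by
    by_contra hne
    exact hi (Finset.mem_filter.2 ⟨Finset.mem_univ _, hne⟩)
  rw [this]; rfl

theorem rowM_le_sz {n k : ℕ} (C : Fin n → Fin k) (τ : ℕ) (D : Fin k → RowD k)
    (hD : D ∈ Fintype.piFinset (datR C τ)) (i : Fin k) : rowM (D i) ≤ szC C i := by
  have := (Fintype.mem_piFinset.1 hD) i
  rw [datR, Finset.mem_insert] at this
  rcases this with h | h
  · rw [h]; simp [rowM]
  · rw [someR, Finset.mem_image] at h
    obtain ⟨⟨j, ρ⟩, h1, h2⟩ := h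
    rw [← h2]
    simp at h1
    simp [rowM, h1]

theorem rowM_le_Rex {n k : ℕ} (C : Fin n → Fin k) (τ : ℕ) (D : Fin k → RowD k)
    (hD : D ∈ Fintype.piFinset (datR C τ)) : ∑ i, rowM (D i) ≤ Rex C (domD D) := by
  rw [rowM_sum_dom]
  exact Finset.sum_le_sum fun i _ => rowM_le_sz C τ D hD i

theorem Rex_le {n k : ℕ} (C : Fin n → Fin k) (I : Finset (Fin k)) : Rex C I ≤ n := by
  conv_rhs => rw [← sum_sz C]
  exact Finset.sum_le_sum_of_subset (Finset.subset_univ _)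

/-- finite form of the first range -/
theorem R1_fin (n k : ℕ) (hk : 0 < k) (hn0 : 0 < n) (β : ℝ) (hβ : 1 ≤ β) (τ : ℕ)
    (hn : (n:ℝ) * ((n / k : ℕ) + 1) ≤ β ^ (τ + 1)) (P : Finset (Fin k) → Prop) (M : ℝ) (hM : 0 ≤ M)
    (hbr : ∀ D ∈ Fintype.piFinset (datR (C0 n k hk) τ), P (domD D) →
      ∑ σ ∈ Finset.univ.filter (fun σ : Equiv.Perm (Fin n) => HasData (C0 n k hk) τ σ D), β ^ sC (C0 n k hk) σ ≤
      (n.factorial : ℝ) / (n.descFactorial (∑ i, rowM (D i)) : ℝ) *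
      (∏ i ∈ domD D, rowW (C0 n k hk) β τ 0 (D i) i) * (M * Real.exp (domD D).card)) :
    ∑ σ ∈ Finset.univ.filter (fun σ : Equiv.Perm (Fin n) => P (domD (dat (C0 n k hk) τ σ))), β ^ sC (C0 n k hk) σ ≤
    (n.factorial : ℝ) * M * ∑ I ∈ (Finset.univ : Finset (Finset (Fin k))).filter P,
      (Real.exp (I.card + (Rex (C0 n k hk) I : ℝ) ^ 2 / n) * ∏ i ∈ I,
        (k * (((n / k : ℕ) : ℝ) + 1) ^ 2 * (wA β (szC (C0 n k hk) i) * ((n:ℝ) ^ szC (C0 n k hk) i)⁻¹))) := by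
  set C := C0 n k hk with hC
  have hnp : (0:ℝ) < n := by exact_mod_cast hn0
  refine (sum_dat C τ (fun D => P (domD D)) (fun σ => β ^ sC C σ) (fun σ => by positivity)).trans ?_
  have step : ∀ D ∈ (Fintype.piFinset (datR C τ)).filter (fun D => P (domD D)),
      ∑ σ ∈ Finset.univ.filter (fun σ : Equiv.Perm (Fin n) => HasData C τ σ D), β ^ sC C σ ≤
      (n.factorial : ℝ) * M * (Real.exp ((domD D).card + (Rex C (domD D) : ℝ) ^ 2 / n) *
        ∏ i ∈ domD D, (rowW C β τ 0 (D i) i * ((n:ℝ) ^ rowM (D i))⁻¹)) := by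
    intro D hD
    rw [Finset.mem_filter] at hD
    refine (hbr D hD.1 hD.2).trans ?_
    have hR := rowM_le_Rex C τ D hD.1
    have hR' := Rex_le C (domD D)
    have h0 := Finset.prod_nonneg fun i (_ : i ∈ domD D) => rowW_nonneg C β hβ τ 0 le_rfl (D i) i
    rw [Finset.prod_mul_distrib, Finset.prod_inv_distrib, Finset.prod_pow_eq_pow_sum, ← rowM_sum_dom]
    set R := ∑ i, rowM (D i)
    set W := ∏ i ∈ domD D, rowW C β τ 0 (D i) i
    have hd := desc_lower n R (by omega)
    have hinv : ((n.descFactorial R : ℕ) : ℝ)⁻¹ ≤ ((n:ℝ) ^ R)⁻¹ * Real.exp ((Rex C (domD D) : ℝ) ^ 2 / n) := by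
      calc _ ≤ ((n:ℝ) ^ R * Real.exp (-((R:ℝ) ^ 2 / n)))⁻¹ := by
            apply inv_anti₀ (by positivity) hd
        _ = ((n:ℝ) ^ R)⁻¹ * Real.exp ((R:ℝ) ^ 2 / n) := by
            rw [mul_inv, Real.exp_neg, inv_inv]
        _ ≤ _ := by gcongr
    rw [Real.exp_add, div_eq_mul_inv]
    calc _ = (n.factorial : ℝ) * M * W * Real.exp (domD D).card * ((n.descFactorial R : ℕ) : ℝ)⁻¹ := by ring
      _ ≤ (n.factorial : ℝ) * M * W * Real.exp (domD D).card * (((n:ℝ) ^ R)⁻¹ * Real.exp ((Rex C (domD D) : ℝ) ^ 2 / n)) := by gcongr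
      _ = _ := by ring
  refine (Finset.sum_le_sum step).trans ?_
  rw [← Finset.mul_sum]
  refine mul_le_mul_of_nonneg_left ?_ (by positivity)
  refine (sum_dom C τ P (fun I => Real.exp (I.card + (Rex C I : ℝ) ^ 2 / n)) (fun I => by positivity)
    (fun i o => rowW C β τ 0 o i * ((n:ℝ) ^ rowM o)⁻¹)
    (fun i o => mul_nonneg (rowW_nonneg C β hβ τ 0 le_rfl _ _) (by positivity))).trans ?_
  refine Finset.sum_le_sum fun I _ => ?_
  refine mul_le_mul_of_nonneg_left ?_ (by positivity)
  refine Finset.prod_le_prod (fun i _ => Finset.sum_nonneg fun o _ =>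
    mul_nonneg (rowW_nonneg C β hβ τ 0 le_rfl _ _) (by positivity)) fun i _ => ?_
  exact sum_some_le n k hk hn0 β hβ τ hn i

/-- real inequality behind the first range -/
theorem logZ (k n a k1 l l1 V W Cc L : ℝ) (hk : 0 < k) (hkn : k ≤ n) (hn : a * k + k1 = n)
    (hk1 : 0 ≤ k1) (hk1k : k1 ≤ k) (hl1 : 0 ≤ l1) (hl1l : l1 ≤ l) (hl1k : l1 ≤ k1) (hlk : l ≤ k)
    (hW0 : 0 ≤ W) (hWL : W ≤ L) (hV : k * V + k1 * W ≤ -n + k * (Cc - Real.log k)) :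
    l * V + l1 * W + (a * l + l1) ^ 2 / n ≤
      l * (Cc - Real.log k + 3) - l * (k - l) / k * (a - L) := by
  have hn0 : 0 < n := by linarith
  have hl0 : 0 ≤ l := by linarith
  set κ := k1 / k with hκ
  have hκ0 : 0 ≤ κ := by positivity
  have hκ1 : κ ≤ 1 := by rw [hκ, div_le_one hk]; exact hk1k
  have hκk : κ * k = k1 := by rw [hκ]; field_simp
  set e := l1 - κ * l with he
  have hnk : n = (a + κ) * k := by rw [add_mul, hκk, hn]
  have hV' : V ≤ -(a + κ) + Cc - Real.log k - κ * W := by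
    have : k * V ≤ k * (-(a + κ) + Cc - Real.log k - κ * W) := by
      calc k * V ≤ -n + k * (Cc - Real.log k) - k1 * W := by linarith
        _ = _ := by rw [hnk, ← hκk]; ring
    exact le_of_mul_le_mul_left this hk
  have he1 : e ≤ l * (k - l) / k := by
    rw [le_div_iff₀ hk]
    by_cases hc : k1 ≤ l
    · have : e ≤ κ * (k - l) := by rw [he]; linarith
      calc e * k ≤ κ * (k - l) * k := by gcongr
        _ = k1 * (k - l) := by rw [← hκk]; ring
        _ ≤ l * (k - l) := by
            apply mul_le_mul_of_nonneg_right hc; linarith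
    · push Not at hc
      have : e ≤ l - κ * l := by rw [he]; linarith
      calc e * k ≤ (l - κ * l) * k := by gcongr
        _ = l * (k - k1) := by rw [← hκk]; ring
        _ ≤ l * (k - l) := by
            apply mul_le_mul_of_nonneg_left _ hl0; linarith
  have hel : |e| ≤ l := by
    rw [abs_le]; constructor
    · rw [he]; nlinarith
    · rw [he]; nlinarith
  have he2 : e ^ 2 ≤ l ^ 2 := by
    rw [← sq_abs]; gcongr
  have hR : a * l + l1 = (a + κ) * l + e := by rw [he]; ring
  have hsq : (a * l + l1) ^ 2 / n = (a + κ) * l ^ 2 / k + 2 * l * e / k + e ^ 2 / n := by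
    have hak : a + κ ≠ 0 := by
      intro h; rw [h] at hnk; linarith
    rw [hR, hnk]
    field_simp
    ring
  have h2 : 2 * l * e / k ≤ 2 * l := by
    rw [div_le_iff₀ hk]
    have : e ≤ k := (le_abs_self e).trans (hel.trans hlk)
    nlinarith
  have h3 : e ^ 2 / n ≤ l := by
    rw [div_le_iff₀ hn0]
    have : l ≤ n := hlk.trans hkn
    nlinarith
  have h4 : (a + κ) * l ^ 2 / k = (a + κ) * l - (a + κ) * (l * (k - l) / k) := by
    field_simp; ring
  have hq0 : 0 ≤ l * (k - l) / k := by
    apply div_nonneg (mul_nonneg hl0 (by linarith)) hk.le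
  have h5 : e * W ≤ l * (k - l) / k * L := by
    calc e * W ≤ l * (k - l) / k * W := by gcongr
      _ ≤ _ := by gcongr
  have h6 : l * V ≤ l * (-(a + κ) + Cc - Real.log k - κ * W) := by gcongr
  rw [hsq, h4]
  have h7 : 0 ≤ κ * (l * (k - l) / k) := by positivity
  have h8 : l1 * W = e * W + κ * l * W := by rw [he]; ring
  nlinarith

theorem termI (n k : ℕ) (hk : 0 < k) (hkn : k ≤ n) (β : ℝ) (hβ : 1 ≤ β) (Cc : ℝ)
    (hW0 : (n:ℝ) ≤ ((n / k : ℕ) + 1) * β ^ (n / k)) (hWL : ((n / k : ℕ) + 1) * β ^ (n / k) ≤ (n:ℝ) ^ 2)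
    (hV : k * Real.log (wA β (n / k) / (n:ℝ) ^ (n / k)) +
      (n % k : ℕ) * Real.log (((n / k : ℕ) + 1) * β ^ (n / k) / n) ≤ -n + k * (Cc - Real.log k))
    (I : Finset (Fin k)) :
    Real.exp (I.card + (Rex (C0 n k hk) I : ℝ) ^ 2 / n) * ∏ i ∈ I,
        (k * (((n / k : ℕ) : ℝ) + 1) ^ 2 * (wA β (szC (C0 n k hk) i) * ((n:ℝ) ^ szC (C0 n k hk) i)⁻¹)) ≤
    Real.exp (I.card * (2 * Real.log ((n / k : ℕ) + 1) + Cc + 4) -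
      I.card * (k - I.card) / k * ((n / k : ℕ) - Real.log n)) := by
  set a := n / k with ha
  have hn0 : (0:ℝ) < n := by exact_mod_cast lt_of_lt_of_le hk hkn
  have hk0 : (0:ℝ) < k := by exact_mod_cast hk
  have hβ0 : 0 < β := by linarith
  set v0 := wA β a / (n:ℝ) ^ a with hv0
  set ω := ((a:ℝ) + 1) * β ^ a / n with hω
  have hv0p : 0 < v0 := by rw [hv0, wA]; positivity
  have hωp : 0 < ω := by positivity
  set l1 : ℕ := (I.filter fun i : Fin k => (i:ℕ) < n % k).card with hl1
  have hsz : ∀ i, szC (C0 n k hk) i = a + if (i:ℕ) < n % k then 1 else 0 := szC_C0 n k hk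
  have hR : Rex (C0 n k hk) I = a * I.card + l1 := by
    rw [Rex, Finset.sum_congr rfl fun i _ => hsz i, Finset.sum_add_distrib, Finset.sum_const,
      Finset.sum_ite, Finset.sum_const, Finset.sum_const_zero]
    simp [hl1, mul_comm]
  have hterm : ∀ i ∈ I, (k * ((a : ℝ) + 1) ^ 2 * (wA β (szC (C0 n k hk) i) * ((n:ℝ) ^ szC (C0 n k hk) i)⁻¹)) =
      (k * ((a : ℝ) + 1) ^ 2 * v0) * (if (i:ℕ) < n % k then ω else 1) := by
    intro i _
    rw [hsz]
    split_ifs with h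
    · rw [hv0, hω, wA, wA]
      have : (a + 1).choose 2 = a.choose 2 + a := by
        rw [Nat.choose_succ_succ' a 1]; simp; ring
      rw [this, Nat.factorial_succ]
      push_cast
      field_simp
      ring
    · rw [add_zero, mul_one, hv0]
      field_simp
  rw [Finset.prod_congr rfl hterm, Finset.prod_mul_distrib, Finset.prod_const, Finset.prod_ite,
    Finset.prod_const, Finset.prod_const_one, mul_one, ← hl1]
  have e1 : (k * ((a : ℝ) + 1) ^ 2 * v0) ^ I.card = Real.exp (I.card * (Real.log k + 2 * Real.log (a + 1) + Real.log v0)) := by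
    rw [Real.exp_nat_mul]
    congr 1
    rw [Real.exp_add, Real.exp_add, Real.exp_log hk0, Real.exp_log hv0p, two_mul, Real.exp_add,
      Real.exp_log (by positivity)]
    ring
  have e2 : ω ^ l1 = Real.exp (l1 * Real.log ω) := by
    rw [Real.exp_nat_mul, Real.exp_log hωp]
  rw [e1, e2, ← Real.exp_add, ← Real.exp_add, hR]
  rw [Real.exp_le_exp]
  have hkk := Nat.mod_lt n hk
  have hnn := Nat.div_add_mod n k
  have key := logZ (k:ℝ) (n:ℝ) (a:ℝ) ((n % k : ℕ):ℝ) ((I.card:ℕ):ℝ) (l1:ℝ) (Real.log v0) (Real.log ω) Cc (Real.log n) hk0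
    (by exact_mod_cast hkn) (by rw [ha]; exact_mod_cast (by rw [mul_comm]; exact hnn)) (Nat.cast_nonneg _)
    (by exact_mod_cast hkk.le) (Nat.cast_nonneg _) (by exact_mod_cast Finset.card_filter_le _ _)
    (by
      have : l1 ≤ n % k := by
        rw [← card_lt_fin k (n % k) hkk.le]
        exact Finset.card_le_card (Finset.filter_subset_filter _ (Finset.subset_univ _))
      exact_mod_cast this)
    (by
      have := Finset.card_le_univ I
      rw [Fintype.card_fin] at this
      exact_mod_cast this)
    (Real.log_nonneg (by rw [hω, le_div_iff₀ hn0, one_mul]; exact hW0))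
    (Real.log_le_log hωp (by rw [hω, div_le_iff₀ hn0, ← sq]; exact hWL)) hV
  push_cast
  linarith

theorem sumI (k : ℕ) (n : ℝ) (a ε0 η q x1 : ℝ) (hk : 0 < k) (hη0 : 0 < η) (hx1 : 0 < x1)
    (haL : Real.log n ≤ a)
    (h1 : q - (1 - η) * (a - Real.log n) ≤ Real.log x1)
    (h2 : q - ε0 * (a - Real.log n) ≤ - (4 / η))
    (T : Finset (Fin k) → ℝ) (P : Finset (Fin k) → Prop)
    (hP : ∀ I, P I → ε0 * k ≤ k - (I.card : ℝ))
    (hT : ∀ I, T I ≤ Real.exp (I.card * q - I.card * (k - I.card) / k * (a - Real.log n))) :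
    ∑ I ∈ (Finset.univ : Finset (Finset (Fin k))).filter P, T I ≤ (1 + x1) ^ k + Real.exp (-2 * k) := by
  have hk0 : (0:ℝ) < k := by exact_mod_cast hk
  have hg : 0 ≤ a - Real.log n := by linarith
  have key : ∀ I ∈ (Finset.univ : Finset (Finset (Fin k))).filter P,
      T I ≤ x1 ^ I.card + Real.exp (-4 * k) := by
    intro I hI
    have hPI := hP I (Finset.mem_filter.1 hI).2
    refine (hT I).trans ?_
    set l : ℝ := ((I.card : ℕ) : ℝ) with hl
    have hl0 : 0 ≤ l := Nat.cast_nonneg _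
    by_cases hc : l ≤ η * k
    · have : Real.exp (l * q - l * (k - l) / k * (a - Real.log n)) ≤ x1 ^ I.card := by
        rw [← Real.exp_log hx1, ← Real.exp_nat_mul, Real.exp_le_exp, ← hl]
        have : (1 - η) ≤ (k - l) / k := by
          rw [le_div_iff₀ hk0]; linarith
        calc _ = l * (q - (k - l) / k * (a - Real.log n)) := by ring
          _ ≤ l * (q - (1 - η) * (a - Real.log n)) := by gcongr
          _ ≤ _ := by gcongr
      refine this.trans (le_add_of_nonneg_right (by positivity))
    · push Not at hc
      have : Real.exp (l * q - l * (k - l) / k * (a - Real.log n)) ≤ Real.exp (-4 * k) := by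
        rw [Real.exp_le_exp]
        have : ε0 ≤ (k - l) / k := by
          rw [le_div_iff₀ hk0]; linarith
        calc _ = l * (q - (k - l) / k * (a - Real.log n)) := by ring
          _ ≤ l * (q - ε0 * (a - Real.log n)) := by gcongr
          _ ≤ l * (-(4 / η)) := by gcongr
          _ ≤ _ := by
            have : k ≤ l / η := by rw [le_div_iff₀ hη0]; linarith
            calc l * (-(4 / η)) = - 4 * (l / η) := by ring
              _ ≤ _ := by nlinarith
      refine this.trans (le_add_of_nonneg_left (by positivity))
  calc _ ≤ ∑ I ∈ (Finset.univ : Finset (Finset (Fin k))).filter P, (x1 ^ I.card + Real.exp (-4 * k)) :=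
        Finset.sum_le_sum key
    _ ≤ ∑ I : Finset (Fin k), (x1 ^ I.card + Real.exp (-4 * k)) :=
        Finset.sum_le_sum_of_subset_of_nonneg (Finset.filter_subset _ _) fun I _ _ => by positivity
    _ = (1 + x1) ^ k + 2 ^ k * Real.exp (-4 * k) := by
        rw [Finset.sum_add_distrib]
        congr 1
        · have := Fintype.sum_pow_mul_eq_add_pow (Fin k) x1 1
          simp only [one_pow, mul_one, Fintype.card_fin] at this
          rw [this, add_comm]
        · simp
    _ ≤ _ := by
        gcongr
        have h2e : (2:ℝ) ≤ Real.exp 2 := by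
          have := Real.add_one_le_exp (2:ℝ); linarith
        calc (2:ℝ) ^ k * Real.exp (-4 * k) ≤ (Real.exp 2) ^ k * Real.exp (-4 * k) := by gcongr
          _ = _ := by rw [← Real.exp_nat_mul, ← Real.exp_add]; congr 1; ring

/-- the set of large classes -/
def bigU (n k : ℕ) : Finset (Fin k) := Finset.univ.filter fun j : Fin k => (j:ℕ) < n % k

/-- number of large classes mapped to small ones -/
def crossP (n k : ℕ) (π : Equiv.Perm (Fin k)) : ℕ := ((bigU n k).image π \ bigU n k).card

theorem card_perm_image (n k : ℕ) (hk : 0 < k) (V : Finset (Fin k)) :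
    (Finset.univ.filter fun π : Equiv.Perm (Fin k) => (bigU n k).image π = V).card ≤
      (k - n % k).factorial * (n % k).factorial := by
  by_cases h : ∃ π0 : Equiv.Perm (Fin k), (bigU n k).image π0 = V
  · obtain ⟨π0, h0⟩ := h
    have := card_stab (tyC n k)
    rw [Fin.prod_univ_two, card_ty0 n k hk, card_ty1 n k hk] at this
    rw [← this]
    refine Finset.card_le_card_of_injOn (fun π => π0⁻¹ * π) ?_ ?_
    · intro π hπ
      simp only [Finset.coe_filter, Finset.mem_univ, true_and, Set.mem_ofPred_eq] at hπ ⊢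
      have key : ∀ j, (π0⁻¹ * π) j ∈ bigU n k ↔ j ∈ bigU n k := by
        intro j
        have h1 : π j ∈ (bigU n k).image π ↔ j ∈ bigU n k := by simp
        have h2 : π0 ((π0⁻¹ * π) j) ∈ (bigU n k).image π0 ↔ (π0⁻¹ * π) j ∈ bigU n k := by
          rw [Finset.mem_image]
          constructor
          · rintro ⟨x, hx, h⟩
            rwa [π0.injective h] at hx
          · intro h; exact ⟨_, h, rfl⟩
        rw [← h1, ← h2, hπ, h0]
        simp
      funext j
      have := key j
      simp only [bigU, Finset.mem_filter, Finset.mem_univ, true_and] at this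
      simp only [Function.comp, tyC]
      simp only [this]
    · intro π _ π' _ h
      simpa using h
  · push Not at h
    rw [Finset.filter_false_of_mem fun π _ => h π]
    simp

theorem sum_perm (n k : ℕ) (hk : 0 < k) (z : ℝ) (hz : 0 ≤ z) :
    ∑ π : Equiv.Perm (Fin k), ((crossP n k π).factorial : ℝ) * z ^ crossP n k π ≤
      ((k - n % k).factorial * (n % k).factorial : ℕ) * Real.exp ((k:ℝ) ^ 2 * z) := by
  set U := bigU n k with hU
  set g : Finset (Fin k) → ℝ := fun V => ((V \ U).card.factorial : ℝ) * z ^ (V \ U).card with hg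
  have hg0 : ∀ V, 0 ≤ g V := fun V => by positivity
  set T := (Finset.univ : Finset (Finset (Fin k))).filter fun V => V.card = U.card with hT
  have h1 : ∑ π : Equiv.Perm (Fin k), ((crossP n k π).factorial : ℝ) * z ^ crossP n k π =
      ∑ V ∈ T, ∑ π ∈ Finset.univ.filter (fun π : Equiv.Perm (Fin k) => U.image π = V), g (U.image π) := by
    rw [Finset.sum_fiberwise_of_maps_to]
    · rfl
    · intro π _
      rw [hT, Finset.mem_filter]
      exact ⟨Finset.mem_univ _, Finset.card_image_of_injective _ π.injective⟩
  rw [h1]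
  have h2 : ∀ V ∈ T, ∑ π ∈ Finset.univ.filter (fun π : Equiv.Perm (Fin k) => U.image π = V), g (U.image π) ≤
      ((k - n % k).factorial * (n % k).factorial : ℕ) * g V := by
    intro V _
    rw [Finset.sum_congr rfl (g := fun _ => g V) (fun π hπ => by rw [(Finset.mem_filter.1 hπ).2]),
      Finset.sum_const, nsmul_eq_mul]
    refine mul_le_mul_of_nonneg_right ?_ (hg0 V)
    exact_mod_cast card_perm_image n k hk V
  refine (Finset.sum_le_sum h2).trans ?_
  rw [← Finset.mul_sum]
  refine mul_le_mul_of_nonneg_left ?_ (by positivity)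
  -- sum over V
  have h3 : ∑ V ∈ T, g V ≤ ∑ q : Finset (Fin k) × Finset (Fin k),
      if q.2.card = q.1.card then (q.1.card.factorial : ℝ) * z ^ q.1.card else 0 := by
    have hcard : ∀ V ∈ T, (U \ V).card = (V \ U).card := by
      intro V hV
      have hV := (Finset.mem_filter.1 hV).2
      exact (Finset.card_sdiff_comm hV).symm
    set F : Finset (Fin k) × Finset (Fin k) → ℝ := fun q => if q.2.card = q.1.card then (q.1.card.factorial : ℝ) * z ^ q.1.card else 0 with hF
    have hinj : Set.InjOn (fun V : Finset (Fin k) => (V \ U, U \ V)) (T : Set (Finset (Fin k))) := by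
      intro V hV V' hV' h
      simp only [Prod.mk.injEq] at h
      have e : ∀ V : Finset (Fin k), V = (V \ U) ∪ (U \ (U \ V)) := by
        intro V; ext x; simp; tauto
      rw [e V, e V', h.1, h.2]
    calc ∑ V ∈ T, g V = ∑ V ∈ T, F (V \ U, U \ V) := by
          refine Finset.sum_congr rfl fun V hV => ?_
          simp only [hF, hcard V hV, if_true, hg]
      _ = ∑ q ∈ T.image (fun V => (V \ U, U \ V)), F q := (Finset.sum_image hinj).symm
      _ ≤ _ := by
        refine Finset.sum_le_sum_of_subset_of_nonneg (Finset.subset_univ _) fun q _ _ => ?_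
        simp only [hF]
        split_ifs <;> positivity
  refine h3.trans ?_
  rw [Fintype.sum_prod_type]
  have h4 : ∀ A : Finset (Fin k), (∑ B : Finset (Fin k), if B.card = A.card then (A.card.factorial : ℝ) * z ^ A.card else 0)
      ≤ ((k:ℝ) * z) ^ A.card := by
    intro A
    rw [← Finset.sum_filter, Finset.sum_const, nsmul_eq_mul]
    have : (Finset.univ.filter fun B : Finset (Fin k) => B.card = A.card).card = k.choose A.card := by
      have := Finset.card_powersetCard A.card (Finset.univ : Finset (Fin k))
      rw [Finset.card_univ, Fintype.card_fin] at this
      rw [← this]; congr 1; ext B; simp [Finset.mem_powersetCard]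
    rw [this, mul_pow, ← mul_assoc]
    refine mul_le_mul_of_nonneg_right ?_ (by positivity)
    have := Nat.descFactorial_eq_factorial_mul_choose k A.card
    have h5 := Nat.descFactorial_le_pow k A.card
    rw [this, mul_comm] at h5
    exact_mod_cast h5
  refine (Finset.sum_le_sum fun A _ => h4 A).trans ?_
  have := Fintype.sum_pow_mul_eq_add_pow (Fin k) ((k:ℝ) * z) 1
  simp only [one_pow, mul_one, Fintype.card_fin] at this
  rw [this]
  calc ((k:ℝ) * z + 1) ^ k ≤ (Real.exp (k * z)) ^ k := by
        gcongr; exact Real.add_one_le_exp _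
    _ = _ := by rw [← Real.exp_nat_mul]; congr 1; ring

theorem sum_d (k n : ℕ) (hkn : k ≤ n) (x : ℝ) (hx : 0 ≤ x) (hnx : 2 * n * x ≤ 1 / 2)
    (T : Finset (Fin k → ℕ)) (hT : ∀ d ∈ T, ∑ i, d i ≤ n) :
    ∑ d ∈ T, ((∑ i, d i).factorial : ℝ) * x ^ (∑ i, d i) ≤ 2 := by
  have h1 : ∑ d ∈ T, ((∑ i, d i).factorial : ℝ) * x ^ (∑ i, d i) =
      ∑ s ∈ Finset.range (n + 1), ∑ d ∈ T.filter (fun d => ∑ i, d i = s), ((∑ i, d i).factorial : ℝ) * x ^ (∑ i, d i) := by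
    rw [Finset.sum_fiberwise_of_maps_to]
    intro d hd
    have := hT d hd
    simp; omega
  rw [h1]
  have h2 : ∀ s ∈ Finset.range (n + 1),
      ∑ d ∈ T.filter (fun d => ∑ i, d i = s), ((∑ i, d i).factorial : ℝ) * x ^ (∑ i, d i) ≤ (1 / 2) ^ s := by
    intro s hs
    have hs : s ≤ n := by simpa [Nat.lt_succ_iff] using hs
    rw [Finset.sum_congr rfl (g := fun _ => (s.factorial : ℝ) * x ^ s)
      (fun d hd => by rw [(Finset.mem_filter.1 hd).2]), Finset.sum_const, nsmul_eq_mul]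
    have hc : (T.filter (fun d => ∑ i, d i = s)).card ≤ k.multichoose s := by
      have e := Sym.card_sym_eq_multichoose (Fin k) s
      rw [Fintype.card_fin] at e
      rw [← e, ← Fintype.card_coe]
      refine Fintype.card_le_of_injective
        (fun d => (Sym.equivNatSumOfFintype (Fin k) s).symm ⟨d.1, (Finset.mem_filter.1 d.2).2⟩) ?_
      intro d d' h
      have := (Sym.equivNatSumOfFintype (Fin k) s).symm.injective h
      exact Subtype.ext (congrArg (fun q => q.1) this)
    have hm : k.multichoose s * s.factorial ≤ (2 * n) ^ s := by
      rw [Nat.multichoose_eq, mul_comm, ← Nat.descFactorial_eq_factorial_mul_choose]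
      refine (Nat.descFactorial_le_pow _ _).trans (Nat.pow_le_pow_left (by omega) _)
    have hm' : ((T.filter (fun d => ∑ i, d i = s)).card : ℝ) * s.factorial ≤ (2 * n) ^ s := by
      have := (Nat.mul_le_mul_right s.factorial hc).trans hm
      exact_mod_cast this
    calc _ = ((T.filter (fun d => ∑ i, d i = s)).card : ℝ) * s.factorial * x ^ s := by ring
      _ ≤ (2 * n) ^ s * x ^ s := by gcongr
      _ = (2 * n * x) ^ s := by rw [mul_pow (2 * (n:ℝ))]
      _ ≤ _ := by gcongr
  refine (Finset.sum_le_sum h2).trans ?_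
  have := geom_sum_eq (x := (1/2:ℝ)) (by norm_num) (n + 1)
  rw [this, div_le_iff_of_neg (by norm_num)]
  have : (0:ℝ) ≤ (1 / 2) ^ (n + 1) := by positivity
  linarith

theorem fact_three (u d c : ℕ) :
    (u + d + c).factorial ≤ 3 ^ (u + d + c) * (u.factorial * d.factorial * c.factorial) := by
  have h1 : ∀ x y : ℕ, (x + y).factorial = (x + y).choose x * (x.factorial * y.factorial) := by
    intro x y
    have := Nat.add_choose_mul_factorial_mul_factorial x y
    rw [← this, Nat.choose_symm_add]; ring
  have e : (3:ℕ) ^ (u + d + c) = ∑ i ∈ Finset.range (u + d + c + 1), 2 ^ i * 1 ^ (u + d + c - i) * (u + d + c).choose i := by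
    have := add_pow (2:ℕ) 1 (u + d + c)
    simpa using this
  have h2 : 2 ^ (u + d) * (u + d + c).choose (u + d) ≤ 3 ^ (u + d + c) := by
    rw [e]
    have := Finset.single_le_sum (f := fun i => 2 ^ i * 1 ^ (u + d + c - i) * (u + d + c).choose i)
      (fun _ _ => Nat.zero_le _) (show u + d ∈ Finset.range (u + d + c + 1) by simp)
    simpa using this
  have h3 := Nat.choose_le_two_pow (u + d) u
  rw [h1 (u + d) c, h1 u d]
  calc _ = ((u + d).choose u * (u + d + c).choose (u + d)) * (u.factorial * d.factorial * c.factorial) := by ring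
    _ ≤ (2 ^ (u + d) * (u + d + c).choose (u + d)) * (u.factorial * d.factorial * c.factorial) := by gcongr
    _ ≤ _ := by gcongr

theorem wt_core (β : ℝ) (hβ : 1 ≤ β) (a τ X Y ρ d e E : ℕ) (hX : X = ρ + d) (hXa : X ≤ a + 1)
    (hE : e + τ * d ≤ E) :
    β ^ e * ((X.descFactorial ρ : ℝ) / ρ.factorial * (Y.descFactorial ρ : ℝ)) ≤
      β ^ E * Y.factorial * (((a:ℝ) + 1) / β ^ τ) ^ d := by
  have hβ0 : 0 < β := by linarith
  have h1 : (X.descFactorial ρ : ℝ) / ρ.factorial ≤ ((a:ℝ) + 1) ^ d := by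
    rw [Nat.descFactorial_eq_factorial_mul_choose]
    push_cast
    rw [mul_div_cancel_left₀ _ (by positivity)]
    have : X.choose ρ = X.choose d := by rw [hX, Nat.choose_symm_add]
    rw [this]
    calc (X.choose d : ℝ) ≤ (X:ℝ) ^ d := by exact_mod_cast Nat.choose_le_pow X d
      _ ≤ _ := by gcongr; exact_mod_cast hXa
  have h2 : (Y.descFactorial ρ : ℝ) ≤ Y.factorial := by
    have h : Y.descFactorial ρ ≤ Y.factorial := by
      by_cases hr : ρ ≤ Y
      · rw [← Nat.factorial_mul_descFactorial hr]
        exact Nat.le_mul_of_pos_left _ (Nat.factorial_pos _)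
      · rw [Nat.descFactorial_eq_zero_iff_lt.2 (by omega)]; exact Nat.zero_le _
    exact_mod_cast h
  have h3 : β ^ e ≤ β ^ E / (β ^ τ) ^ d := by
    rw [le_div_iff₀ (by positivity), ← pow_mul, ← pow_add]
    exact pow_le_pow_right₀ hβ hE
  calc _ ≤ β ^ E / (β ^ τ) ^ d * (((a:ℝ) + 1) ^ d * Y.factorial) := by gcongr
    _ = _ := by rw [div_pow]; ring

/-- pair weights -/
def wPair (β : ℝ) (a A A' : ℕ) : ℝ :=
  if A = a then (if A' = a then 1 else a + 1) else if A' = a then a + 1 else (a + 1) * β ^ a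

theorem wPair_ge (β : ℝ) (hβ : 1 ≤ β) (a A A' : ℕ) : 1 ≤ wPair β a A A' := by
  have : (0:ℝ) ≤ a := Nat.cast_nonneg _
  have h := one_le_pow₀ hβ (n := a)
  unfold wPair
  split_ifs <;> nlinarith

theorem wt_le2 (β : ℝ) (hβ : 1 ≤ β) (a τ A A' ρ : ℕ) (hA : A = a ∨ A = a + 1) (hA' : A' = a ∨ A' = a + 1)
    (hτ : τ < ρ) (h1 : ρ ≤ A) (h2 : ρ ≤ A') :
    β ^ (ρ.choose 2 + (A - ρ).choose 2) * (A.descFactorial ρ : ℝ) * (A'.descFactorial ρ : ℝ) / ρ.factorial ≤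
      wA β a * wPair β a A A' * (((a:ℝ) + 1) / β ^ τ) ^ (min A A' - ρ) := by
  have hs : (a + 1).choose 2 = a.choose 2 + a := by
    rw [Nat.choose_succ_succ' a 1]; simp; ring
  have hne : a + 1 ≠ a := by omega
  rcases hA with rfl | rfl <;> rcases hA' with rfl | rfl
  · obtain ⟨d, rfl⟩ := Nat.exists_eq_add_of_le h1
    have := wt_core β hβ (ρ + d) τ (ρ + d) (ρ + d) ρ d (ρ.choose 2 + d.choose 2) ((ρ + d).choose 2) rfl (by omega)
      (by rw [choose_two_split]; nlinarith)
    simp only [wPair, wA, min_self, Nat.add_sub_cancel_left, if_true, mul_one]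
    calc _ = _ := by ring
      _ ≤ _ := this
      _ = _ := by ring
  · obtain ⟨d, rfl⟩ := Nat.exists_eq_add_of_le h1
    have := wt_core β hβ (ρ + d) τ (ρ + d) (ρ + d + 1) ρ d (ρ.choose 2 + d.choose 2) ((ρ + d).choose 2) rfl (by omega)
      (by rw [choose_two_split]; nlinarith)
    simp only [wPair, wA, Nat.add_sub_cancel_left, if_true, hne, if_false]
    rw [min_eq_left (by omega), Nat.add_sub_cancel_left]
    calc _ = _ := by ring
      _ ≤ _ := this
      _ = _ := by rw [Nat.factorial_succ]; push_cast; ring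
  · obtain ⟨d, rfl⟩ := Nat.exists_eq_add_of_le h2
    have := wt_core β hβ (ρ + d) τ (ρ + d) (ρ + d + 1) ρ d (ρ.choose 2 + (d + 1).choose 2) ((ρ + d).choose 2) rfl (by omega)
      (by rw [choose_two_split ρ d, choose_two_split d 1]; simp; nlinarith)
    simp only [wPair, wA, if_true, hne, if_false]
    rw [min_eq_right (by omega), Nat.add_sub_cancel_left, show ρ + d + 1 - ρ = d + 1 by omega]
    calc _ = _ := by ring
      _ ≤ _ := this
      _ = _ := by rw [Nat.factorial_succ]; push_cast; ring
  · obtain ⟨d, hd⟩ := Nat.exists_eq_add_of_le h1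
    have := wt_core β hβ a τ (a + 1) (a + 1) ρ d (ρ.choose 2 + d.choose 2) ((a + 1).choose 2) hd le_rfl
      (by rw [hd, choose_two_split]; nlinarith)
    simp only [wPair, wA, hne, if_false, min_self]
    rw [show a + 1 - ρ = d by omega]
    calc _ = _ := by ring
      _ ≤ _ := this
      _ = _ := by rw [Nat.factorial_succ, hs, pow_add]; push_cast; ring

theorem card_cross (n k : ℕ) (π : Equiv.Perm (Fin k)) :
    (Finset.univ.filter fun i : Fin k => i ∈ bigU n k ∧ π i ∉ bigU n k).card = crossP n k π := by
  rw [crossP]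
  rw [← Finset.card_map π.toEmbedding]
  congr 1
  ext j
  simp only [Finset.mem_map, Finset.mem_filter, Finset.mem_univ, true_and, Finset.mem_sdiff, Finset.mem_image,
    Equiv.coe_toEmbedding]
  constructor
  · rintro ⟨i, ⟨h1, h2⟩, rfl⟩; exact ⟨⟨i, h1, rfl⟩, h2⟩
  · rintro ⟨⟨i, h1, rfl⟩, h2⟩; exact ⟨i, ⟨h1, h2⟩, rfl⟩

theorem card_cross' (n k : ℕ) (π : Equiv.Perm (Fin k)) :
    (Finset.univ.filter fun i : Fin k => i ∉ bigU n k ∧ π i ∈ bigU n k).card = crossP n k π := by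
  have hc : ((bigU n k).image π).card = (bigU n k).card := Finset.card_image_of_injective _ π.injective
  rw [crossP, Finset.card_sdiff_comm hc]
  rw [← Finset.card_map π.toEmbedding]
  congr 1
  ext j
  simp only [Finset.mem_map, Finset.mem_filter, Finset.mem_univ, true_and, Finset.mem_sdiff, Finset.mem_image,
    Equiv.coe_toEmbedding]
  constructor
  · rintro ⟨i, ⟨h1, h2⟩, rfl⟩
    refine ⟨h2, ?_⟩
    rintro ⟨x, hx, h⟩
    rw [π.injective h] at hx
    exact h1 hx
  · rintro ⟨h1, h2⟩
    refine ⟨π.symm j, ⟨?_, by simpa using h1⟩, by simp⟩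
    intro h
    exact h2 ⟨_, h, by simp⟩

theorem prod_wPair (n k : ℕ) (hk : 0 < k) (β : ℝ) (hβ : 1 ≤ β) (π : Equiv.Perm (Fin k)) :
    ∏ i, wPair β (n / k) (szC (C0 n k hk) i) (szC (C0 n k hk) (π i)) =
      (((n / k : ℕ) + 1) * β ^ (n / k)) ^ (n % k) * ((((n / k : ℕ):ℝ) + 1) / β ^ (n / k)) ^ crossP n k π := by
  set a := n / k
  have hβ0 : 0 < β := by linarith
  set Ω : ℝ := ((a:ℝ) + 1) * β ^ a with hΩ
  have hΩ0 : Ω ≠ 0 := by positivity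
  have h1 : ∀ i, wPair β a (szC (C0 n k hk) i) (szC (C0 n k hk) (π i)) =
      (if (i:ℕ) < n % k then Ω else 1) * (if i ∈ bigU n k ∧ π i ∉ bigU n k then ((a:ℝ) + 1) / Ω else 1) *
      (if i ∉ bigU n k ∧ π i ∈ bigU n k then ((a:ℝ) + 1) else 1) := by
    intro i
    rw [szC_C0, szC_C0]
    simp only [bigU, Finset.mem_filter, Finset.mem_univ, true_and]
    by_cases hi : (i:ℕ) < n % k <;> by_cases hp : ((π i : Fin k) : ℕ) < n % k <;>
      simp [hi, hp, wPair, a, hΩ]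
    field_simp
  rw [Finset.prod_congr rfl fun i _ => h1 i, Finset.prod_mul_distrib, Finset.prod_mul_distrib,
    prod_ty n k hk, one_pow, mul_one]
  rw [Finset.prod_ite, Finset.prod_ite]
  simp only [Finset.prod_const, one_pow, mul_one]
  rw [card_cross, card_cross', mul_assoc, ← mul_pow]
  congr 2
  rw [hΩ]; field_simp

/-- extension of the partial matching in the data -/
theorem exists_ext {n k : ℕ} (C : Fin n → Fin k) (τ : ℕ) (hτ : ∀ j, szC C j < 2 * (τ + 1))
    (σ : Equiv.Perm (Fin n)) : ∃ π : Equiv.Perm (Fin k), ∀ i j ρ, dat C τ σ i = some (j, ρ) → π i = j := by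
  set I : Set (Fin k) := {i | dat C τ σ i ≠ none} with hI
  have hg : ∀ i : I, ∃ j : Fin k, ∃ ρ, dat C τ σ i.1 = some (j, ρ) := by
    rintro ⟨i, hi⟩
    rcases h : dat C τ σ i with _ | ⟨j, ρ⟩
    · exact absurd h hi
    · exact ⟨j, ρ, rfl⟩
  choose g hg using hg
  have hinj : Function.Injective g := by
    intro i i' h
    obtain ⟨ρ, h1⟩ := hg i
    obtain ⟨ρ', h2⟩ := hg i'
    rw [← h] at h2
    exact Subtype.ext (dat_inj C τ hτ σ _ _ _ _ _ h1 h2)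
  obtain ⟨π, hπ⟩ := Equiv.Perm.exists_extending_pair (fun i : I => i.1) g Subtype.val_injective hinj
  refine ⟨π, fun i j ρ h => ?_⟩
  have hi : i ∈ I := by rw [hI]; simp [h]
  obtain ⟨ρ', h'⟩ := hg ⟨i, hi⟩
  have h2 := hπ ⟨i, hi⟩
  simp only at h2 h'
  rw [h] at h'
  rw [h2]
  simp only [Option.some.injEq, Prod.mk.injEq] at h'
  exact h'.1.symm

/-- deficiency -/
def defD {n k : ℕ} (C : Fin n → Fin k) (o : RowD k) (i : Fin k) : ℕ := match o with
  | none => 0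
  | some (j, ρ) => min (szC C i) (szC C j) - ρ

theorem term2 (n k : ℕ) (hk : 0 < k) (β : ℝ) (hβ : 1 ≤ β) (τ : ℕ) (ν : ℝ) (hν : 1 ≤ ν)
    (hc : β ^ (τ + 2) * ((((n / k + 1 : ℕ) : ℝ)) ^ 2 * (Real.exp 1 / ν)) ^ 2 ≤ 1 / 4)
    (hrow : 2 * (β - 1) * ((n / k + 1).choose 2 : ℕ) * (fk n k : ℝ) * (Real.exp 1 / ν) ^ 2 +
      k * (2 * β ^ 3 * ((((n / k + 1 : ℕ) : ℝ)) ^ 2 * (Real.exp 1 / ν)) ^ 3) ≤ 1)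
    (σ : Equiv.Perm (Fin n)) (D : Fin k → RowD k) (hD : dat (C0 n k hk) τ σ = D)
    (hh : (((n / k + 1) * (k - (domD D).card) : ℕ) : ℝ) ≤ ν)
    (π : Equiv.Perm (Fin k)) (hπ : ∀ i j ρ, D i = some (j, ρ) → π i = j) :
    ∑ σ ∈ Finset.univ.filter (fun σ : Equiv.Perm (Fin n) => HasData (C0 n k hk) τ σ D), β ^ sC (C0 n k hk) σ ≤
    (wA β (n / k) ^ k * (((n / k : ℕ) + 1) * β ^ (n / k)) ^ (n % k)) *
    (((3 * ν) ^ (n / k + 1) * Real.exp 1 / wA β (n / k)) ^ (k - (domD D).card) *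
      (((crossP n k π).factorial : ℝ) * (3 * ((((n / k : ℕ):ℝ) + 1) / β ^ (n / k))) ^ crossP n k π) *
      (((∑ i, defD (C0 n k hk) (D i) i).factorial : ℝ) *
        (3 * ((((n / k : ℕ):ℝ) + 1) / β ^ τ)) ^ (∑ i, defD (C0 n k hk) (D i) i))) := by
  set C := C0 n k hk with hC
  set a := n / k with ha
  have hβ0 : 0 < β := by linarith
  have hν0 : 0 < ν := by linarith
  have hDm : D ∈ Fintype.piFinset (datR C τ) := hD ▸ dat_mem C τ σ
  have hRU := datR_RU C τ D hDm
  set R := ∑ i, rowM (D i) with hR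
  set u := ∑ i, rowU C (D i) i with hu
  set h := k - (domD D).card with hhd
  set c := crossP n k π with hcd
  set d := ∑ i, defD C (D i) i with hd
  have hszA : ∀ j, szC C j ≤ a + 1 := fun j => (sz_bounds n k hk j).2
  have hsza : ∀ j, szC C j = a ∨ szC C j = a + 1 := fun j => by
    have := sz_bounds n k hk j
    change a ≤ szC C j ∧ szC C j ≤ a + 1 at this
    omega
  have hcompl : ((domD D)ᶜ).card = h := by
    rw [Finset.card_compl, Fintype.card_fin]
  -- u bound
  have huh : u ≤ (a + 1) * h := by
    have : u = ∑ i ∈ (domD D)ᶜ, rowU C (D i) i := by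
      symm
      refine Finset.sum_subset (Finset.subset_univ _) fun i _ hi => ?_
      simp only [domD, Finset.mem_compl, Finset.mem_filter, Finset.mem_univ, true_and, not_not] at hi
      rcases hDi : D i with _ | q
      · exact absurd hDi hi
      · rfl
    rw [this, ← hcompl, mul_comm, ← smul_eq_mul, ← Finset.sum_const]
    refine Finset.sum_le_sum fun i _ => ?_
    rcases hDi : D i with _ | q
    · exact hszA i
    · simp [rowU]
  have huν : (u:ℝ) ≤ ν := le_trans (by exact_mod_cast huh) hh
  -- n - R
  have hsome : ∀ i j ρ, D i = some (j, ρ) → τ < ρ ∧ ρ ≤ szC C i ∧ ρ ≤ szC C j := by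
    intro i j ρ hi
    rw [← hD] at hi
    exact (dat_some C τ σ i j ρ hi).2
  have hn' : n - R ≤ u + d + c := by
    have key : ∀ i, szC C i ≤ rowM (D i) + rowU C (D i) i + defD C (D i) i +
        (if i ∈ bigU n k ∧ π i ∉ bigU n k then 1 else 0) := by
      intro i
      rcases hDi : D i with _ | ⟨j, ρ⟩
      · simp [rowU]; omega
      · have h1 := hsome i j ρ hDi
        have h2 := hπ i j ρ hDi
        have h3 := szC_C0 n k hk i
        have h4 := szC_C0 n k hk j
        rw [← hC] at h3 h4
        simp only [rowM, rowU, defD, bigU, Finset.mem_filter, Finset.mem_univ, true_and, h2]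
        split_ifs at h3 h4 ⊢ <;> omega
    have := Finset.sum_le_sum fun i (_ : i ∈ (Finset.univ : Finset (Fin k))) => key i
    rw [sum_sz, Finset.sum_add_distrib, Finset.sum_add_distrib, Finset.sum_add_distrib,
      ← Finset.card_filter, card_cross] at this
    omega
  -- main bound
  have main := main_term C τ β hβ D ((ν / u) ^ u) 0 (Real.exp 1 / ν) 0 hRU
    (by
      intro T hT
      rw [← hu] at hT
      rw [← hR, zero_mul, add_zero]
      rcases Nat.eq_zero_or_pos u with hu0 | hu0
      · have : T = 0 := by omega
        simp [hu0, this]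
      have hup : (0:ℝ) < u := by exact_mod_cast hu0
      have h1 : ((u:ℝ) / Real.exp 1) ^ T ≤ ((n - R).descFactorial T : ℝ) := by
        refine (desc_lower' u T hT).trans ?_
        exact_mod_cast Nat.descFactorial_le T (by omega)
      have h2 : (1:ℝ) ≤ (ν / u) ^ (u - T) := one_le_pow₀ ((one_le_div hup).2 huν)
      have h3 : (ν / u) ^ u = (ν / u) ^ (u - T) * (ν / u) ^ T := by
        rw [← pow_add]; congr 1; omega
      calc (1:ℝ) ≤ (ν / u) ^ (u - T) := h2
        _ = ((u:ℝ) / Real.exp 1) ^ T * ((ν / u) ^ u * (Real.exp 1 / ν) ^ T) := by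
            rw [h3]
            calc (ν / u) ^ (u - T) = (ν / u) ^ (u - T) * ((u:ℝ) / Real.exp 1 * (ν / u) * (Real.exp 1 / ν)) ^ T := by
                  rw [show (u:ℝ) / Real.exp 1 * (ν / u) * (Real.exp 1 / ν) = 1 by field_simp]; simp
              _ = _ := by rw [mul_pow, mul_pow]; ring
        _ ≤ _ := by gcongr)
    (by positivity) le_rfl (by positivity) le_rfl
  rw [zero_mul, add_zero] at main
  refine main.trans ?_
  -- rows
  have hrows : ∏ i, rowW C β τ (Real.exp 1 / ν) (D i) i ≤
      (∏ i ∈ domD D, rowW C β τ 0 (D i) i) * Real.exp h := by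
    refine (prod_rowW_le C β (Real.exp 1 / ν) hβ (by positivity) τ (a + 1) hszA hc D).trans ?_
    refine mul_le_mul_of_nonneg_left ?_ (Finset.prod_nonneg fun i _ => rowW_nonneg C β hβ τ 0 le_rfl _ _)
    rw [Real.exp_le_exp]
    calc _ ≤ ∑ i ∈ (domD D)ᶜ, (1:ℝ) := by
          refine Finset.sum_le_sum fun i _ => le_trans ?_ hrow
          have : ((szC C i).choose 2 : ℝ) ≤ ((a + 1).choose 2 : ℕ) := by
            exact_mod_cast Nat.choose_le_choose 2 (hszA i)
          rw [hC, fC_C0, ← hC]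
          have hb : 0 ≤ β - 1 := by linarith
          gcongr
      _ = h := by rw [Finset.sum_const, hcompl]; simp
  -- weights
  have hw0 : 0 < wA β a := by rw [wA]; positivity
  have hW : ∏ i ∈ domD D, rowW C β τ 0 (D i) i ≤
      wA β a ^ (domD D).card * ((((a:ℝ) + 1) * β ^ a) ^ (n % k) * (((a:ℝ) + 1) / β ^ a) ^ c) *
        (((a:ℝ) + 1) / β ^ τ) ^ d := by
    have h1 : ∀ i ∈ domD D, rowW C β τ 0 (D i) i ≤
        wA β a * wPair β a (szC C i) (szC C (π i)) * (((a:ℝ) + 1) / β ^ τ) ^ defD C (D i) i := by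
      intro i hi
      rcases hDi : D i with _ | ⟨j, ρ⟩
      · simp [domD, hDi] at hi
      · have h1 := hsome i j ρ hDi
        have h2 := hπ i j ρ hDi
        simp only [rowW, defD, h2]
        exact wt_le2 β hβ a τ _ _ ρ (hsza i) (hsza j) h1.1 h1.2.1 h1.2.2
    refine (Finset.prod_le_prod (fun i _ => rowW_nonneg C β hβ τ 0 le_rfl _ _) h1).trans ?_
    rw [Finset.prod_mul_distrib, Finset.prod_mul_distrib, Finset.prod_const, Finset.prod_pow_eq_pow_sum]
    have h2 : ∑ i ∈ domD D, defD C (D i) i = d := by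
      refine Finset.sum_subset (Finset.subset_univ _) fun i _ hi => ?_
      simp only [domD, Finset.mem_filter, Finset.mem_univ, true_and, not_not] at hi
      rw [hi]; rfl
    rw [h2]
    gcongr
    rw [← prod_wPair n k hk β hβ π]
    exact Finset.prod_le_prod_of_subset_of_one_le (Finset.subset_univ _)
      (fun i _ => by linarith [wPair_ge β hβ a (szC C i) (szC C (π i))]) fun i _ _ => wPair_ge β hβ a _ _
  -- factorial
  have hfac : (n.factorial : ℝ) / (n.descFactorial R : ℝ) ≤
      3 ^ (u + d + c) * (u.factorial * d.factorial * c.factorial) := by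
    have hRn : R ≤ n := by omega
    have e := Nat.factorial_mul_descFactorial hRn
    have hpos : (0:ℝ) < n.descFactorial R := by
      exact_mod_cast Nat.descFactorial_pos.2 hRn
    rw [← e]
    push_cast
    rw [mul_div_assoc, div_self hpos.ne', mul_one]
    have := (Nat.factorial_le hn').trans (fact_three u d c)
    exact_mod_cast this
  have huu : (u.factorial : ℝ) * (ν / u) ^ u ≤ ν ^ u := by
    rcases Nat.eq_zero_or_pos u with hu0 | hu0
    · simp [hu0]
    have hup : (0:ℝ) < u := by exact_mod_cast hu0
    calc (u.factorial : ℝ) * (ν / u) ^ u ≤ (u:ℝ) ^ u * (ν / u) ^ u := by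
          gcongr; exact_mod_cast Nat.factorial_le_pow u
      _ = _ := by rw [← mul_pow]; congr 1; field_simp
  have h3u : (3 * ν) ^ u ≤ ((3 * ν) ^ (a + 1)) ^ h := by
    rw [← pow_mul]
    exact pow_le_pow_right₀ (by linarith) huh
  have hkk : k = (domD D).card + h := by
    have := Finset.card_le_univ (domD D)
    rw [Fintype.card_fin] at this
    omega
  have hP0 : 0 ≤ ∏ i ∈ domD D, rowW C β τ 0 (D i) i := Finset.prod_nonneg fun i _ => rowW_nonneg C β hβ τ 0 le_rfl _ _
  set Om : ℝ := (((a:ℝ) + 1) * β ^ a) ^ (n % k) with hOm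
  have hOm0 : 0 ≤ Om := by positivity
  calc _ ≤ (3 ^ (u + d + c) * (u.factorial * d.factorial * c.factorial)) * ((ν / u) ^ u *
        ((wA β a ^ (domD D).card * (Om * (((a:ℝ) + 1) / β ^ a) ^ c) *
        (((a:ℝ) + 1) / β ^ τ) ^ d) * Real.exp h)) := by
        have hr2 := hrows.trans (mul_le_mul_of_nonneg_right hW (Real.exp_pos h).le)
        have hr0 : 0 ≤ ∏ i, rowW C β τ (Real.exp 1 / ν) (D i) i :=
          Finset.prod_nonneg fun i _ => rowW_nonneg C β hβ τ _ (by positivity) _ _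
        have hr3 := mul_le_mul_of_nonneg_left hr2 (show (0:ℝ) ≤ (ν / u) ^ u by positivity)
        exact mul_le_mul hfac hr3 (by positivity) (by positivity)
    _ = ((u.factorial : ℝ) * (ν / u) ^ u) * (3 ^ u * wA β a ^ (domD D).card * Real.exp h * Om *
        ((c.factorial : ℝ) * (3 * (((a:ℝ) + 1) / β ^ a)) ^ c) *
        ((d.factorial : ℝ) * (3 * (((a:ℝ) + 1) / β ^ τ)) ^ d)) := by
        rw [mul_pow 3 (((a:ℝ) + 1) / β ^ a), mul_pow 3 (((a:ℝ) + 1) / β ^ τ), pow_add, pow_add]; ring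
    _ ≤ ν ^ u * (3 ^ u * wA β a ^ (domD D).card * Real.exp h * Om *
        ((c.factorial : ℝ) * (3 * (((a:ℝ) + 1) / β ^ a)) ^ c) *
        ((d.factorial : ℝ) * (3 * (((a:ℝ) + 1) / β ^ τ)) ^ d)) := by gcongr
    _ = (3 * ν) ^ u * (wA β a ^ (domD D).card * Real.exp h * Om *
        ((c.factorial : ℝ) * (3 * (((a:ℝ) + 1) / β ^ a)) ^ c) *
        ((d.factorial : ℝ) * (3 * (((a:ℝ) + 1) / β ^ τ)) ^ d)) := by rw [mul_pow 3 ν]; ring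
    _ ≤ ((3 * ν) ^ (a + 1)) ^ h * (wA β a ^ (domD D).card * Real.exp h * Om *
        ((c.factorial : ℝ) * (3 * (((a:ℝ) + 1) / β ^ a)) ^ c) *
        ((d.factorial : ℝ) * (3 * (((a:ℝ) + 1) / β ^ τ)) ^ d)) := by gcongr
    _ = _ := by
        have e1 : Real.exp h = (Real.exp 1) ^ h := by rw [← Real.exp_nat_mul, mul_one]
        have e2 : wA β a ^ k = wA β a ^ (domD D).card * wA β a ^ h := by rw [← pow_add, ← hkk]
        set Z := (3 * ν) ^ (a + 1) with hZ
        rw [e1, e2, div_pow, mul_pow Z]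
        field_simp


theorem wA_Dk (n k : ℕ) (hk : 0 < k) (β : ℝ) :
    (wA β (n / k) ^ k * (((n / k : ℕ) + 1) * β ^ (n / k)) ^ (n % k)) *
      (((k - n % k).factorial * (n % k).factorial : ℕ) : ℝ) = β ^ fk n k * Dk n k := by
  have hlt := Nat.mod_lt n hk
  obtain ⟨c, hc⟩ := Nat.exists_eq_add_of_le hlt.le
  have hs : (n / k + 1).choose 2 = (n / k).choose 2 + n / k := by
    rw [Nat.choose_succ_succ' (n / k) 1]; simp; ring
  rw [Dk, fk, hs]
  generalize n / k = a at *
  generalize n % k = r at *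
  have hc' : k - r = c := by omega
  rw [hc', hc, wA, Nat.factorial_succ]
  push_cast
  rw [mul_pow, mul_pow, mul_pow, pow_add, pow_add]
  ring

theorem R2_fin (n k : ℕ) (hk : 0 < k) (hkn : k ≤ n) (β : ℝ) (hβ : 1 ≤ β) (τ : ℕ) (ν : ℝ) (hν : 1 ≤ ν)
    (hτ : n / k + 1 < 2 * (τ + 1))
    (hc : β ^ (τ + 2) * ((((n / k + 1 : ℕ) : ℝ)) ^ 2 * (Real.exp 1 / ν)) ^ 2 ≤ 1 / 4)
    (hrow : 2 * (β - 1) * ((n / k + 1).choose 2 : ℕ) * (fk n k : ℝ) * (Real.exp 1 / ν) ^ 2 +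
      k * (2 * β ^ 3 * ((((n / k + 1 : ℕ) : ℝ)) ^ 2 * (Real.exp 1 / ν)) ^ 3) ≤ 1)
    (hX : 12 * n * (((n / k : ℕ):ℝ) + 1) ≤ β ^ τ)
    (Q : Finset (Fin k) → Prop)
    (hQ : ∀ I, Q I → (((n / k + 1) * (k - I.card) : ℕ) : ℝ) ≤ ν) :
    ∑ σ ∈ Finset.univ.filter (fun σ : Equiv.Perm (Fin n) => Q (domD (dat (C0 n k hk) τ σ))), β ^ sC (C0 n k hk) σ ≤
    β ^ fk n k * Dk n k * (2 * Real.exp (k * ((3 * ν) ^ (n / k + 1) * Real.exp 1 / wA β (n / k)) +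
      (k:ℝ) ^ 2 * (3 * ((((n / k : ℕ):ℝ) + 1) / β ^ (n / k))))) := by
  set C := C0 n k hk with hC
  set a := n / k with ha
  have hβ0 : 0 < β := by linarith
  have hν0 : 0 < ν := by linarith
  have hsz : ∀ j, szC C j < 2 * (τ + 1) := fun j => lt_of_le_of_lt (sz_bounds n k hk j).2 hτ
  set x := (3 * ν) ^ (a + 1) * Real.exp 1 / wA β a with hx
  have hw0 : 0 < wA β a := by rw [wA]; positivity
  have hx0 : 0 ≤ x := by positivity
  set y := 3 * (((a:ℝ) + 1) / β ^ a) with hy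
  set z := 3 * (((a:ℝ) + 1) / β ^ τ) with hz
  have hy0 : 0 ≤ y := by positivity
  have hz0 : 0 ≤ z := by positivity
  set Wk := wA β a ^ k * (((a:ℝ) + 1) * β ^ a) ^ (n % k) with hWk
  have hWk0 : 0 ≤ Wk := by positivity
  set P : (Fin k → RowD k) → Prop := fun D => (∃ σ, dat C τ σ = D) ∧ Q (domD D) with hP
  refine le_trans (le_of_eq ?_) ((sum_dat C τ P (fun σ => β ^ sC C σ) (fun σ => by positivity)).trans ?_)
  · refine Finset.sum_congr ?_ (fun _ _ => rfl)
    ext σ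
    simp [hP]
  set T := (Fintype.piFinset (datR C τ)).filter P with hT
  have hext : ∀ D : Fin k → RowD k, ∃ π : Equiv.Perm (Fin k), P D → ∀ i j ρ, D i = some (j, ρ) → π i = j := by
    intro D
    by_cases hD : P D
    · obtain ⟨⟨σ, rfl⟩, _⟩ := hD
      obtain ⟨π, hπ⟩ := exists_ext C τ hsz σ
      exact ⟨π, fun _ => hπ⟩
    · exact ⟨1, fun h => absurd h hD⟩
  choose πD hπD using hext
  set dD : (Fin k → RowD k) → (Fin k → ℕ) := fun D i => defD C (D i) i with hdD
  set G : Finset (Fin k) × Equiv.Perm (Fin k) × (Fin k → ℕ) → ℝ := fun q =>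
    x ^ (k - q.1.card) * (((crossP n k q.2.1).factorial : ℝ) * y ^ crossP n k q.2.1) *
      (((∑ i, q.2.2 i).factorial : ℝ) * z ^ (∑ i, q.2.2 i)) with hG
  have hG0 : ∀ q, 0 ≤ G q := fun q => by positivity
  have h1 : ∀ D ∈ T, ∑ σ ∈ Finset.univ.filter (fun σ => HasData C τ σ D), β ^ sC C σ ≤
      Wk * G (domD D, πD D, dD D) := by
    intro D hD
    have hPD := (Finset.mem_filter.1 hD).2
    obtain ⟨σ, hσ⟩ := hPD.1
    exact term2 n k hk β hβ τ ν hν hc hrow σ D hσ (hQ _ hPD.2) (πD D) (hπD D hPD)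
  refine le_trans (le_of_eq ?_) ((Finset.sum_le_sum h1).trans ?_)
  · refine Finset.sum_congr ?_ (fun _ _ => rfl)
    ext D
    simp only [hT, Finset.mem_filter]
  rw [← Finset.mul_sum]
  have hval : ∀ D ∈ T, ∀ i j ρ, D i = some (j, ρ) → τ < ρ ∧ ρ ≤ szC C i ∧ ρ ≤ szC C j := by
    intro D hD i j ρ hi
    obtain ⟨σ, hσ⟩ := (Finset.mem_filter.1 hD).2.1
    rw [← hσ] at hi
    exact (dat_some C τ σ i j ρ hi).2
  have hinj : Set.InjOn (fun D => (domD D, πD D, dD D)) (T : Set (Fin k → RowD k)) := by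
    intro D hD D' hD' h
    simp only [Prod.mk.injEq] at h
    obtain ⟨e1, e2, e3⟩ := h
    funext i
    have hi : i ∈ domD D ↔ i ∈ domD D' := by rw [e1]
    have hd := congrFun e3 i
    simp only [hdD] at hd
    simp only [domD, Finset.mem_filter, Finset.mem_univ, true_and] at hi
    rcases hDi : D i with _ | ⟨j, ρ⟩ <;> rcases hDi' : D' i with _ | ⟨j', ρ'⟩
    · rfl
    · simp [hDi, hDi'] at hi
    · simp [hDi, hDi'] at hi
    · have p1 := hπD D (Finset.mem_filter.1 hD).2 i j ρ hDi
      have p2 := hπD D' (Finset.mem_filter.1 hD').2 i j' ρ' hDi'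
      have hj : j = j' := by rw [← p1, ← p2, e2]
      subst hj
      have v1 := hval D hD i j ρ hDi
      have v2 := hval D' hD' i j ρ' hDi'
      rw [hDi, hDi'] at hd
      simp only [defD] at hd
      have : ρ = ρ' := by omega
      rw [this]
  have h2 : ∑ D ∈ T, G (domD D, πD D, dD D) ≤
      ∑ q ∈ (Finset.univ : Finset (Finset (Fin k))) ×ˢ (Finset.univ : Finset (Equiv.Perm (Fin k))) ×ˢ T.image dD, G q := by
    rw [← Finset.sum_image (f := G) hinj]
    refine Finset.sum_le_sum_of_subset_of_nonneg ?_ fun q _ _ => hG0 q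
    intro q hq
    obtain ⟨D, hD, rfl⟩ := Finset.mem_image.1 hq
    simp only [Finset.mem_product, Finset.mem_univ, true_and]
    exact Finset.mem_image_of_mem _ hD
  have h3 : ∑ q ∈ (Finset.univ : Finset (Finset (Fin k))) ×ˢ (Finset.univ : Finset (Equiv.Perm (Fin k))) ×ˢ T.image dD, G q =
      (∑ I : Finset (Fin k), x ^ (k - I.card)) * (∑ π : Equiv.Perm (Fin k), ((crossP n k π).factorial : ℝ) * y ^ crossP n k π) *
      (∑ d ∈ T.image dD, ((∑ i, d i).factorial : ℝ) * z ^ (∑ i, d i)) := by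
    rw [Finset.sum_product]
    simp_rw [Finset.sum_product, hG]
    rw [Finset.sum_mul_sum, Finset.sum_mul]
    refine Finset.sum_congr rfl fun I _ => ?_
    rw [Finset.sum_mul_sum]
  have h4 : ∑ I : Finset (Fin k), x ^ (k - I.card) ≤ Real.exp (k * x) := by
    have := Fintype.sum_pow_mul_eq_add_pow (Fin k) 1 x
    simp only [one_pow, one_mul, Fintype.card_fin] at this
    rw [this]
    calc (1 + x) ^ k ≤ (Real.exp x) ^ k := by
          gcongr; rw [add_comm]; exact Real.add_one_le_exp _
      _ = _ := by rw [← Real.exp_nat_mul]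
  have h5 := sum_perm n k hk y hy0
  have h6 : ∑ d ∈ T.image dD, ((∑ i, d i).factorial : ℝ) * z ^ (∑ i, d i) ≤ 2 := by
    refine sum_d k n hkn z hz0 ?_ _ ?_
    · rw [hz]
      have : 2 * (n:ℝ) * (3 * (((a:ℝ) + 1) / β ^ τ)) = (12 * n * ((a:ℝ) + 1)) / β ^ τ / 2 := by ring
      rw [this]
      have : (12 * n * ((a:ℝ) + 1)) / β ^ τ ≤ 1 := (div_le_one (by positivity)).2 hX
      linarith
    · intro d hd
      obtain ⟨D, hD, rfl⟩ := Finset.mem_image.1 hd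
      rw [← sum_sz C]
      refine Finset.sum_le_sum fun i _ => ?_
      simp only [hdD]
      rcases D i with _ | ⟨j, ρ⟩
      · simp [defD]
      · simp only [defD]; omega
  have hn0 : 0 ≤ ∑ d ∈ T.image dD, ((∑ i, d i).factorial : ℝ) * z ^ (∑ i, d i) :=
    Finset.sum_nonneg fun d _ => by positivity
  calc Wk * ∑ D ∈ T, G (domD D, πD D, dD D) ≤
      Wk * (Real.exp (k * x) * (((k - n % k).factorial * (n % k).factorial : ℕ) * Real.exp ((k:ℝ) ^ 2 * y)) * 2) := by
        refine mul_le_mul_of_nonneg_left (h2.trans ?_) hWk0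
        rw [h3]
        gcongr
    _ = _ := by
        rw [← wA_Dk n k hk β, Real.exp_add]
        ring

theorem Pk_le' (n m k : ℕ) (hm0 : 0 < m) (hm : m < n.choose 2) :
    Pk n m k ≤ gq (n.choose 2) m 0 ^ fk n k := by
  by_cases h : fk n k + m ≤ n.choose 2
  · rw [Pk_eq n m k h]
    calc _ ≤ ∏ i ∈ Finset.range (fk n k), gq (n.choose 2) m 0 := by
          refine Finset.prod_le_prod (fun j hj => ?_) fun j hj => ?_
          · rw [Finset.mem_range] at hj; exact gq_nonneg (by omega)
          · rw [Finset.mem_range] at hj; exact gq_anti (by omega) (by omega)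
      _ = _ := by simp
  · rw [Pk, Nat.choose_eq_zero_of_lt (by omega)]
    simp only [Nat.cast_zero, zero_div]
    exact pow_nonneg (gq_nonneg (by omega)) _

theorem Pk_ratio (n m k k' d : ℕ) (h : fk n k + m < n.choose 2) (hd : fk n k = fk n k' + d) :
    Pk n m k ≤ Pk n m k' * gq (n.choose 2) m 0 ^ d := by
  rw [Pk_eq n m k (by omega), Pk_eq n m k' (by omega), hd, Finset.prod_range_add]
  refine mul_le_mul_of_nonneg_left ?_ (Finset.prod_nonneg fun i hi => gq_nonneg (by rw [Finset.mem_range] at hi; omega))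
  calc _ ≤ ∏ i ∈ Finset.range d, gq (n.choose 2) m 0 := by
        refine Finset.prod_le_prod (fun j hj => ?_) fun j hj => ?_
        · rw [Finset.mem_range] at hj; exact gq_nonneg (by omega)
        · rw [Finset.mem_range] at hj; exact gq_anti (by omega) (by omega)
    _ = _ := by simp

theorem two_choose (a : ℕ) : 2 * a.choose 2 + a = a * a := by
  induction a with
  | zero => simp
  | succ a ih =>
    rw [Nat.choose_succ_succ' a 1]; simp only [Nat.choose_one_right]; nlinarith

theorem fact_add_le (c d M : ℕ) (h : c + d ≤ M) : (c + d).factorial ≤ c.factorial * M ^ d := by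
  rw [← Nat.factorial_mul_ascFactorial]
  exact Nat.mul_le_mul_left _ ((Nat.ascFactorial_le_pow_add c d).trans (Nat.pow_le_pow_left h d))

theorem fact_le_pow_sub (j M : ℕ) (hj : 1 ≤ j) (h : j ≤ M) : j.factorial ≤ M ^ (j - 1) := by
  obtain ⟨i, rfl⟩ : ∃ i, j = 1 + i := ⟨j - 1, by omega⟩
  have := fact_add_le 1 i M h
  simpa using this

theorem jump1 (n k a : ℕ) (hk : 0 < k) (ha : a = n / k) (h1 : a ≤ n % k) :
    fk n k = fk n (k + 1) + (a + 1).choose 2 ∧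
    Dk n (k + 1) * (a + 1) ^ a ≤ Dk n k * (k + 1) ^ (a + 1) := by
  have hn := Nat.div_add_mod n k
  have hlt := Nat.mod_lt n hk
  obtain ⟨t, ht⟩ := Nat.exists_eq_add_of_le h1
  obtain ⟨c, hc⟩ : ∃ c, k = c + a + t := ⟨k - a - t, by omega⟩
  have hq : n / (k + 1) = a ∧ n % (k + 1) = t := by
    rw [Nat.div_mod_unique (by omega)]
    refine ⟨?_, by omega⟩
    rw [← hn, ← ha, ht]; ring
  have e1 : k - n % k = c := by omega
  have e2 : k + 1 - t = c + a + 1 := by omega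
  unfold fk Dk
  rw [hq.1, hq.2, ← ha, e1, e2, ht]
  have hC := two_choose a
  have hC' : (a + 1).choose 2 = a.choose 2 + a := by
    rw [Nat.choose_succ_succ' a 1]; simp; ring
  constructor
  · rw [hC']; nlinarith
  · have f1 : (c + a + 1).factorial ≤ c.factorial * (k + 1) ^ (a + 1) :=
      fact_add_le c (a + 1) (k + 1) (by omega)
    have f2 : a.factorial * t.factorial ≤ (a + t).factorial := Nat.factorial_mul_factorial_dvd_factorial_add a t |> Nat.le_of_dvd (Nat.factorial_pos _)
    calc _ = ((a + 1).factorial ^ t * a.factorial ^ c * a.factorial ^ a * (a + 1) ^ a) *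
          ((c + a + 1).factorial * (a.factorial * t.factorial)) := by
            rw [pow_succ, pow_add a.factorial c a]; ring
      _ ≤ ((a + 1).factorial ^ t * a.factorial ^ c * a.factorial ^ a * (a + 1) ^ a) *
          ((c.factorial * (k + 1) ^ (a + 1)) * (a + t).factorial) := by gcongr
      _ = _ := by
        rw [pow_add (a + 1).factorial a t]
        conv_rhs => rw [show (a + 1).factorial ^ a = (a + 1) ^ a * a.factorial ^ a by
          rw [Nat.factorial_succ, mul_pow]]
        ring

theorem jump2 (n k a : ℕ) (hk : 0 < k) (ha : a = n / k) (h1 : n % k < a) (hak : a ≤ k) :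
    fk n k = fk n (k + 1) + (a.choose 2 + n % k) ∧
    (Dk n (k + 1) ≤ Dk n k * a.factorial ∨
    Dk n (k + 1) * (a - 1).factorial ≤ Dk n k * (k + 1) ^ (a - 1)) := by
  have hn := Nat.div_add_mod n k
  have hlt := Nat.mod_lt n hk
  rw [← ha] at hn
  unfold fk Dk
  rw [← ha]
  generalize n % k = r at *
  obtain ⟨j, hj⟩ := Nat.exists_eq_add_of_lt h1
  obtain ⟨a0, ha0⟩ : ∃ a0, a = a0 + 1 := ⟨a - 1, by omega⟩
  obtain ⟨e, he⟩ : ∃ e, k + 1 = e + (j + 1) := ⟨k - j, by omega⟩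
  obtain ⟨c, hc⟩ : ∃ c, k = c + r := ⟨k - r, by omega⟩
  have hq : n / (k + 1) = a0 ∧ n % (k + 1) = e := by
    rw [Nat.div_mod_unique (by omega)]
    refine ⟨?_, by omega⟩
    rw [← hn, ha0]
    have : e + a0 = k + r := by omega
    nlinarith
  have e1 : k - r = c := by omega
  have e2 : k + 1 - e = j + 1 := by omega
  rw [hq.1, hq.2, e1, e2, ha0, Nat.add_sub_cancel]
  have hC' : (a0 + 1).choose 2 = a0.choose 2 + a0 := by
    rw [Nat.choose_succ_succ' a0 1]; simp; ring
  have hC'' : (a0 + 1 + 1).choose 2 = a0.choose 2 + 2 * a0 + 1 := by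
    rw [Nat.choose_succ_succ' (a0 + 1) 1, hC']; simp; ring
  constructor
  · rw [hC'', hC']
    have h3 : c + r + 1 = e + j + 1 := by omega
    have h4 : a0 = r + j := by omega
    have h5 : c + r = e + j := by omega
    have hC := two_choose a0
    subst h4
    zify at *
    have : (c:ℤ) = e + j - r := by linarith
    rw [this]
    linear_combination -hC
  · have key : ((a0 + 1).factorial ^ e * a0.factorial ^ (j + 1) * ((j + 1).factorial * e.factorial)) *
        (c.factorial * r.factorial) ≤ ((a0 + 1 + 1).factorial ^ r * (a0 + 1).factorial ^ c * (c.factorial * r.factorial)) *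
        ((j + 1).factorial * e.factorial) := by
      have g : (a0 + 1).factorial ^ e * a0.factorial ^ (j + 1) ≤ (a0 + 1 + 1).factorial ^ r * (a0 + 1).factorial ^ c := by
        have hpos : 0 < (a0 + 1) ^ (j + 1) := by positivity
        refine Nat.le_of_mul_le_mul_right ?_ hpos
        have hf : (a0 + 1).factorial ≤ (a0 + 1) ^ (j + 1) * (a0 + 1 + 1) ^ r := by
          calc (a0 + 1).factorial ≤ (a0 + 1) ^ (a0 + 1) := Nat.factorial_le_pow _
            _ = (a0 + 1) ^ (j + 1) * (a0 + 1) ^ r := by rw [← pow_add]; congr 1; omega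
            _ ≤ _ := by gcongr; omega
        calc (a0 + 1).factorial ^ e * a0.factorial ^ (j + 1) * (a0 + 1) ^ (j + 1)
            = (a0 + 1).factorial ^ e * ((a0 + 1) * a0.factorial) ^ (j + 1) := by rw [mul_pow]; ring
          _ = (a0 + 1).factorial ^ (r + c) * (a0 + 1).factorial := by
            rw [← Nat.factorial_succ, ← pow_add, ← pow_succ]; congr 1; omega
          _ ≤ (a0 + 1).factorial ^ (r + c) * ((a0 + 1) ^ (j + 1) * (a0 + 1 + 1) ^ r) := by gcongr
          _ = _ := by
            rw [Nat.factorial_succ (a0 + 1), mul_pow (a0 + 1 + 1), pow_add]; ring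
      calc _ = ((a0 + 1).factorial ^ e * a0.factorial ^ (j + 1)) * (((j + 1).factorial * e.factorial) *
        (c.factorial * r.factorial)) := by ring
        _ ≤ ((a0 + 1 + 1).factorial ^ r * (a0 + 1).factorial ^ c) * (((j + 1).factorial * e.factorial) *
        (c.factorial * r.factorial)) := by gcongr
        _ = _ := by ring
    set D' := (a0 + 1).factorial ^ e * a0.factorial ^ (j + 1) * ((j + 1).factorial * e.factorial) with hD'
    set D := (a0 + 1 + 1).factorial ^ r * (a0 + 1).factorial ^ c * (c.factorial * r.factorial) with hD
    by_cases hcase : e ≤ c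
    · left
      have hpos : 0 < c.factorial * r.factorial := by positivity
      refine Nat.le_of_mul_le_mul_right (key.trans ?_) hpos
      have k1 : (j + 1).factorial ≤ (a0 + 1).factorial := Nat.factorial_le (by omega)
      have k2 : e.factorial ≤ c.factorial := Nat.factorial_le hcase
      calc D * ((j + 1).factorial * e.factorial) ≤ D * ((a0 + 1).factorial * c.factorial) := by gcongr
        _ ≤ D * ((a0 + 1).factorial * c.factorial) * r.factorial := Nat.le_mul_of_pos_right _ (by positivity)
        _ = _ := by ring
    · right
      have k1 : e.factorial ≤ c.factorial * (k + 1) ^ (e - c) := by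
        have := fact_add_le c (e - c) (k + 1) (by omega)
        rwa [show c + (e - c) = e by omega] at this
      have k2 : a0.factorial ≤ r.factorial * (k + 1) ^ j := by
        have := fact_add_le r j (k + 1) (by omega)
        rwa [show r + j = a0 by omega] at this
      have k3 : (j + 1).factorial ≤ (k + 1) ^ j := by
        have := fact_le_pow_sub (j + 1) (k + 1) (by omega) (by omega)
        simpa using this
      have hpos : 0 < c.factorial * r.factorial * (j + 1).factorial * (k + 1) ^ j := by positivity
      refine Nat.le_of_mul_le_mul_right ?_ hpos
      calc D' * a0.factorial * (c.factorial * r.factorial * (j + 1).factorial * (k + 1) ^ j)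
          = (D' * (c.factorial * r.factorial)) * (a0.factorial * (j + 1).factorial * (k + 1) ^ j) := by ring
        _ ≤ (D * ((j + 1).factorial * e.factorial)) * (a0.factorial * (j + 1).factorial * (k + 1) ^ j) := by gcongr
        _ ≤ (D * ((j + 1).factorial * (c.factorial * (k + 1) ^ (e - c)))) * ((r.factorial * (k + 1) ^ j) * (k + 1) ^ j * (k + 1) ^ j) := by gcongr
        _ = D * (k + 1) ^ (e - c + j + j) * (c.factorial * r.factorial * (j + 1).factorial * (k + 1) ^ j) := by
          rw [pow_add, pow_add]; ring
        _ = _ := by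
          congr 3; omega

theorem Ebar_cmp (n m k k' d X Y : ℕ) (g r : ℝ) (hg : 0 ≤ g) (hr : 0 ≤ r) (hX : 0 < X)
    (hP0 : 0 ≤ Pk n m k')
    (hP : Pk n m k ≤ Pk n m k' * g ^ d) (hD : Dk n k' * X ≤ Dk n k * Y) (h : g ^ d * Y * r ≤ X) :
    Ebar n m k * r ≤ Ebar n m k' := by
  unfold Ebar
  have hD0 : (0:ℝ) < Dk n k := by exact_mod_cast Dk_pos n k
  have hD0' : (0:ℝ) < Dk n k' := by exact_mod_cast Dk_pos n k'
  have hX0 : (0:ℝ) < X := by exact_mod_cast hX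
  have hDr : (Dk n k' : ℝ) * X ≤ Dk n k * Y := by exact_mod_cast hD
  rw [div_mul_eq_mul_div, div_le_div_iff₀ hD0 hD0', mul_assoc, mul_assoc, mul_assoc]
  refine mul_le_mul_of_nonneg_left ?_ (by positivity)
  refine le_of_mul_le_mul_right ?_ hX0
  calc Pk n m k * (r * Dk n k') * X = Pk n m k * r * (Dk n k' * X) := by ring
    _ ≤ (Pk n m k' * g ^ d) * r * (Dk n k * Y) := by gcongr
    _ = Pk n m k' * Dk n k * (g ^ d * Y * r) := by ring
    _ ≤ Pk n m k' * Dk n k * X := by gcongr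

theorem jump (n m k a : ℕ) (hk : 0 < k) (ha : a = n / k) (ha1 : 1 ≤ a) (hak : a ≤ k) (ha3 : a ^ 3 ≤ n)
    (h : fk n k + m < n.choose 2) (s c : ℝ) (hs1 : 1 ≤ s) (hs : s ^ 2 * gq (n.choose 2) m 0 = 1)
    (hc0 : 0 < c) (hc1 : c ≤ 1) (hcn : c * n ≤ a * s ^ a) :
    Ebar n m k * ((c / 2) ^ (a + 1) * ((a - 1).factorial : ℕ)) ≤ Ebar n m (k + 1) := by
  have hn0 : 0 < n := lt_of_lt_of_le (by positivity) ha3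
  have hn0' : (0:ℝ) < n := by exact_mod_cast hn0
  have ha0' : (1:ℝ) ≤ a := by exact_mod_cast ha1
  have hs0 : 0 < s := by linarith
  set g := gq (n.choose 2) m 0 with hg
  have hge : g = (s ^ 2)⁻¹ := by
    exact eq_inv_of_mul_eq_one_right hs
  have hg0 : 0 ≤ g := by rw [hge]; positivity
  have hg1 : g ≤ 1 := by rw [hge]; exact inv_le_one_of_one_le₀ (one_le_pow₀ hs1)
  set v := (s ^ a)⁻¹ with hv
  have hv0 : 0 ≤ v := by positivity
  have hvle : v ≤ a / (c * n) := by
    rw [hv, inv_le_comm₀ (by positivity) (by positivity), inv_div, div_le_iff₀ (by positivity)]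
    linarith
  have hnk : k * a ≤ n := by rw [ha]; exact Nat.mul_div_le n k
  have hkv : v * ((k:ℝ) + 1) ≤ 2 / c := by
    calc v * ((k:ℝ) + 1) ≤ a / (c * n) * (k + 1) := by gcongr
      _ ≤ 2 / c := by
        rw [div_mul_eq_mul_div, div_le_div_iff₀ (by positivity) hc0]
        have h1 : (k:ℝ) * a ≤ n := by exact_mod_cast hnk
        have h2 : (1:ℝ) ≤ k := by exact_mod_cast hk
        have : (a:ℝ) * (k + 1) ≤ 2 * n := by nlinarith
        nlinarith
  have hgp : ∀ b : ℕ, g ^ (b + 1).choose 2 = ((s ^ b)⁻¹) ^ (b + 1) := by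
    intro b
    rw [hge, inv_pow, inv_pow, ← pow_mul, ← pow_mul]
    congr 2
    have := two_choose (b + 1)
    nlinarith
  have hfp : ∀ j, j ≤ a + 1 → ((a - 1).factorial : ℝ) ≤ ((a:ℝ)+1) ^ a := by
    intro j _
    calc ((a - 1).factorial : ℝ) ≤ (a.factorial : ℝ) := by exact_mod_cast Nat.factorial_le (by omega)
      _ ≤ (a:ℝ) ^ a := by exact_mod_cast Nat.factorial_le_pow a
      _ ≤ _ := by gcongr; linarith
  have hP0 : fk n (k + 1) ≤ fk n k → 0 ≤ Pk n m (k + 1) := fun _ => by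
    unfold Pk; positivity
  have hr0 : 0 ≤ (c / 2) ^ (a + 1) * (((a - 1).factorial : ℕ) : ℝ) := by positivity
  by_cases hcase : a ≤ n % k
  · obtain ⟨hf, hD⟩ := jump1 n k a hk ha hcase
    refine Ebar_cmp n m k (k + 1) ((a + 1).choose 2) ((a + 1) ^ a) ((k + 1) ^ (a + 1)) g _ hg0 hr0
      (by positivity) (hP0 (by omega)) (Pk_ratio n m k (k + 1) _ h hf) hD ?_
    rw [hgp a]
    push_cast
    calc v ^ (a + 1) * ((k:ℝ) + 1) ^ (a + 1) * ((c / 2) ^ (a + 1) * ((a - 1).factorial : ℝ))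
        = (v * ((k:ℝ) + 1)) ^ (a + 1) * (c / 2) ^ (a + 1) * ((a - 1).factorial : ℝ) := by
          rw [mul_pow]; ring
      _ ≤ (2 / c) ^ (a + 1) * (c / 2) ^ (a + 1) * ((a:ℝ) + 1) ^ a := by
          have := hfp 0 (by omega)
          gcongr
      _ = _ := by
          rw [← mul_pow, show 2 / c * (c / 2) = 1 by field_simp]; simp
  · push Not at hcase
    obtain ⟨hf, hD⟩ := jump2 n k a hk ha hcase hak
    obtain ⟨a0, rfl⟩ : ∃ a0, a = a0 + 1 := ⟨a - 1, by omega⟩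
    rw [Nat.add_sub_cancel] at *
    have hPr := Pk_ratio n m k (k + 1) _ h hf
    have hgd : g ^ ((a0 + 1).choose 2 + n % k) ≤ v ^ a0 := by
      calc g ^ ((a0 + 1).choose 2 + n % k) ≤ g ^ ((a0 + 1).choose 2) :=
            pow_le_pow_of_le_one hg0 hg1 (by omega)
        _ = v ^ a0 := by
          rw [hgp a0, hv, inv_pow, inv_pow, ← pow_mul, ← pow_mul, mul_comm]
    have hc2 : c / 2 ≤ 1 := by linarith
    rcases hD with hD | hD
    · refine Ebar_cmp n m k (k + 1) _ 1 ((a0 + 1).factorial) g _ hg0 hr0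
        one_pos (hP0 (by omega)) hPr (by rw [mul_one]; exact hD) ?_
      have p1 : ((a0 + 1).factorial : ℝ) ≤ ((a0 + 1 : ℕ) : ℝ) ^ a0 := by
        exact_mod_cast fact_le_pow_sub (a0 + 1) (a0 + 1) (by omega) le_rfl
      have p2 : (a0.factorial : ℝ) ≤ ((a0 + 1 : ℕ) : ℝ) ^ a0 :=
        le_trans (by exact_mod_cast Nat.factorial_le (by omega)) p1
      set A : ℝ := ((a0 + 1 : ℕ) : ℝ) with hA
      have hvA : v * A ^ 2 * (c / 2) ≤ 1 := by
        calc v * A ^ 2 * (c / 2) ≤ A / (c * n) * A ^ 2 * (c / 2) := by gcongr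
          _ = A ^ 3 / n / 2 := by field_simp
          _ ≤ 1 := by
            have : A ^ 3 / n ≤ 1 := (div_le_one hn0').2 (by rw [hA]; exact_mod_cast ha3)
            linarith
      calc g ^ ((a0 + 1).choose 2 + n % k) * ((a0 + 1).factorial : ℝ) * ((c / 2) ^ (a0 + 1 + 1) * (a0.factorial : ℝ))
          ≤ v ^ a0 * A ^ a0 * ((c / 2) ^ a0 * A ^ a0) := by
            have := pow_le_pow_of_le_one (by positivity : 0 ≤ c / 2) hc2 (by omega : a0 ≤ a0 + 1 + 1)
            gcongr
        _ = (v * A ^ 2 * (c / 2)) ^ a0 := by rw [mul_pow, mul_pow, ← pow_mul]; ring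
        _ ≤ 1 := pow_le_one₀ (by positivity) hvA
        _ = ((1:ℕ):ℝ) := by simp
    · refine Ebar_cmp n m k (k + 1) _ (a0.factorial) ((k + 1) ^ a0) g _ hg0 hr0
        (by positivity) (hP0 (by omega)) hPr hD ?_
      push_cast
      calc g ^ ((a0 + 1).choose 2 + n % k) * ((k:ℝ) + 1) ^ a0 * ((c / 2) ^ (a0 + 1 + 1) * (a0.factorial : ℝ))
          ≤ v ^ a0 * ((k:ℝ) + 1) ^ a0 * ((c / 2) ^ a0 * (a0.factorial : ℝ)) := by
            have := pow_le_pow_of_le_one (by positivity : 0 ≤ c / 2) hc2 (by omega : a0 ≤ a0 + 1 + 1)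
            gcongr
        _ = (v * ((k:ℝ) + 1) * (c / 2)) ^ a0 * (a0.factorial : ℝ) := by rw [mul_pow, mul_pow]; ring
        _ ≤ (2 / c * (c / 2)) ^ a0 * (a0.factorial : ℝ) := by gcongr
        _ = _ := by rw [show 2 / c * (c / 2) = 1 by field_simp]; simp

theorem fk_eq (n k : ℕ) (hk : 0 < k) : 2 * fk n k + (n / k) * (k - n % k) = n * (n / k) := by
  have hn := Nat.div_add_mod n k
  have hlt := Nat.mod_lt n hk
  unfold fk
  generalize n / k = a at *
  generalize n % k = r at *
  obtain ⟨c, hc⟩ := Nat.exists_eq_add_of_le hlt.le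
  have e : k - r = c := by omega
  have hC' : (a + 1).choose 2 = a.choose 2 + a := by
    rw [Nat.choose_succ_succ' a 1]; simp; ring
  have hC := two_choose a
  rw [e, hC', ← hn, hc]
  zify at *
  linear_combination (c + r : ℤ) * hC

theorem fk_le (n k : ℕ) (hk : 0 < k) : 2 * fk n k ≤ n * (n / k) := by
  have := fk_eq n k hk; omega

theorem fk_ge (n k : ℕ) (hk : 0 < k) : n * (n / k - 1) ≤ 2 * fk n k := by
  have h := fk_eq n k hk
  have h2 : (n / k) * (k - n % k) ≤ n := by
    calc (n / k) * (k - n % k) ≤ (n / k) * k := Nat.mul_le_mul_left _ (by omega)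
      _ ≤ n := Nat.div_mul_le_self n k
  rw [Nat.mul_sub, mul_one]; omega

theorem Ebar_upper (n m k : ℕ) (hk : 0 < k) (hkn : k ≤ n) (hm0 : 0 < m) (hm : m < n.choose 2)
    (s : ℝ) (hs1 : 1 ≤ s) (hs : s ^ 2 * gq (n.choose 2) m 0 = 1) :
    Ebar n m k ≤ (n * Real.exp 1 / ((n / k : ℕ) * s ^ (n / k - 1))) ^ n := by
  have hs0 : 0 < s := by linarith
  have ha1 : 1 ≤ n / k := (Nat.one_le_div_iff hk).2 hkn
  set a := n / k with ha
  have ha0 : (0:ℝ) < a := by exact_mod_cast ha1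
  have hge : gq (n.choose 2) m 0 = (s ^ 2)⁻¹ := eq_inv_of_mul_eq_one_right hs
  have h1 : (n.factorial : ℝ) ≤ (n:ℝ) ^ n := by exact_mod_cast Nat.factorial_le_pow n
  have h2 : Pk n m k ≤ ((s ^ (a - 1)) ^ n)⁻¹ := by
    refine (Pk_le' n m k hm0 hm).trans ?_
    rw [hge, inv_pow, ← pow_mul, ← pow_mul]
    refine inv_anti₀ (by positivity) (pow_le_pow_right₀ hs1 ?_)
    have := fk_ge n k hk
    rw [mul_comm]; exact this
  have h3 : ((a:ℝ) / Real.exp 1) ^ n ≤ Dk n k := by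
    have hn := Nat.div_add_mod n k
    have hlt := Nat.mod_lt n hk
    rw [← ha] at hn
    have hn' : n = (a + 1) * (n % k) + a * (k - n % k) := by
      obtain ⟨c, hc⟩ := Nat.exists_eq_add_of_le hlt.le
      have e : k - n % k = c := by omega
      rw [e]
      have : k * a = (n % k) * a + c * a := by rw [← add_mul, ← hc]
      nlinarith
    have f1 := fact_lower a
    have f2 : ((a:ℝ) / Real.exp 1) ^ (a + 1) ≤ (a + 1).factorial := by
      refine le_trans ?_ (fact_lower (a + 1))
      gcongr; simp
    have f3 : (1:ℝ) ≤ ((k - n % k).factorial * (n % k).factorial : ℕ) := by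
      exact_mod_cast Nat.succ_le_of_lt (by positivity)
    unfold Dk
    rw [← ha]
    generalize n % k = r at *
    generalize k - r = c at *
    rw [hn', pow_add, pow_mul, pow_mul]
    push_cast at *
    calc _ ≤ ((a + 1).factorial : ℝ) ^ r * (a.factorial : ℝ) ^ c * 1 := by
            rw [mul_one]; gcongr
      _ ≤ _ := by gcongr
  unfold Ebar
  have hD0 : (0:ℝ) < Dk n k := by exact_mod_cast Dk_pos n k
  have hP0 : 0 ≤ Pk n m k := by unfold Pk; positivity
  calc (n.factorial : ℝ) * Pk n m k / Dk n k ≤ (n:ℝ) ^ n * ((s ^ (a - 1)) ^ n)⁻¹ / ((a:ℝ) / Real.exp 1) ^ n := by gcongr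
    _ = _ := by
      rw [div_pow, div_pow, mul_pow, mul_pow]; field_simp

theorem Ebar_lower (n m k : ℕ) (hk : 0 < k) (h : 2 * fk n k + m < n.choose 2) :
    (n / Real.exp 1) ^ n ≤ Ebar n m k * (((n / k : ℕ) + 1) ^ n * (k:ℝ) ^ k * bp n m k ^ fk n k) := by
  set a := n / k with ha
  have hD0 : (0:ℝ) < Dk n k := by exact_mod_cast Dk_pos n k
  have hP0 : 0 < Pk n m k := Pk_pos n m k h
  have hb0 : 0 < bp n m k := by
    unfold bp
    have : 0 < gq (n.choose 2) m (fk n k) := gq_pos (by omega)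
    positivity
  have h3 : (Dk n k : ℝ) ≤ ((a:ℝ) + 1) ^ n * (k:ℝ) ^ k := by
    have hn := Nat.div_add_mod n k
    have hlt := Nat.mod_lt n hk
    rw [← ha] at hn
    have hn' : n = (a + 1) * (n % k) + a * (k - n % k) := by
      obtain ⟨c, hc⟩ := Nat.exists_eq_add_of_le hlt.le
      have e : k - n % k = c := by omega
      rw [e]
      have : k * a = (n % k) * a + c * a := by rw [← add_mul, ← hc]
      nlinarith
    have f1 : a.factorial ≤ (a + 1) ^ a :=
      (Nat.factorial_le_pow a).trans (Nat.pow_le_pow_left (by omega) _)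
    have f2 : (a + 1).factorial ≤ (a + 1) ^ (a + 1) := Nat.factorial_le_pow _
    have f3 : (k - n % k).factorial * (n % k).factorial ≤ k ^ k := by
      refine le_trans ?_ (Nat.factorial_le_pow k)
      have := Nat.factorial_mul_factorial_dvd_factorial_add (k - n % k) (n % k)
      rw [Nat.sub_add_cancel hlt.le] at this
      exact Nat.le_of_dvd (Nat.factorial_pos _) this
    have : Dk n k ≤ (a + 1) ^ n * k ^ k := by
      unfold Dk
      rw [← ha]
      generalize n % k = r at *
      generalize k - r = c at *
      rw [hn', pow_add, pow_mul, pow_mul]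
      gcongr
    exact_mod_cast this
  have h4 := Pk_ge n m k h
  have h5 := fact_lower n
  unfold Ebar
  calc (n / Real.exp 1) ^ n ≤ (n.factorial : ℝ) := h5
    _ = (n.factorial : ℝ) * (1 / bp n m k) ^ fk n k / Dk n k * (Dk n k * bp n m k ^ fk n k) := by
        rw [div_pow, one_pow]; field_simp
    _ ≤ (n.factorial : ℝ) * Pk n m k / Dk n k * (((a:ℝ) + 1) ^ n * (k:ℝ) ^ k * bp n m k ^ fk n k) := by
        gcongr

theorem Ebar_self (n m : ℕ) (hn : 0 < n) (hm : m ≤ n.choose 2) : Ebar n m n = 1 := by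
  have hf : fk n n = 0 := by simp [fk, Nat.div_self hn]
  have hD : Dk n n = n.factorial := by simp [Dk, Nat.div_self hn]
  have : (0:ℝ) < ((n.choose 2).choose m : ℕ) := by exact_mod_cast Nat.choose_pos hm
  have h2 : (0:ℝ) < n.factorial := by exact_mod_cast Nat.factorial_pos n
  rw [Ebar, Pk, hf, hD, Nat.sub_zero]
  field_simp

/-- basic facts on `N` and `m` for a given `n` -/
theorem base_N (p : ℝ) (hp0 : 0 < p) (hp1 : p < 1) : ∀ᶠ n : ℕ in atTop,
    (n:ℝ) ^ 2 / 4 ≤ (n.choose 2 : ℕ) ∧ ((n.choose 2 : ℕ) : ℝ) ≤ (n:ℝ) ^ 2 / 2 ∧ (n:ℝ) ≤ (n.choose 2 : ℕ) ∧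
    0 < mFloor p n ∧ mFloor p n < n.choose 2 ∧ (mFloor p n : ℝ) ≤ p * (n.choose 2 : ℕ) ∧
    p * (n.choose 2 : ℕ) ≤ mFloor p n + 1 ∧ 4 ≤ n := by
  have h1 : ∀ᶠ n : ℕ in atTop, 4 / p ≤ (n:ℝ) := tendsto_natCast_atTop_atTop.eventually_ge_atTop _
  filter_upwards [h1, eventually_ge_atTop 4] with n h1 h4
  have hn : (4:ℝ) ≤ n := by exact_mod_cast h4
  have e : ((n.choose 2 : ℕ) : ℝ) = n * (n - 1) / 2 := Nat.cast_choose_two ℝ n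
  have hN1 : (n:ℝ) ^ 2 / 4 ≤ (n.choose 2 : ℕ) := by rw [e]; nlinarith
  have hN2 : (n:ℝ) ≤ (n.choose 2 : ℕ) := by rw [e]; nlinarith
  have hN0 : (0:ℝ) < (n.choose 2 : ℕ) := by linarith
  have hpN : 1 ≤ p * (n.choose 2 : ℕ) := by
    rw [div_le_iff₀ hp0] at h1
    nlinarith
  have hle : (mFloor p n : ℝ) ≤ p * (n.choose 2 : ℕ) := Nat.floor_le (by positivity)
  refine ⟨hN1, ?_, hN2, ?_, ?_, hle, (Nat.lt_floor_add_one _).le, h4⟩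
  · rw [e]; nlinarith
  · exact Nat.floor_pos.2 hpN
  · have : (mFloor p n : ℝ) < (n.choose 2 : ℕ) := by nlinarith
    exact_mod_cast this

theorem base_b (p : ℝ) (hp0 : 0 < p) (hp1 : p < 1) : ∀ᶠ n : ℕ in atTop,
    (1/(1-p)) ≤ (1 / gq (n.choose 2) (mFloor p n) 0) * Real.exp ((1/(1-p)) / n) ∧
    1 / gq (n.choose 2) (mFloor p n) 0 ≤ 1/(1-p) ∧ 1 ≤ 1 / gq (n.choose 2) (mFloor p n) 0 ∧
    ∀ k : ℕ, 0 < k → ((n / k : ℕ) : ℝ) * 100 ≤ (1 - p) * n →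
      2 * fk n k + mFloor p n < n.choose 2 ∧
      1 / gq (n.choose 2) (mFloor p n) 0 ≤ bp n (mFloor p n) k ∧
      bp n (mFloor p n) k ≤ bB n (mFloor p n) k ∧
      bB n (mFloor p n) k ≤ (1 / gq (n.choose 2) (mFloor p n) 0) *
        Real.exp (6 * (n / k : ℕ) * (1/(1-p)) / n) := by
  filter_upwards [base_N p hp0 hp1] with n ⟨h1, h2, h3, h4, h5, h6, h7, h8⟩
  have hq : 0 < 1 - p := by linarith
  have hn : (4:ℝ) ≤ n := by exact_mod_cast h8
  have hn0 : (0:ℝ) < n := by linarith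
  have h5' : (mFloor p n : ℝ) < (n.choose 2 : ℕ) := by exact_mod_cast h5
  set m := mFloor p n with hm
  set N := n.choose 2 with hN
  have hN0 : (0:ℝ) < N := by linarith
  have hM : (1 - p) * N ≤ (N:ℝ) - m := by linarith
  have hM0 : 0 < (N:ℝ) - m := by linarith
  have hb0 : 1 / gq N m 0 = N / ((N:ℝ) - m) := by
    unfold gq; simp
  rw [hb0]
  have hm0 : (0:ℝ) ≤ m := Nat.cast_nonneg m
  refine ⟨?_, ?_, ?_, ?_⟩
  · have he := Real.add_one_le_exp (1 / (1 - p) / n)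
    have h8 : (N:ℝ) - m ≤ (1 - p) * N + 1 := by linarith
    rw [div_mul_eq_mul_div, div_le_div_iff₀ hq hM0]
    have h9 : (1 - p) * N + 1 ≤ N * (1 - p) * (1 / (1 - p) / n + 1) := by
      have : (N:ℝ) * (1 - p) * (1 / (1 - p) / n + 1) = N / n + N * (1 - p) := by field_simp
      rw [this]
      have : 1 ≤ (N:ℝ) / n := (one_le_div hn0).2 h3
      linarith
    calc 1 * ((N:ℝ) - m) ≤ N * (1 - p) * (1 / (1 - p) / n + 1) := by linarith
      _ ≤ N * (1 - p) * Real.exp (1 / (1 - p) / n) := by gcongr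
      _ = _ := by ring
  · rw [div_le_div_iff₀ hM0 hq]; linarith
  · rw [le_div_iff₀ hM0]; linarith
  · intro k hk ha
    have hfa : (2:ℝ) * fk n k ≤ n * (n / k : ℕ) := by exact_mod_cast fk_le n k hk
    set a := n / k with hadef
    set f := fk n k with hf
    have hf0 : (0:ℝ) ≤ f := Nat.cast_nonneg f
    have ha0 : (0:ℝ) ≤ a := Nat.cast_nonneg a
    have hfq : (50:ℝ) * f ≤ (1 - p) * N := by nlinarith
    have hff : (2:ℝ) * f + m < N := by nlinarith
    have hfM : 2 * (f:ℝ) ≤ (N:ℝ) - m := by nlinarith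
    have hMf : 0 < (N:ℝ) - m - f := by nlinarith
    have hbp : bp n m k = ((N:ℝ) - f) / ((N:ℝ) - m - f) := by
      unfold bp gq; rw [one_div_div]
    have hmu0 : 0 ≤ mu n m k := by
      unfold mu; rw [← hN]; positivity
    have hfM2 : (f:ℝ) / ((N:ℝ) - m) ≤ 2 * a * (1 / (1 - p)) / n := by
      rw [div_le_div_iff₀ hM0 hn0]
      have : (1 - p) * ((n:ℝ) ^ 2 / 4) ≤ (N:ℝ) - m := le_trans (by gcongr) hM
      calc (f:ℝ) * n ≤ (n * a / 2) * n := by gcongr; linarith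
        _ = 2 * a * (1 / (1 - p)) * ((1 - p) * ((n:ℝ) ^ 2 / 4)) := by field_simp; ring
        _ ≤ _ := by gcongr
    have hmu1 : mu n m k ≤ 2 * a * (1 / (1 - p)) / n := by
      refine le_trans ?_ hfM2
      unfold mu
      rw [← hN, ← hf, div_le_div_iff₀ (by positivity) hM0]
      have : (f:ℝ) * m * ((N:ℝ) - m) ≤ f * N * ((N:ℝ) - m) := by gcongr
      linarith
    have hb1 : (N:ℝ) / (N - m) ≤ bp n m k := by
      rw [hbp, div_le_div_iff₀ hM0 hMf]; nlinarith
    have hb2 : bp n m k ≤ (N:ℝ) / (N - m) * Real.exp (4 * a * (1 / (1 - p)) / n) := by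
      have he := Real.add_one_le_exp (4 * a * (1 / (1 - p)) / n)
      refine le_trans ?_ (mul_le_mul_of_nonneg_left he (by positivity))
      have h10 : bp n m k ≤ (N:ℝ) / (N - m) * (2 * (f / ((N:ℝ) - m)) + 1) := by
        rw [hbp, div_le_iff₀ hMf]
        rw [show (N:ℝ) / (N - m) * (2 * (f / ((N:ℝ) - m)) + 1) * ((N:ℝ) - m - f) =
          N * (2 * f + (N - m)) * ((N - m) - f) / ((N:ℝ) - m) ^ 2 by field_simp]
        rw [le_div_iff₀ (by positivity)]
        generalize (N:ℝ) - m = M at *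
        nlinarith [mul_nonneg (mul_nonneg hf0 hN0.le) (sub_nonneg.2 hfM), mul_nonneg hf0 (sq_nonneg M)]
      refine h10.trans ?_
      gcongr
      calc 2 * ((f:ℝ) / ((N:ℝ) - m)) ≤ 2 * (2 * a * (1 / (1 - p)) / n) := by gcongr
        _ = _ := by ring
    have hbp0 : 0 < bp n m k := lt_of_lt_of_le (by positivity) hb1
    refine ⟨by exact_mod_cast hff, hb1, ?_, ?_⟩
    · unfold bB
      exact le_mul_of_one_le_right hbp0.le (Real.one_le_exp hmu0)
    · unfold bB
      calc bp n m k * Real.exp (mu n m k) ≤ ((N:ℝ) / (N - m) * Real.exp (4 * a * (1 / (1 - p)) / n)) *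
            Real.exp (2 * a * (1 / (1 - p)) / n) := by gcongr
        _ = _ := by rw [mul_assoc, ← Real.exp_add]; congr 2; ring

theorem scale_low (b Kc : ℝ) (hb1 : 1 < b) (hbe : b < Real.exp 1) (hK : 0 < Kc) :
    ∃ ε > 0, ∀ᶠ n : ℕ in atTop, ∀ a : ℕ, 1 ≤ a → (n:ℝ) ^ 2 ≤ Kc * ((a:ℝ) ^ 2 * b ^ a) →
      (2 + ε) * Real.log n ≤ a := by
  set l := Real.log b with hl
  have hl0 : 0 < l := Real.log_pos hb1
  have hl1 : l < 1 := by
    rw [hl, Real.log_lt_iff_lt_exp (by linarith)]; exact hbe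
  set l' := (1 + l) / 2 with hl'
  have hl'0 : 0 < l' := by linarith
  have hl'1 : l' < 1 := by linarith
  set δ := (1 - l) / 4 with hδ
  have hδ0 : 0 < δ := by linarith
  set C := Real.log Kc + 2 * (-1 - Real.log δ) with hC
  refine ⟨1 / l' - 1, by rw [gt_iff_lt, sub_pos, one_lt_div hl'0]; exact hl'1, ?_⟩
  have hlog : Tendsto (fun n : ℕ => Real.log n) atTop atTop :=
    Real.tendsto_log_atTop.comp tendsto_natCast_atTop_atTop
  filter_upwards [hlog.eventually_ge_atTop (C / (1 - l')), eventually_gt_atTop 0] with n hn hn0 a ha h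
  have hn0' : (0:ℝ) < n := by exact_mod_cast hn0
  have ha0 : (0:ℝ) < a := by exact_mod_cast ha
  have hb0 : 0 < b := by linarith
  have h1 := Real.log_le_log (by positivity) h
  rw [Real.log_pow, Real.log_mul hK.ne' (by positivity), Real.log_mul (by positivity) (by positivity),
    Real.log_pow, Real.log_pow, ← hl] at h1
  push_cast at h1
  have h2 := Real.log_le_sub_one_of_pos (mul_pos hδ0 ha0)
  rw [Real.log_mul hδ0.ne' ha0.ne'] at h2
  have h3 : 2 * Real.log n ≤ C + l' * a := by
    rw [hC, hl']; rw [hδ] at h2 ⊢; nlinarith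
  rw [div_le_iff₀ (by linarith)] at hn
  have h4 : l' * ((2 + (1 / l' - 1)) * Real.log n) ≤ l' * a := by
    have : l' * ((2 + (1 / l' - 1)) * Real.log n) = (l' + 1) * Real.log n := by
      field_simp; ring
    rw [this]; nlinarith
  exact le_of_mul_le_mul_left h4 hl'0

theorem scale_up (b Kc : ℝ) (hb1 : 1 < b) (hK : 0 < Kc) :
    ∃ K > 0, ∀ᶠ n : ℕ in atTop, ∀ a : ℕ, 1 ≤ a → (a:ℝ) ^ 2 * b ^ a ≤ Kc * (n:ℝ) ^ 2 →
      (a:ℝ) ≤ K * Real.log n := by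
  set l := Real.log b with hl
  have hl0 : 0 < l := Real.log_pos hb1
  refine ⟨3 / l, by positivity, ?_⟩
  have hlog : Tendsto (fun n : ℕ => Real.log n) atTop atTop :=
    Real.tendsto_log_atTop.comp tendsto_natCast_atTop_atTop
  filter_upwards [hlog.eventually_ge_atTop (Real.log Kc), eventually_gt_atTop 0] with n hn hn0 a ha h
  have hn0' : (0:ℝ) < n := by exact_mod_cast hn0
  have ha0 : (1:ℝ) ≤ a := by exact_mod_cast ha
  have hb0 : 0 < b := by linarith
  have h1 := Real.log_le_log (by positivity) h
  rw [Real.log_mul hK.ne' (by positivity), Real.log_mul (by positivity) (by positivity),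
    Real.log_pow, Real.log_pow, Real.log_pow, ← hl] at h1
  push_cast at h1
  have h2 := Real.log_nonneg ha0
  rw [div_mul_eq_mul_div, le_div_iff₀ hl0]
  linarith

/-- regularity of the class size `a` and the base `β` -/
def Reg (b Kc : ℝ) (n a : ℕ) (β : ℝ) : Prop :=
  1 ≤ a ∧ (n:ℝ) ^ 2 ≤ Kc * ((a:ℝ) ^ 2 * b ^ a) ∧ (a:ℝ) ^ 2 * b ^ a ≤ Kc * (n:ℝ) ^ 2 ∧
    b ≤ β * Real.exp (b / n) ∧ β ≤ b * Real.exp (6 * a * b / n)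

theorem log_pow_le (K C : ℝ) : ∀ᶠ n : ℕ in atTop, C * (K * Real.log n + 2) ^ 20 ≤ (n:ℝ) ^ (1/100 : ℝ) := by
  have h1 : ∀ x : ℝ, (fun x : ℝ => (Real.log x) ^ 20) =o[atTop] fun x => x ^ (1/100:ℝ) := by
    intro _
    have := isLittleO_log_rpow_rpow_atTop (20:ℝ) (by norm_num : (0:ℝ) < 1/100)
    refine this.congr' ?_ (Eventually.of_forall fun _ => rfl)
    filter_upwards with x
    norm_cast
  have h2 : (fun n : ℕ => (Real.log n) ^ 20) =o[atTop] fun n : ℕ => (n:ℝ) ^ (1/100:ℝ) :=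
    (h1 0).comp_tendsto tendsto_natCast_atTop_atTop
  set c := |C| * (|K| + 2) ^ 20 with hc
  have hlog : Tendsto (fun n : ℕ => Real.log n) atTop atTop :=
    Real.tendsto_log_atTop.comp tendsto_natCast_atTop_atTop
  filter_upwards [h2.bound (show (0:ℝ) < 1 / (c + 1) by positivity), hlog.eventually_ge_atTop 1] with n hn hL
  rw [Real.norm_of_nonneg (by positivity), Real.norm_of_nonneg (by positivity), div_mul_eq_mul_div,
    le_div_iff₀ (by positivity), one_mul] at hn
  have h3 : |K * Real.log n + 2| ≤ (|K| + 2) * Real.log n := by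
    calc |K * Real.log n + 2| ≤ |K * Real.log n| + |2| := abs_add_le _ _
      _ = |K| * Real.log n + 2 := by rw [abs_mul, abs_of_nonneg (by linarith : 0 ≤ Real.log n)]; norm_num
      _ ≤ _ := by nlinarith
  calc C * (K * Real.log n + 2) ^ 20 ≤ |C * (K * Real.log n + 2) ^ 20| := le_abs_self _
    _ = |C| * |K * Real.log n + 2| ^ 20 := by rw [abs_mul, abs_pow]
    _ ≤ |C| * ((|K| + 2) * Real.log n) ^ 20 := by gcongr
    _ = c * (Real.log n) ^ 20 := by rw [mul_pow, hc]; ring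
    _ ≤ (c + 1) * (Real.log n) ^ 20 := by gcongr; linarith
    _ ≤ _ := by linarith

set_option maxHeartbeats 1000000 in
theorem reg_facts (b Kc : ℝ) (hb1 : 1 < b) (hbe : b < Real.exp 1) (hK : 1 ≤ Kc) :
    ∃ ε > 0, ∀ C : ℝ, ∀ᶠ n : ℕ in atTop, ∀ (a : ℕ) (β : ℝ), Reg b Kc n a β →
      ∃ z : ℝ, 2 ≤ z ∧ z ^ 100 = n ∧ C * ((a:ℝ) + 2) ^ 20 ≤ z ∧ C ≤ z ∧ C ≤ a ∧ (2 + ε) * Real.log n ≤ a ∧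
        (n:ℝ) ^ 2 ≤ 2 * Kc * ((a:ℝ) ^ 2 * β ^ a) ∧ (a:ℝ) ^ 2 * β ^ a ≤ 2 * Kc * (n:ℝ) ^ 2 ∧
        1 ≤ β ∧ β ≤ 3 ∧ z ^ 187 ≤ β ^ (19 * a / 20) ∧ β ^ (19 * a / 20 + 2) ≤ z ^ 193 := by
  obtain ⟨ε, hε, hlow⟩ := scale_low b Kc hb1 hbe (by linarith)
  obtain ⟨K, hK0, hup⟩ := scale_up b Kc hb1 (by linarith)
  refine ⟨ε, hε, fun C => ?_⟩
  have hlog : Tendsto (fun n : ℕ => Real.log n) atTop atTop :=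
    Real.tendsto_log_atTop.comp tendsto_natCast_atTop_atTop
  have hlb : 0 < Real.log b := Real.log_pos hb1
  filter_upwards [hlow, hup, log_pow_le K (max C (12 * b + 4 * Kc + b / Real.log b + 100)), hlog.eventually_ge_atTop (max (800 * Real.log 2) (max (C/2) 400)),
    eventually_ge_atTop 4] with n hlow hup hz hL hn4 a β ⟨ha, H1, H2, B1, B2⟩
  have hn4' : (4:ℝ) ≤ n := by exact_mod_cast hn4
  have hn0 : (0:ℝ) < n := by linarith
  have ha1 : (1:ℝ) ≤ a := by exact_mod_cast ha
  have hlow := hlow a ha H1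
  have hup := hup a ha H2
  set z := (n:ℝ) ^ (1/100:ℝ) with hzdef
  have hL1 : 800 * Real.log 2 ≤ Real.log n := (le_max_left _ _).trans hL
  have hL2 : C / 2 ≤ Real.log n := ((le_max_left _ _).trans (le_max_right _ _)).trans hL
  have hL3 : 400 ≤ Real.log n := ((le_max_right _ _).trans (le_max_right _ _)).trans hL
  have hz0 : 0 < z := by positivity
  have hzn : z ^ 100 = n := by
    rw [hzdef, ← Real.rpow_natCast, ← Real.rpow_mul hn0.le]; norm_num
  have hzL : Real.log z = Real.log n / 100 := by
    rw [← hzn, Real.log_pow]; push_cast; ring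
  have hzA : (max C (12 * b + 4 * Kc + b / Real.log b + 100)) * ((a:ℝ) + 2) ^ 20 ≤ z := by
    refine le_trans ?_ hz
    have : 0 ≤ max C (12 * b + 4 * Kc + b / Real.log b + 100) := le_trans (by positivity) (le_max_right _ _)
    gcongr
  have hA1 : (1:ℝ) ≤ ((a:ℝ) + 2) ^ 20 := one_le_pow₀ (by linarith)
  have hC1 : C * ((a:ℝ) + 2) ^ 20 ≤ z := by
    refine le_trans ?_ hzA
    gcongr
    exact le_max_left _ _
  have hC2 : (12 * b + 4 * Kc + b / Real.log b + 100) * ((a:ℝ) + 2) ^ 20 ≤ z := by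
    refine le_trans ?_ hzA
    gcongr
    exact le_max_right _ _
  have hCz : C ≤ z := by
    by_cases hC0 : 0 ≤ C
    · exact le_trans (le_mul_of_one_le_right hC0 hA1) hC1
    · linarith
  have hblb : 0 ≤ b / Real.log b := by positivity
  have hz100 : 100 ≤ z := by
    have : 100 * 1 ≤ (12 * b + 4 * Kc + b / Real.log b + 100) * ((a:ℝ) + 2) ^ 20 := by
      gcongr; linarith
    linarith
  have hzb : 12 * b * (a:ℝ) ^ 2 ≤ z := by
    have e1 : (a:ℝ) ^ 2 ≤ ((a:ℝ) + 2) ^ 20 := by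
      calc (a:ℝ) ^ 2 ≤ ((a:ℝ) + 2) ^ 2 := by gcongr; linarith
        _ ≤ _ := pow_le_pow_right₀ (by linarith) (by norm_num)
    have : 12 * b * (a:ℝ) ^ 2 ≤ (12 * b + 4 * Kc + b / Real.log b + 100) * ((a:ℝ) + 2) ^ 20 := by
      gcongr; linarith
    linarith
  have hzK : 2 * Kc * (a:ℝ) ^ 2 ≤ z := by
    have e1 : (a:ℝ) ^ 2 ≤ ((a:ℝ) + 2) ^ 20 := by
      calc (a:ℝ) ^ 2 ≤ ((a:ℝ) + 2) ^ 2 := by gcongr; linarith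
        _ ≤ _ := pow_le_pow_right₀ (by linarith) (by norm_num)
    have : 2 * Kc * (a:ℝ) ^ 2 ≤ (12 * b + 4 * Kc + b / Real.log b + 100) * ((a:ℝ) + 2) ^ 20 := by
      gcongr; linarith
    linarith
  have hbz : b / Real.log b ≤ z := by
    have : b / Real.log b * 1 ≤ (12 * b + 4 * Kc + b / Real.log b + 100) * ((a:ℝ) + 2) ^ 20 := by
      gcongr; linarith
    linarith
  have hznn : z ^ 2 ≤ n := by
    rw [← hzn]; exact pow_le_pow_right₀ (by linarith) (by norm_num)
  have hz100n : 100 * z ≤ n := by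
    refine le_trans ?_ hznn
    rw [sq]; gcongr
  have hzle : z ≤ n := by linarith
  have hlog2 : (1:ℝ)/2 ≤ Real.log 2 := by linarith [Real.log_two_gt_d9]
  have hsmall : (a:ℝ) * (6 * a * b / n) ≤ 1 / 20 := by
    rw [mul_div_assoc', div_le_iff₀ hn0]; linarith
  have hsm1 : 6 * a * b / n ≤ 1 / 20 := by
    have : 6 * a * b / n ≤ a * (6 * a * b / n) := le_mul_of_one_le_left (by positivity) ha1
    linarith
  have hsmb : (a:ℝ) * (b / n) ≤ Real.log 2 := by
    have : (a:ℝ) * (b / n) ≤ a * (6 * a * b / n) := by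
      gcongr
      have : b * 1 ≤ b * a := by gcongr
      linarith
    linarith
  have hβ1 : 1 ≤ β := by
    have h1 : Real.exp (b / n) ≤ b := by
      rw [← Real.le_log_iff_exp_le (by linarith), div_le_iff₀ hn0]
      rw [div_le_iff₀ hlb] at hbz
      refine hbz.trans ?_
      rw [mul_comm]; gcongr
    have : Real.exp (b / n) ≤ β * Real.exp (b / n) := h1.trans B1
    have he := Real.exp_pos (b / n)
    exact le_of_mul_le_mul_right (by rw [one_mul]; exact this) he
  have hβ0 : 0 < β := by linarith
  have hβ3 : β ≤ 3 := by
    refine B2.trans ?_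
    have e1 : Real.exp (6 * a * b / n) ≤ 1 / (1 - 1/20) := by
      refine (Real.exp_le_exp.2 hsm1).trans ?_
      exact Real.exp_bound_div_one_sub_of_interval (by norm_num) (by norm_num)
    have := Real.exp_one_lt_d9
    calc b * Real.exp (6 * a * b / n) ≤ 2.7182818286 * (1 / (1 - 1/20)) := by gcongr; linarith
      _ ≤ 3 := by norm_num
  have hup2 : β ^ a ≤ 2 * b ^ a := by
    calc β ^ a ≤ (b * Real.exp (6 * a * b / n)) ^ a := by gcongr
      _ = b ^ a * Real.exp (a * (6 * a * b / n)) := by rw [mul_pow, ← Real.exp_nat_mul]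
      _ ≤ b ^ a * 2 := by
        gcongr
        rw [← Real.le_log_iff_exp_le (by norm_num)]; linarith
      _ = _ := by ring
  have hlo2 : b ^ a ≤ 2 * β ^ a := by
    calc b ^ a ≤ (β * Real.exp (b / n)) ^ a := by gcongr
      _ = β ^ a * Real.exp (a * (b / n)) := by rw [mul_pow, ← Real.exp_nat_mul]
      _ ≤ β ^ a * 2 := by
        gcongr
        rw [← Real.le_log_iff_exp_le (by norm_num)]; linarith
      _ = _ := by ring
  have G1 : (n:ℝ) ^ 2 ≤ 2 * Kc * ((a:ℝ) ^ 2 * β ^ a) := by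
    calc (n:ℝ) ^ 2 ≤ Kc * ((a:ℝ) ^ 2 * b ^ a) := H1
      _ ≤ Kc * ((a:ℝ) ^ 2 * (2 * β ^ a)) := by gcongr
      _ = _ := by ring
  have G2 : (a:ℝ) ^ 2 * β ^ a ≤ 2 * Kc * (n:ℝ) ^ 2 := by
    calc (a:ℝ) ^ 2 * β ^ a ≤ (a:ℝ) ^ 2 * (2 * b ^ a) := by gcongr
      _ ≤ 2 * (Kc * (n:ℝ) ^ 2) := by linarith
      _ = _ := by ring
  have hz200 : (n:ℝ) ^ 2 = z ^ 200 := by rw [← hzn, ← pow_mul]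
  have Z1 : z ^ 199 ≤ β ^ a := by
    have : z ^ 199 * z ≤ β ^ a * z := by
      calc z ^ 199 * z = (n:ℝ) ^ 2 := by rw [hz200]; ring
        _ ≤ 2 * Kc * ((a:ℝ) ^ 2 * β ^ a) := G1
        _ = (2 * Kc * (a:ℝ) ^ 2) * β ^ a := by ring
        _ ≤ z * β ^ a := by gcongr
        _ = _ := by ring
    exact le_of_mul_le_mul_right this hz0
  have Z2 : β ^ a ≤ z ^ 201 := by
    calc β ^ a ≤ (a:ℝ) ^ 2 * β ^ a := le_mul_of_one_le_left (by positivity) (one_le_pow₀ ha1)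
      _ ≤ 2 * Kc * z ^ 200 := by rw [← hz200]; exact G2
      _ ≤ z * z ^ 200 := by
        gcongr
        have : 2 * Kc * 1 ≤ 2 * Kc * (a:ℝ) ^ 2 := by
          gcongr; exact one_le_pow₀ ha1
        linarith
      _ = _ := by ring
  have L1 := Real.log_le_log (by positivity) Z1
  have L2 := Real.log_le_log (by positivity) Z2
  rw [Real.log_pow, Real.log_pow] at L1 L2
  push_cast at L1 L2
  have hlβ : Real.log β ≤ 2 := by
    have := Real.log_le_sub_one_of_pos hβ0; linarith
  have hlβ0 : 0 ≤ Real.log β := Real.log_nonneg hβ1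
  have ht1 : (19 * (a:ℝ) / 20) ≤ ((19 * a / 20 : ℕ) : ℝ) + 1 := by
    have : 19 * a ≤ 20 * (19 * a / 20) + 20 := by omega
    have : (19:ℝ) * a ≤ 20 * ((19 * a / 20 : ℕ) : ℝ) + 20 := by exact_mod_cast this
    linarith
  have ht2 : ((19 * a / 20 : ℕ) : ℝ) ≤ (19 * (a:ℝ) / 20) := by
    have : 20 * (19 * a / 20) ≤ 19 * a := by omega
    have : 20 * ((19 * a / 20 : ℕ) : ℝ) ≤ 19 * a := by exact_mod_cast this
    linarith
  have hz4 : 4 ≤ Real.log z := by rw [hzL]; linarith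
  refine ⟨z, by linarith, hzn, hC1, hCz, ?_, hlow, G1, G2, hβ1, hβ3, ?_, ?_⟩
  · have := mul_nonneg hε.le (by linarith : (0:ℝ) ≤ Real.log n)
    linarith
  · rw [← Real.log_le_log_iff (by positivity) (by positivity), Real.log_pow, Real.log_pow]
    push_cast
    have := mul_le_mul_of_nonneg_right ht1 hlβ0
    linarith
  · rw [← Real.log_le_log_iff (by positivity) (by positivity), Real.log_pow, Real.log_pow]
    push_cast
    have := mul_le_mul_of_nonneg_right ht2 hlβ0
    linarith

theorem wA_ge (Kc β : ℝ) (n a : ℕ) (hK : 1 ≤ Kc) (ha : 1 ≤ a) (hβ1 : 1 ≤ β) (hβ3 : β ≤ 3)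
    (h : (n:ℝ) ^ 2 ≤ 2 * Kc * ((a:ℝ) ^ 2 * β ^ a)) :
    ((n:ℝ) / (3 * Kc * Real.exp 1)) ^ a ≤ wA β a := by
  have hβ0 : 0 < β := by linarith
  have hw0 : 0 ≤ wA β a := by rw [wA]; positivity
  have e1 : wA β a ^ 2 = (β ^ (a - 1)) ^ a * ((a.factorial : ℝ)) ^ 2 := by
    rw [wA, mul_pow, ← pow_mul, ← pow_mul]
    congr 2
    have := two_choose a
    obtain ⟨c, rfl⟩ : ∃ c, a = c + 1 := ⟨a - 1, by omega⟩
    simp only [Nat.add_sub_cancel]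
    nlinarith
  have e2 : (((a:ℝ) / Real.exp 1) ^ 2) ^ a ≤ ((a.factorial : ℝ)) ^ 2 := by
    have := fact_lower a
    calc (((a:ℝ) / Real.exp 1) ^ 2) ^ a = (((a:ℝ) / Real.exp 1) ^ a) ^ 2 := by
          rw [← pow_mul, ← pow_mul, mul_comm 2 a]
      _ ≤ _ := by gcongr
  rw [← pow_le_pow_iff_left₀ (by positivity) hw0 (two_ne_zero), e1]
  calc (((n:ℝ) / (3 * Kc * Real.exp 1)) ^ a) ^ 2 = (((n:ℝ) / (3 * Kc * Real.exp 1)) ^ 2) ^ a := by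
        rw [← pow_mul, ← pow_mul, mul_comm 2 a]
    _ = (((n:ℝ) / (3 * Kc * Real.exp 1)) ^ 2) ^ a := rfl
    _ ≤ (β ^ (a - 1) * ((a:ℝ) / Real.exp 1) ^ 2) ^ a := by
        gcongr
        have hba : β ^ a = β ^ (a - 1) * β := by rw [← pow_succ]; congr 1; omega
        rw [div_pow, div_le_iff₀ (by positivity)]
        have hpos : 0 ≤ (a:ℝ) ^ 2 * β ^ (a - 1) := by positivity
        calc (n:ℝ) ^ 2 ≤ 2 * Kc * ((a:ℝ) ^ 2 * β ^ a) := h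
          _ = (2 * Kc * β) * ((a:ℝ) ^ 2 * β ^ (a - 1)) := by rw [hba]; ring
          _ ≤ (9 * Kc ^ 2) * ((a:ℝ) ^ 2 * β ^ (a - 1)) := by
            have hh : 2 * Kc * β ≤ 9 * Kc ^ 2 := by nlinarith
            exact mul_le_mul_of_nonneg_right hh hpos
          _ = _ := by field_simp; try ring
    _ = (β ^ (a - 1)) ^ a * (((a:ℝ) / Real.exp 1) ^ 2) ^ a := by rw [mul_pow]
    _ ≤ _ := by gcongr

set_option maxHeartbeats 1000000 in
theorem R2_asym (b Kc : ℝ) (hb1 : 1 < b) (hbe : b < Real.exp 1) (hK : 1 ≤ Kc) :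
    ∃ ε0 > 0, ε0 ≤ 1 / 2 ∧ ∀ᶠ n : ℕ in atTop, ∀ (k : ℕ) (hk : 0 < k), k ≤ n → ∀ β : ℝ, Reg b Kc n (n / k) β →
      ∀ Q : Finset (Fin k) → Prop, (∀ I, Q I → (k:ℝ) - ((I.card : ℕ) : ℝ) ≤ ε0 * k) →
      ∑ σ ∈ Finset.univ.filter (fun σ : Equiv.Perm (Fin n) => Q (domD (dat (C0 n k hk) (19 * (n / k) / 20) σ))),
        β ^ sC (C0 n k hk) σ ≤
      β ^ fk n k * Dk n k * (2 * Real.exp (1 + 12 * Kc * (n / k : ℕ))) := by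
  obtain ⟨ε, hε, hreg⟩ := reg_facts b Kc hb1 hbe hK
  have he1 : (1:ℝ) ≤ Real.exp 1 := Real.one_le_exp (by norm_num)
  set C1 := 3 * Kc * Real.exp 1 with hC1
  have hC10 : 1 ≤ C1 := by rw [hC1]; nlinarith
  set ε' := 1 / (3 * C1 * Real.exp 2) with hε'
  have hε'0 : 0 < ε' := by positivity
  have he2 : Real.exp 1 ≤ Real.exp 2 := Real.exp_le_exp.2 (by norm_num)
  have h3e : 3 * ε' * Real.exp 1 ≤ 1 := by
    rw [hε', mul_one_div, div_mul_eq_mul_div, div_le_one (by positivity)]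
    nlinarith
  have hε'1 : ε' ≤ 1 := by nlinarith
  refine ⟨ε' / 2, by positivity, by linarith, ?_⟩
  filter_upwards [hreg (Real.exp 1 / ε' + 200), eventually_gt_atTop 0] with n hreg hn k hk hkn β hR Q hQ
  have ha : 1 ≤ n / k := hR.1
  obtain ⟨z, hz2, hzn, hCA, hCz, hCa, hlow, G1, G2, hβ1, hβ3, T1, T2⟩ := hreg (n / k) β hR
  have hn0 : (0:ℝ) < n := by exact_mod_cast hn
  have hkan : k * (n / k) ≤ n := Nat.mul_div_le n k
  have hfk := fk_le n k hk
  set a := n / k with hadef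
  have ha1 : (1:ℝ) ≤ a := by exact_mod_cast ha
  have hkan' : (k:ℝ) * a ≤ n := by exact_mod_cast hkan
  have hkn' : (k:ℝ) ≤ n := by exact_mod_cast hkn
  have hβ0 : 0 < β := by linarith
  have heε : 0 < Real.exp 1 / ε' := by positivity
  have hz200 : 200 ≤ z := by linarith
  have hz0 : 0 < z := by linarith
  set ν := ε' * n with hν
  have hν0 : 0 < ν := by positivity
  -- u
  set u := ((a:ℝ) + 1) ^ 2 * (Real.exp 1 / ε') with hu
  have hA4 : ((a:ℝ) + 1) ^ 2 ≤ ((a:ℝ) + 2) ^ 20 :=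
    calc ((a:ℝ) + 1) ^ 2 ≤ ((a:ℝ) + 2) ^ 2 := by gcongr; norm_num
      _ ≤ _ := pow_le_pow_right₀ (by linarith) (by norm_num)
  have huz : u ≤ z := by
    calc u ≤ ((a:ℝ) + 2) ^ 20 * (Real.exp 1 / ε' + 200) := by
          rw [hu]; gcongr; linarith
      _ ≤ z := by linarith
  have haz : 12 * ((a:ℝ) + 1) ≤ z := by
    calc 12 * ((a:ℝ) + 1) ≤ (Real.exp 1 / ε' + 200) * ((a:ℝ) + 2) ^ 20 := by
          have : ((a:ℝ) + 1) ≤ ((a:ℝ) + 2) ^ 20 :=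
            calc ((a:ℝ) + 1) ≤ ((a:ℝ) + 2) := by linarith
              _ ≤ _ := le_self_pow₀ (by linarith) (by norm_num)
          gcongr; linarith
      _ ≤ z := hCA
  have hy : (((a + 1 : ℕ) : ℝ)) ^ 2 * (Real.exp 1 / ν) = u / n := by
    rw [hu, hν]; push_cast; field_simp
  have hu0 : 0 < u := by positivity
  have hyz : u / n ≤ 1 / z ^ 99 := by
    rw [div_le_div_iff₀ hn0 (by positivity), ← hzn, one_mul]
    calc u * z ^ 99 ≤ z * z ^ 99 := by gcongr
      _ = _ := by ring
  have hL0 : 0 ≤ Real.log n := Real.log_nonneg (by exact_mod_cast hn)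
  have hpz : ∀ i : ℕ, 1 ≤ i → 200 ≤ z ^ i := fun i hi => hz200.trans (le_self_pow₀ (by linarith) (by omega))
  have main := R2_fin n k hk hkn β hβ1 (19 * a / 20) ν ?_ ?_ ?_ ?_ ?_ Q ?_
  · refine main.trans ?_
    have hβf : 0 ≤ β ^ fk n k * (Dk n k : ℝ) := by positivity
    refine mul_le_mul_of_nonneg_left ?_ hβf
    refine mul_le_mul_of_nonneg_left ?_ (by norm_num)
    refine Real.exp_le_exp.2 (add_le_add ?_ ?_)
    · -- S part
      rw [← hadef]
      have hw := wA_ge Kc β n a hK ha hβ1 hβ3 G1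
      rw [← hC1] at hw
      have hexp : (3 * ε' * C1) ^ a = Real.exp (-(2 * a)) := by
        have : 3 * ε' * C1 = Real.exp (-2) := by
          rw [hε', Real.exp_neg]; field_simp
        rw [this, ← Real.exp_nat_mul]; congr 1; ring
      have hx : (3 * ν) ^ (a + 1) * Real.exp 1 / wA β a ≤ n * Real.exp (-(2 * a)) := by
        calc (3 * ν) ^ (a + 1) * Real.exp 1 / wA β a ≤ (3 * ν) ^ (a + 1) * Real.exp 1 / ((n:ℝ) / C1) ^ a := by gcongr
          _ = (3 * ε' * Real.exp 1) * n * (3 * ε' * C1) ^ a := by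
            rw [hν, div_pow, mul_pow (3 * ε') C1, show 3 * (ε' * (n:ℝ)) = (3 * ε') * n by ring, mul_pow (3 * ε') (n:ℝ)]
            field_simp
            try ring
          _ ≤ 1 * n * Real.exp (-(2 * a)) := by rw [hexp]; gcongr
          _ = _ := by ring
      calc (k:ℝ) * ((3 * ν) ^ (a + 1) * Real.exp 1 / wA β a) ≤ n * (n * Real.exp (-(2 * a))) := by
            refine mul_le_mul hkn' hx ?_ (by positivity)
            have hw1 : 0 ≤ wA β a := by rw [wA]; positivity
            positivity
        _ ≤ 1 := by
          have hn2 : (n:ℝ) * (n * Real.exp (-(2 * a))) =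
              Real.exp (Real.log n) * (Real.exp (Real.log n) * Real.exp (-(2 * a))) := by rw [Real.exp_log hn0]
          rw [hn2, ← Real.exp_add, ← Real.exp_add, Real.exp_le_one_iff]
          have := mul_nonneg hε.le hL0
          linarith
    · rw [← hadef]
      have h2 : (k:ℝ) ^ 2 * (a:ℝ) ^ 2 ≤ (n:ℝ) ^ 2 := by
        rw [← mul_pow]; gcongr
      have h3 : (k:ℝ) ^ 2 * (a:ℝ) ^ 2 ≤ (2 * Kc * β ^ a) * (a:ℝ) ^ 2 := by
        refine (h2.trans G1).trans (le_of_eq ?_); ring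
      have h4 : (k:ℝ) ^ 2 ≤ 2 * Kc * β ^ a := le_of_mul_le_mul_right h3 (by positivity)
      rw [show (k:ℝ) ^ 2 * (3 * (((a:ℝ) + 1) / β ^ a)) = (k:ℝ) ^ 2 * (3 * ((a:ℝ) + 1)) / β ^ a by ring,
        div_le_iff₀ (by positivity)]
      calc (k:ℝ) ^ 2 * (3 * ((a:ℝ) + 1)) ≤ 2 * Kc * β ^ a * (3 * (a + a)) := by gcongr
        _ = _ := by ring
  · -- 1 ≤ ν
    have h1 : 1 ≤ Real.exp 1 := he1
    have h2 : Real.exp 1 / ε' ≤ z := by linarith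
    rw [div_le_iff₀ hε'0] at h2
    have h3 : z ≤ n := by rw [← hzn]; exact le_self_pow₀ (by linarith) (by norm_num)
    have : z * ε' ≤ n * ε' := by gcongr
    rw [hν]; linarith
  · have h200 : 200 ≤ a := by
      have : (200:ℝ) ≤ a := by linarith
      exact_mod_cast this
    rw [← hadef]; omega
  · rw [← hadef, hy]
    calc β ^ (19 * a / 20 + 2) * (u / n) ^ 2 ≤ z ^ 193 * (1 / z ^ 99) ^ 2 := by gcongr
      _ = 1 / z ^ 5 := by field_simp
      _ ≤ 1 / 4 := by
        have := hpz 5 (by norm_num)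
        exact one_div_le_one_div_of_le (by norm_num) (by linarith)
  · rw [← hadef, hy]
    have hch : (((a + 1).choose 2 : ℕ) : ℝ) ≤ ((a:ℝ) + 1) ^ 2 := by
      have := two_choose (a + 1)
      have h2 : (a + 1).choose 2 ≤ (a + 1) ^ 2 := by nlinarith
      exact_mod_cast h2
    have hff : (fk n k : ℝ) ≤ n * (a + 1) ^ 2 / 2 := by
      have : (2:ℝ) * fk n k ≤ n * a := by exact_mod_cast hfk
      have : (n:ℝ) * a ≤ n * ((a:ℝ) + 1) ^ 2 := by gcongr; nlinarith
      linarith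
    have p1 : 2 * (β - 1) * (((a + 1).choose 2 : ℕ) : ℝ) * (fk n k : ℝ) * (Real.exp 1 / ν) ^ 2 ≤ 1 / 2 := by
      calc 2 * (β - 1) * (((a + 1).choose 2 : ℕ) : ℝ) * (fk n k : ℝ) * (Real.exp 1 / ν) ^ 2
          ≤ 2 * 2 * (((a:ℝ) + 1) ^ 2) * (n * (a + 1) ^ 2 / 2) * (Real.exp 1 / ν) ^ 2 := by
            gcongr; linarith
        _ = 2 * u ^ 2 / n := by rw [hu, hν]; field_simp
        _ ≤ 2 * z ^ 2 / n := by gcongr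
        _ = 2 / z ^ 98 := by rw [← hzn]; field_simp
        _ ≤ 1 / 2 := by
          have := hpz 98 (by norm_num)
          rw [div_le_div_iff₀ (by positivity) (by norm_num)]; linarith
    have p2 : (k:ℝ) * (2 * β ^ 3 * (u / n) ^ 3) ≤ 1 / 2 := by
      calc (k:ℝ) * (2 * β ^ 3 * (u / n) ^ 3) ≤ n * (2 * 3 ^ 3 * (1 / z ^ 99) ^ 3) := by gcongr
        _ = 54 / z ^ 197 := by rw [← hzn]; field_simp; norm_num
        _ ≤ 1 / 2 := by
          have := hpz 197 (by norm_num)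
          rw [div_le_div_iff₀ (by positivity) (by norm_num)]; linarith
    linarith
  · rw [← hadef]
    calc 12 * (n:ℝ) * ((a:ℝ) + 1) = (12 * ((a:ℝ) + 1)) * z ^ 100 := by rw [← hzn]; ring
      _ ≤ z * z ^ 100 := by gcongr
      _ = z ^ 101 := by ring
      _ ≤ z ^ 187 := pow_le_pow_right₀ (by linarith) (by norm_num)
      _ ≤ _ := T1
  · intro I hI
    have hcard : I.card ≤ k := by simpa using Finset.card_le_univ I
    rw [← hadef]
    push_cast [Nat.cast_sub hcard]
    calc ((a:ℝ) + 1) * ((k:ℝ) - ((I.card : ℕ) : ℝ)) ≤ (a + a) * (ε' / 2 * k) := by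
          have h0 : (0:ℝ) ≤ (k:ℝ) - ((I.card : ℕ) : ℝ) := by
            have : ((I.card : ℕ) : ℝ) ≤ k := by exact_mod_cast hcard
            linarith
          have h1 : (a:ℝ) + 1 ≤ a + a := by linarith
          exact mul_le_mul h1 (hQ I hI) h0 (by positivity)
      _ = ε' * (k * a) := by ring
      _ ≤ ν := by rw [hν]; gcongr

theorem log_fact_le (n : ℕ) (hn : 1 ≤ n) :
    Real.log (n.factorial : ℝ) ≤ 1 + Real.log n + n * Real.log n - n := by
  induction n, hn using Nat.le_induction with
  | base => simp
  | succ n hn ih =>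
    have hn0 : (0:ℝ) < n := by exact_mod_cast hn
    rw [Nat.factorial_succ]
    push_cast
    rw [Real.log_mul (by positivity) (by positivity)]
    have h := Real.one_sub_inv_le_log_of_pos (show (0:ℝ) < ((n:ℝ) + 1) / n by positivity)
    rw [Real.log_div (by positivity) (by positivity)] at h
    have h2 : 1 - (((n:ℝ) + 1) / n)⁻¹ = 1 / (n + 1) := by field_simp; ring
    rw [h2, div_le_iff₀ (by positivity)] at h
    linarith

theorem exp_two_le : Real.exp 2 ≤ 8 := by
  have h : Real.exp 2 = Real.exp 1 * Real.exp 1 := by rw [← Real.exp_add]; norm_num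
  have h1 := Real.exp_one_lt_d9
  have h0 := Real.exp_pos 1
  rw [h]
  nlinarith

theorem brk (ε0 δ0 : ℝ) (hε : 0 < ε0) (hδ : 0 < δ0) : ∃ C : ℝ, 0 < C ∧
    ∀ n a k l f n' β z lam : ℝ, 2 ≤ z → z ^ 100 = n → C * (a + 2) ^ 20 ≤ z → C ≤ a → 1 ≤ a →
      1 ≤ β → β ≤ 3 → 0 ≤ k → k ≤ n → 0 ≤ l → 0 ≤ f → 2 * f ≤ n * a → ε0 * n / 2 ≤ n' → n' ≤ n →
      n - (a + 1) * l ≤ n' → 2 * (β - 1) * f ^ 2 / n ^ 2 ≤ lam + δ0 → 0 ≤ lam →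
      Real.exp ((a ^ 3) ^ 2 / (ε0 * n / 2) + 2 * (β - 1) * f ^ 2 * (1 / n') ^ 2 +
          k ^ 2 * (2 * β ^ 3 * ((a + 1) ^ 2 * (1 / (ε0 * n / 2))) ^ 3)) +
       Real.exp (- a ^ 3 + 2 * (β - 1) * f ^ 2 * (Real.exp 2 / (ε0 * n / 2)) ^ 2 +
          k ^ 2 * (2 * β ^ 3 * ((a + 1) ^ 2 * (Real.exp 2 / (ε0 * n / 2))) ^ 3)) ≤
      ((Real.exp (3 * δ0) + δ0) * Real.exp lam) * Real.exp l := by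
  set c1 := 2 / (ε0 * δ0) with hc1
  set c2 := 8 / ε0 ^ 2 with hc2
  set c3 := 432 / (ε0 ^ 3 * δ0) with hc3
  set c4 := 432 * 512 / ε0 ^ 3 with hc4
  set c5 := 256 / ε0 ^ 2 with hc5
  have h1 : 0 < c1 := by positivity
  have h2 : 0 < c2 := by positivity
  have h3 : 0 < c3 := by positivity
  have h4 : 0 < c4 := by positivity
  have h5 : 0 < c5 := by positivity
  have h6 : 0 ≤ |Real.log δ0| := abs_nonneg _
  refine ⟨c1 + c2 + c3 + c4 + c5 + |Real.log δ0| + 2, by positivity, ?_⟩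
  intro n a k l f n' β z lam hz hzn hC hCa ha hβ1 hβ3 hk0 hkn hl hf0 hf hn'1 hn'n hn'l hlam hlam0
  have hz0 : 0 < z := by linarith
  have hzn1 : z ≤ n := by rw [← hzn]; exact le_self_pow₀ (by linarith) (by norm_num)
  have hn0 : 0 < n := by linarith
  have key : ∀ c, 0 ≤ c → c ≤ c1 + c2 + c3 + c4 + c5 + |Real.log δ0| + 2 → ∀ j : ℕ, j ≤ 20 →
      c * (a + 1) ^ j ≤ n := by
    intro c hc0 hc j hj
    have : (a + 1) ^ j ≤ (a + 2) ^ 20 :=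
      calc (a + 1) ^ j ≤ (a + 2) ^ j := by gcongr; norm_num
        _ ≤ _ := pow_le_pow_right₀ (by linarith) hj
    calc c * (a + 1) ^ j ≤ (c1 + c2 + c3 + c4 + c5 + |Real.log δ0| + 2) * (a + 2) ^ 20 := by gcongr
      _ ≤ n := hC.trans hzn1
  have hn'0 : 0 < n' := lt_of_lt_of_le (by positivity) hn'1
  have hbf : 2 * (β - 1) * f ^ 2 ≤ n ^ 2 * a ^ 2 := by
    have hff : (2 * f) ^ 2 ≤ (n * a) ^ 2 := by gcongr
    have : 2 * (β - 1) * f ^ 2 ≤ 4 * f ^ 2 := by gcongr; linarith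
    linarith [hff, mul_pow n a 2, mul_pow 2 f 2]
  have hb0 : 0 ≤ 2 * (β - 1) * f ^ 2 := by
    have : 0 ≤ β - 1 := by linarith
    positivity
  have hb3 : β ^ 3 ≤ 27 := by
    calc β ^ 3 ≤ 3 ^ 3 := by gcongr
      _ = 27 := by norm_num
  have he2 := exp_two_le
  have he20 := Real.exp_pos 2
  -- term 1
  have t1 : (a ^ 3) ^ 2 / (ε0 * n / 2) ≤ δ0 := by
    have := key c1 h1.le (by linarith) 6 (by norm_num)
    rw [hc1, div_mul_eq_mul_div, div_le_iff₀ (by positivity)] at this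
    rw [div_le_iff₀ (by positivity)]
    have h : (a ^ 3) ^ 2 ≤ (a + 1) ^ 6 := by rw [← pow_mul]; gcongr; linarith
    linarith
  have t3 : k ^ 2 * (2 * β ^ 3 * ((a + 1) ^ 2 * (1 / (ε0 * n / 2))) ^ 3) ≤ δ0 := by
    have := key c3 h3.le (by linarith) 6 (by norm_num)
    rw [hc3, div_mul_eq_mul_div, div_le_iff₀ (by positivity)] at this
    calc k ^ 2 * (2 * β ^ 3 * ((a + 1) ^ 2 * (1 / (ε0 * n / 2))) ^ 3)
        ≤ n ^ 2 * (2 * 27 * ((a + 1) ^ 2 * (1 / (ε0 * n / 2))) ^ 3) := by gcongr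
      _ = 432 * (a + 1) ^ 6 / (n * ε0 ^ 3) := by field_simp; ring
      _ ≤ δ0 := by rw [div_le_iff₀ (by positivity)]; linarith
  have t4 : k ^ 2 * (2 * β ^ 3 * ((a + 1) ^ 2 * (Real.exp 2 / (ε0 * n / 2))) ^ 3) ≤ 1 := by
    have := key c4 h4.le (by linarith) 6 (by norm_num)
    rw [hc4, div_mul_eq_mul_div, div_le_iff₀ (by positivity)] at this
    calc k ^ 2 * (2 * β ^ 3 * ((a + 1) ^ 2 * (Real.exp 2 / (ε0 * n / 2))) ^ 3)
        ≤ n ^ 2 * (2 * 27 * ((a + 1) ^ 2 * (8 / (ε0 * n / 2))) ^ 3) := by gcongr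
      _ = 432 * 512 * (a + 1) ^ 6 / (n * ε0 ^ 3) := by field_simp; ring
      _ ≤ 1 := by rw [div_le_iff₀ (by positivity)]; linarith
  have t5 : 2 * (β - 1) * f ^ 2 * (Real.exp 2 / (ε0 * n / 2)) ^ 2 ≤ c5 * a ^ 2 := by
    calc 2 * (β - 1) * f ^ 2 * (Real.exp 2 / (ε0 * n / 2)) ^ 2
        ≤ n ^ 2 * a ^ 2 * (8 / (ε0 * n / 2)) ^ 2 := by gcongr
      _ = c5 * a ^ 2 := by rw [hc5]; field_simp; ring
  have t2 : 2 * (β - 1) * f ^ 2 * (1 / n') ^ 2 ≤ lam + δ0 + l := by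
    have hd : (1 / n') ^ 2 ≤ 1 / n ^ 2 + 8 * (a + 1) * l / (n * ε0 ^ 2) / n ^ 2 := by
      have e : (1 / n') ^ 2 = 1 / n ^ 2 + (n - n') * (n + n') / (n ^ 2 * n' ^ 2) := by
        field_simp; ring
      rw [e]
      have : (n - n') * (n + n') / (n ^ 2 * n' ^ 2) ≤ ((a + 1) * l) * (2 * n) / (n ^ 2 * (ε0 * n / 2) ^ 2) := by
        gcongr <;> linarith
      refine add_le_add le_rfl (this.trans (le_of_eq ?_))
      field_simp; ring
    have := key c2 h2.le (by linarith) 3 (by norm_num)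
    rw [hc2, div_mul_eq_mul_div, div_le_iff₀ (by positivity)] at this
    calc 2 * (β - 1) * f ^ 2 * (1 / n') ^ 2
        ≤ 2 * (β - 1) * f ^ 2 * (1 / n ^ 2 + 8 * (a + 1) * l / (n * ε0 ^ 2) / n ^ 2) := by gcongr
      _ = 2 * (β - 1) * f ^ 2 / n ^ 2 + 2 * (β - 1) * f ^ 2 * (8 * (a + 1) * l / (n * ε0 ^ 2) / n ^ 2) := by ring
      _ ≤ (lam + δ0) + n ^ 2 * a ^ 2 * (8 * (a + 1) * l / (n * ε0 ^ 2) / n ^ 2) := by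
          gcongr
      _ = (lam + δ0) + (8 * (a ^ 2 * (a + 1))) / (n * ε0 ^ 2) * l := by field_simp
      _ ≤ (lam + δ0) + 1 * l := by
          gcongr
          rw [div_le_one (by positivity)]
          have h : a ^ 2 * (a + 1) ≤ (a + 1) ^ 3 := by
            have : a ^ 2 ≤ (a + 1) ^ 2 := by gcongr; linarith
            calc a ^ 2 * (a + 1) ≤ (a + 1) ^ 2 * (a + 1) := by gcongr
              _ = _ := by ring
          linarith
      _ = _ := by ring
  have E1 : Real.exp ((a ^ 3) ^ 2 / (ε0 * n / 2) + 2 * (β - 1) * f ^ 2 * (1 / n') ^ 2 +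
          k ^ 2 * (2 * β ^ 3 * ((a + 1) ^ 2 * (1 / (ε0 * n / 2))) ^ 3)) ≤
      Real.exp (3 * δ0) * Real.exp lam * Real.exp l := by
    rw [← Real.exp_add, ← Real.exp_add]
    exact Real.exp_le_exp.2 (by linarith)
  have E2 : Real.exp (- a ^ 3 + 2 * (β - 1) * f ^ 2 * (Real.exp 2 / (ε0 * n / 2)) ^ 2 +
          k ^ 2 * (2 * β ^ 3 * ((a + 1) ^ 2 * (Real.exp 2 / (ε0 * n / 2))) ^ 3)) ≤ δ0 * 1 * 1 := by
    rw [mul_one, mul_one, ← Real.le_log_iff_exp_le hδ]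
    have ha2 : 1 ≤ a ^ 2 := one_le_pow₀ ha
    have q1 : (c5 + 1 + |Real.log δ0|) * a ^ 2 ≤ a * a ^ 2 := by gcongr; linarith
    have q2 : |Real.log δ0| * 1 ≤ |Real.log δ0| * a ^ 2 := by gcongr
    have q3 := neg_abs_le (Real.log δ0)
    have q4 : a * a ^ 2 = a ^ 3 := by ring
    rw [q4] at q1
    linarith
  have o1 : 1 ≤ Real.exp lam := Real.one_le_exp hlam0
  have o2 : 1 ≤ Real.exp l := Real.one_le_exp hl
  have E3 : δ0 * 1 * 1 ≤ δ0 * Real.exp lam * Real.exp l := by gcongr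
  linarith

theorem log_fact_ge (k : ℕ) (hk : 0 < k) : (k:ℝ) * Real.log k - k ≤ Real.log (k.factorial : ℝ) := by
  have hk0 : (0:ℝ) < k := by exact_mod_cast hk
  have h := fact_lower k
  have h2 := Real.log_le_log (by positivity) h
  rw [Real.log_pow, Real.log_div (by positivity) (by positivity), Real.log_exp] at h2
  linarith

theorem hV_log (n k : ℕ) (hk : 0 < k) (hkn : k ≤ n) (β Y : ℝ) (hβ : 1 ≤ β)
    (hE : β ^ fk n k * (Dk n k : ℝ) ≤ (n.factorial : ℝ) * Real.exp Y)
    (hY : Y + 1 + Real.log n ≤ k) :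
    k * Real.log (wA β (n / k) / (n:ℝ) ^ (n / k)) +
      (n % k : ℕ) * Real.log (((n / k : ℕ) + 1) * β ^ (n / k) / n) ≤ -n + k * (3 - Real.log k) := by
  have hk0 : (0:ℝ) < k := by exact_mod_cast hk
  have hn : 0 < n := lt_of_lt_of_le hk hkn
  have hn0 : (0:ℝ) < n := by exact_mod_cast hn
  have hβ0 : 0 < β := by linarith
  have hw : 0 < wA β (n / k) := by rw [wA]; positivity
  rw [← wA_Dk n k hk β] at hE
  have hf0 : (0:ℝ) < (((k - n % k).factorial * (n % k).factorial : ℕ) : ℝ) := by positivity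
  have hB : (0:ℝ) < ((n / k : ℕ) + 1) * β ^ (n / k) := by positivity
  have hL := Real.log_le_log (by positivity) hE
  rw [Real.log_mul (by positivity) hf0.ne', Real.log_mul (by positivity) (by positivity),
    Real.log_mul (by positivity) (by positivity), Real.log_pow, Real.log_pow, Real.log_exp] at hL
  have h1 := log_fact_le n hn
  have h2 := log_fact_ge k hk
  have h3 : Real.log (k.factorial : ℝ) ≤ k * Real.log 2 +
      Real.log (((k - n % k).factorial * (n % k).factorial : ℕ) : ℝ) := by
    rw [← Real.log_pow, ← Real.log_mul (by positivity) hf0.ne']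
    refine Real.log_le_log (by positivity) ?_
    have hlt := (Nat.mod_lt n hk).le
    have e := Nat.choose_mul_factorial_mul_factorial hlt
    have h4 : k.choose (n % k) ≤ 2 ^ k := Nat.choose_le_two_pow k (n % k)
    have : k.factorial ≤ 2 ^ k * ((k - n % k).factorial * (n % k).factorial) := by
      rw [← e, mul_assoc, mul_comm ((n % k).factorial)]
      exact Nat.mul_le_mul_right _ h4
    exact_mod_cast this
  rw [Real.log_div hw.ne' (by positivity), Real.log_div hB.ne' hn0.ne', Real.log_pow]
  have hl2 : Real.log 2 ≤ 1 := by
    have := Real.log_two_lt_d9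
    linarith
  have hk2 : k * Real.log 2 ≤ k * 1 := by gcongr
  have hsplit : (k:ℝ) * (n / k : ℕ) + (n % k : ℕ) = n := by exact_mod_cast Nat.div_add_mod n k
  have hsp2 : (k:ℝ) * ((n / k : ℕ) * Real.log n) + (n % k : ℕ) * Real.log n = n * Real.log n := by
    calc _ = ((k:ℝ) * (n / k : ℕ) + (n % k : ℕ)) * Real.log n := by ring
      _ = _ := by rw [hsplit]
  linarith

theorem loglog_small (K c C : ℝ) (hK : 0 < K) (hc : 0 < c) :
    ∀ᶠ n : ℕ in atTop, 2 * Real.log (K * Real.log n + 1) + C ≤ c * Real.log n := by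
  have hlog : Tendsto (fun n : ℕ => Real.log n) atTop atTop :=
    Real.tendsto_log_atTop.comp tendsto_natCast_atTop_atTop
  have hx : Tendsto (fun n : ℕ => K * Real.log n + 1) atTop atTop :=
    tendsto_atTop_add_const_right _ _ (hlog.const_mul_atTop hK)
  have ho := (Real.isLittleO_log_id_atTop.bound (show 0 < c / (4 * K) by positivity))
  have h1 := hx.eventually ho
  have h2 := hlog.eventually_ge_atTop (2 / c * (C + c / (2 * K)))
  filter_upwards [h1, h2, hlog.eventually_ge_atTop 0] with n h1 h2 h0
  have h3 := (le_abs_self _).trans h1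
  simp only [id, Real.norm_eq_abs] at h3
  rw [abs_of_nonneg (by positivity)] at h3
  have h4 : c / (4 * K) * (K * Real.log n + 1) = c / 4 * Real.log n + c / (2 * K) / 2 := by
    field_simp; ring
  rw [h4] at h3
  have h5 : c * (2 / c * (C + c / (2 * K))) ≤ c * Real.log n := by gcongr
  have h6 : c * (2 / c * (C + c / (2 * K))) = 2 * (C + c / (2 * K)) := by field_simp
  linarith

theorem choose_delta (δ : ℝ) (hδ : 0 < δ) :
    ∃ δ0 > 0, (Real.exp (3 * δ0) + δ0) * (Real.exp δ0 + δ0) ≤ 1 + δ := by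
  have hc : Tendsto (fun x : ℝ => (Real.exp (3 * x) + x) * (Real.exp x + x)) (nhds 0) (nhds 1) := by
    have : Continuous (fun x : ℝ => (Real.exp (3 * x) + x) * (Real.exp x + x)) := by fun_prop
    have h := this.tendsto 0
    simpa using h
  have h := hc.eventually (eventually_le_nhds (show (1:ℝ) < 1 + δ by linarith))
  have h2 := (h.filter_mono nhdsWithin_le_nhds : ∀ᶠ x in nhdsWithin (0:ℝ) (Set.Ioi 0), _)
  obtain ⟨x, hx1, hx2⟩ := (h2.and self_mem_nhdsWithin).exists
  exact ⟨x, hx2, hx1⟩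

/-- mean of the overlap exponent -/
theorem lam_bound (n a f b b0 β N δ0 : ℝ) (hn : 0 < n) (ha : 0 ≤ a) (hf0 : 0 ≤ f) (hf : 2 * f ≤ n * a)
    (hb0 : 1 ≤ b0) (hb03 : b0 ≤ 3) (hb : 0 ≤ b) (hβ : β ≤ b0 * Real.exp (6 * a * b / n)) (hβ1 : 1 ≤ β)
    (hN1 : n ^ 2 / 4 ≤ N) (hN2 : N ≤ n ^ 2 / 2) (h1 : 6 * a * b ≤ n) (h2 : 36 * b * a ^ 3 ≤ δ0 * n) :
    2 * (β - 1) * f ^ 2 / n ^ 2 ≤ (b0 - 1) * f ^ 2 / N + δ0 := by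
  have hN0 : 0 < N := lt_of_lt_of_le (by positivity) hN1
  have hx0 : 0 ≤ 6 * a * b / n := by positivity
  have hx1 : 6 * a * b / n ≤ 1 := by rw [div_le_one hn]; exact h1
  have he : Real.exp (6 * a * b / n) ≤ 1 + 2 * (6 * a * b / n) := by
    have := Real.exp_bound' hx0 hx1 (n := 1) (by norm_num)
    simp at this
    linarith
  have hd : β ≤ b0 + 36 * a * b / n := by
    calc β ≤ b0 * Real.exp (6 * a * b / n) := hβ
      _ ≤ b0 * (1 + 2 * (6 * a * b / n)) := by gcongr
      _ = b0 + b0 * (2 * (6 * a * b / n)) := by ring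
      _ ≤ b0 + 3 * (2 * (6 * a * b / n)) := by gcongr
      _ = _ := by ring
  have hff : f ^ 2 / N ≤ a ^ 2 := by
    rw [div_le_iff₀ hN0]
    have : (2 * f) ^ 2 ≤ (n * a) ^ 2 := by gcongr
    calc f ^ 2 = (2 * f) ^ 2 / 4 := by ring
      _ ≤ (n * a) ^ 2 / 4 := by gcongr
      _ = a ^ 2 * (n ^ 2 / 4) := by ring
      _ ≤ _ := by gcongr
  calc 2 * (β - 1) * f ^ 2 / n ^ 2 = (β - 1) * f ^ 2 / (n ^ 2 / 2) := by field_simp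
    _ ≤ (β - 1) * f ^ 2 / N := by
        have : 0 ≤ β - 1 := by linarith
        gcongr
    _ ≤ (b0 + 36 * a * b / n - 1) * f ^ 2 / N := by gcongr
    _ = (b0 - 1) * f ^ 2 / N + 36 * a * b / n * (f ^ 2 / N) := by ring
    _ ≤ (b0 - 1) * f ^ 2 / N + 36 * a * b / n * a ^ 2 := by gcongr
    _ = (b0 - 1) * f ^ 2 / N + 36 * b * a ^ 3 / n := by ring
    _ ≤ _ := by
        gcongr
        rw [div_le_iff₀ hn]; exact h2

set_option maxHeartbeats 1000000 in
theorem R1_asym (b Kc ε0 δ : ℝ) (hb1 : 1 < b) (hbe : b < Real.exp 1) (hK : 1 ≤ Kc) (hε0 : 0 < ε0) (hδ : 0 < δ) :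
    ∀ᶠ n : ℕ in atTop, ∀ (k : ℕ) (hk : 0 < k), k ≤ n → ∀ β b0 N : ℝ, Reg b Kc n (n / k) β →
      1 ≤ b0 → b0 ≤ b → β ≤ b0 * Real.exp (6 * (n / k : ℕ) * b / n) →
      (n:ℝ) ^ 2 / 4 ≤ N → N ≤ (n:ℝ) ^ 2 / 2 →
      (Dk n k : ℝ) * b0 ^ fk n k ≤ (n.factorial : ℝ) →
      ∀ P : Finset (Fin k) → Prop, (∀ I, P I → ε0 * k ≤ (k:ℝ) - ((I.card : ℕ) : ℝ)) →
      ∑ σ ∈ Finset.univ.filter (fun σ : Equiv.Perm (Fin n) => P (domD (dat (C0 n k hk) (19 * (n / k) / 20) σ))),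
        β ^ sC (C0 n k hk) σ ≤
      (n.factorial : ℝ) * ((1 + δ) * Real.exp ((b0 - 1) * (fk n k : ℝ) ^ 2 / N)) := by
  obtain ⟨ε, hε, hreg⟩ := reg_facts b Kc hb1 hbe hK
  obtain ⟨δ0, hδ0, hδδ⟩ := choose_delta δ hδ
  obtain ⟨Cb, hCb, hbrk⟩ := brk ε0 δ0 hε0 hδ0
  obtain ⟨Ku, hKu, hup⟩ := scale_up b Kc hb1 (by linarith)
  set η := ε / (2 * (1 + ε)) with hη
  have hη0 : 0 < η := by positivity
  set c := min (ε / 2) ε0 with hc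
  have hc0 : 0 < c := lt_min (by positivity) hε0
  have he3 : Real.exp 1 < 3 := by have := Real.exp_one_lt_d9; linarith
  set Cs := Cb + 16 / ε0 + 36 * b / δ0 + 6 * b + 4 * Kc + 1 / δ0 + 10 with hCs
  have p1 : 0 < 16 / ε0 := by positivity
  have p2 : 0 < 36 * b / δ0 := by positivity
  have p3 : 0 < 1 / δ0 := by positivity
  have hCs0 : 0 < Cs := by positivity
  filter_upwards [hreg Cs, eventually_gt_atTop 0, hup, loglog_small Ku c (7 + 4 / η) hKu hc0] with
    n hreg hn hup hll k hk hkn β b0 N hR hb01 hb0b hβb0 hN1 hN2 hD P hP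
  have ha : 1 ≤ n / k := hR.1
  obtain ⟨z, hz2, hzn, hCA, hCz, hCa, hlow, G1, G2, hβ1, hβ3, T1, T2⟩ := hreg (n / k) β hR
  have haK := hup (n / k) ha hR.2.2.1
  have hn0 : (0:ℝ) < n := by exact_mod_cast hn
  have hn1 : (1:ℝ) ≤ n := by exact_mod_cast hn
  have hkan : k * (n / k) ≤ n := Nat.mul_div_le n k
  have hkan1 : n ≤ k * (n / k + 1) := (Nat.lt_mul_div_succ n hk).le
  have hfk := fk_le n k hk
  have hszb := sz_bounds n k hk
  have hhV := hV_log n k hk hkn β (3 * ((n / k : ℕ):ℝ) ^ 2 * b) hβ1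
  have htI := termI n k hk hkn β hβ1 3
  have hRF := R1_fin n k hk hn β hβ1 (19 * (n / k) / 20)
  set a := n / k with hadef
  have ha1 : (1:ℝ) ≤ a := by exact_mod_cast ha
  have hk0 : (0:ℝ) < k := by exact_mod_cast hk
  have hkan' : (k:ℝ) * a ≤ n := by exact_mod_cast hkan
  have hkan1' : (n:ℝ) ≤ k * (a + 1) := by exact_mod_cast hkan1
  have hkn' : (k:ℝ) ≤ n := by exact_mod_cast hkn
  have hβ0 : 0 < β := by linarith
  have hz0 : 0 < z := by linarith
  have hL0 : 0 ≤ Real.log n := Real.log_nonneg hn1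
  have hzn1 : z ≤ n := by rw [← hzn]; exact le_self_pow₀ (by linarith) (by norm_num)
  have key : ∀ c, 0 ≤ c → c ≤ Cs → ∀ j : ℕ, j ≤ 20 → c * ((a:ℝ) + 1) ^ j ≤ z := by
    intro c hc0 hc j hj
    have : ((a:ℝ) + 1) ^ j ≤ ((a:ℝ) + 2) ^ 20 :=
      calc ((a:ℝ) + 1) ^ j ≤ ((a:ℝ) + 2) ^ j := by gcongr; norm_num
        _ ≤ _ := pow_le_pow_right₀ (by linarith) hj
    calc c * ((a:ℝ) + 1) ^ j ≤ Cs * ((a:ℝ) + 2) ^ 20 := by gcongr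
      _ ≤ z := hCA
  have hkz : z ≤ k := by
    have h1 := key 1 (by norm_num) (by rw [hCs]; linarith) 1 (by norm_num)
    rw [one_mul, pow_one] at h1
    have h2 : z ^ 99 * z ≤ k * z := by
      calc z ^ 99 * z = n := by rw [← hzn]; ring
        _ ≤ k * (a + 1) := hkan1'
        _ ≤ k * z := by gcongr
    have h3 : z ^ 99 ≤ k := le_of_mul_le_mul_right h2 hz0
    exact (le_self_pow₀ (by linarith) (by norm_num)).trans h3
  have hfr : 2 * (fk n k : ℝ) ≤ n * a := by exact_mod_cast hfk
  set lam := (b0 - 1) * (fk n k : ℝ) ^ 2 / N with hlam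
  have hN0 : 0 < N := lt_of_lt_of_le (by positivity) hN1
  have hlam0 : 0 ≤ lam := by
    have : 0 ≤ b0 - 1 := by linarith
    positivity
  have hlamb : 2 * (β - 1) * (fk n k : ℝ) ^ 2 / (n:ℝ) ^ 2 ≤ lam + δ0 := by
    refine lam_bound n a (fk n k) b b0 β N δ0 hn0 (by positivity) (by positivity) hfr hb01 (by linarith) (by linarith)
      hβb0 hβ1 hN1 hN2 ?_ ?_
    · have h1 := key (6 * b) (by positivity) (by rw [hCs]; linarith) 1 (by norm_num)
      rw [pow_one] at h1
      linarith
    · have h1 := key (36 * b / δ0) (by positivity) (by rw [hCs]; linarith) 3 (by norm_num)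
      rw [div_mul_eq_mul_div, div_le_iff₀ hδ0] at h1
      have h2 : 36 * b * (a:ℝ) ^ 3 ≤ 36 * b * ((a:ℝ) + 1) ^ 3 := by gcongr; linarith
      have h3 : z * δ0 ≤ n * δ0 := by gcongr
      linarith
  -- bracket
  have hν0 : 0 < ε0 * n / 2 := by positivity
  have hcc : β ^ (19 * a / 20 + 2) * (((a + 1 : ℕ):ℝ) ^ 2 * (Real.exp 2 / (ε0 * n / 2))) ^ 2 ≤ 1 / 4 := by
    have hu := key (16 / ε0) p1.le (by rw [hCs]; linarith) 2 (by norm_num)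
    have he2 := exp_two_le
    have hy : ((a + 1 : ℕ):ℝ) ^ 2 * (Real.exp 2 / (ε0 * n / 2)) ≤ 1 / z ^ 99 := by
      calc ((a + 1 : ℕ):ℝ) ^ 2 * (Real.exp 2 / (ε0 * n / 2)) ≤ ((a + 1 : ℕ):ℝ) ^ 2 * (8 / (ε0 * n / 2)) := by gcongr
        _ = (16 / ε0 * ((a:ℝ) + 1) ^ 2) / n := by push_cast; field_simp; ring
        _ ≤ z / n := by gcongr
        _ = 1 / z ^ 99 := by rw [← hzn]; field_simp
    calc β ^ (19 * a / 20 + 2) * (((a + 1 : ℕ):ℝ) ^ 2 * (Real.exp 2 / (ε0 * n / 2))) ^ 2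
        ≤ z ^ 193 * (1 / z ^ 99) ^ 2 := by gcongr
      _ = 1 / z ^ 5 := by field_simp
      _ ≤ 1 / 2 ^ 5 := by gcongr
      _ ≤ 1 / 4 := by norm_num
  have hbr : ∀ D ∈ Fintype.piFinset (datR (C0 n k hk) (19 * a / 20)), P (domD D) →
      ∑ σ ∈ Finset.univ.filter (fun σ : Equiv.Perm (Fin n) => HasData (C0 n k hk) (19 * a / 20) σ D), β ^ sC (C0 n k hk) σ ≤
      (n.factorial : ℝ) / (n.descFactorial (∑ i, rowM (D i)) : ℝ) *
      (∏ i ∈ domD D, rowW (C0 n k hk) β (19 * a / 20) 0 (D i) i) *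
        (((Real.exp (3 * δ0) + δ0) * Real.exp lam) * Real.exp (domD D).card) := by
    intro D hD hPD
    have hPD' := hP _ hPD
    have hR1 := rowM_le_Rex _ _ D hD
    have hR2 := Rex_le (C0 n k hk) (domD D)
    have hcard : (domD D).card ≤ k := by simpa using Finset.card_le_univ (domD D)
    have hR3 : Rex (C0 n k hk) (domD D) ≤ (a + 1) * (domD D).card := by
      rw [Rex]
      calc _ ≤ ∑ i ∈ domD D, (a + 1) := Finset.sum_le_sum fun i _ => (hszb i).2
        _ = _ := by rw [Finset.sum_const, smul_eq_mul, mul_comm]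
    have hR4 : Rex (C0 n k hk) (domD D) + a * (k - (domD D).card) ≤ n := by
      have e := Finset.sum_add_sum_compl (domD D) (fun i => szC (C0 n k hk) i)
      rw [sum_sz] at e
      have : a * (k - (domD D).card) ≤ ∑ i ∈ (domD D)ᶜ, szC (C0 n k hk) i := by
        calc a * (k - (domD D).card) = ∑ i ∈ (domD D)ᶜ, a := by
              rw [Finset.sum_const, smul_eq_mul, Finset.card_compl, Fintype.card_fin, mul_comm]
          _ ≤ _ := Finset.sum_le_sum fun i _ => (hszb i).1
      rw [Rex]; omega
    set R := ∑ i, rowM (D i) with hRdef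
    have hRn : R ≤ n := hR1.trans hR2
    have hcast : ((n - R : ℕ) : ℝ) = (n:ℝ) - R := by rw [Nat.cast_sub hRn]
    have hR1' : (R:ℝ) ≤ Rex (C0 n k hk) (domD D) := by exact_mod_cast hR1
    have hR3' : (Rex (C0 n k hk) (domD D) : ℝ) ≤ ((a:ℝ) + 1) * (domD D).card := by exact_mod_cast hR3
    have hR4' : (Rex (C0 n k hk) (domD D) : ℝ) + (a:ℝ) * ((k:ℝ) - (domD D).card) ≤ n := by
      have : ((Rex (C0 n k hk) (domD D) + a * (k - (domD D).card) : ℕ) : ℝ) ≤ n := by exact_mod_cast hR4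
      rw [Nat.cast_add, Nat.cast_mul, Nat.cast_sub hcard] at this
      exact this
    have hνn : ε0 * n / 2 ≤ ((n - R : ℕ) : ℝ) := by
      rw [hcast]
      have q1 : (a:ℝ) * (ε0 * k) ≤ (a:ℝ) * ((k:ℝ) - (domD D).card) := by gcongr
      have q2 : ε0 * (n:ℝ) ≤ ε0 * (k * (a + a)) := by
        refine mul_le_mul_of_nonneg_left (hkan1'.trans ?_) hε0.le
        gcongr
      linarith
    have hb := br1 (C0 n k hk) β hβ1 (19 * a / 20) (a + 1) (fun j => (hszb j).2) D hD (ε0 * n / 2) ((a:ℝ) ^ 3)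
      hν0 (by positivity) hνn hcc
    refine hb.trans ?_
    have h0 := Finset.prod_nonneg fun i (_ : i ∈ domD D) => rowW_nonneg (C0 n k hk) β hβ1 (19 * a / 20) 0 le_rfl (D i) i
    refine mul_le_mul_of_nonneg_left ?_ (by positivity)
    rw [fC_C0]
    have := hbrk n a k (domD D).card (fk n k) ((n - R : ℕ) : ℝ) β z lam hz2 hzn
      (le_trans (by gcongr; rw [hCs]; linarith) hCA) (by rw [hCs] at hCa; linarith) ha1 hβ1 hβ3 hk0.le hkn'
      (by positivity) (by positivity) hfr hνn (by rw [hcast]; linarith [(Nat.cast_nonneg R : (0:ℝ) ≤ R)])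
      (by rw [hcast]; linarith) hlamb hlam0
    rw [← hRdef]
    push_cast at this ⊢
    exact this
  have hA := hRF ?_ P ((Real.exp (3 * δ0) + δ0) * Real.exp lam) (by positivity) hbr
  swap
  · calc (n:ℝ) * ((a:ℝ) + 1) = ((a:ℝ) + 1) * z ^ 100 := by rw [← hzn]; ring
      _ ≤ z * z ^ 100 := by
          have h1 := key 1 (by norm_num) (by rw [hCs]; linarith) 1 (by norm_num)
          rw [one_mul, pow_one] at h1
          gcongr
      _ = z ^ 101 := by ring
      _ ≤ z ^ 187 := pow_le_pow_right₀ (by linarith) (by norm_num)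
      _ ≤ _ := T1.trans (pow_le_pow_right₀ hβ1 (by omega))
  have hβa : 0 < β ^ a := by positivity
  have hW0 : (n:ℝ) ≤ ((a:ℝ) + 1) * β ^ a := by
    have h1 := key (4 * Kc) (by positivity) (by rw [hCs]; linarith) 1 (by norm_num)
    rw [pow_one] at h1
    have h2 : (2 * Kc * a) * (n:ℝ) ≤ (2 * Kc * a) * (a * β ^ a) := by
      calc (2 * Kc * a) * (n:ℝ) ≤ n * n := by
            gcongr
            have : 0 ≤ Kc * a := by positivity
            linarith
        _ = (n:ℝ) ^ 2 := by ring
        _ ≤ _ := G1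
        _ = _ := by ring
    have h3 := le_of_mul_le_mul_left h2 (by positivity)
    linarith
  have hWL : ((a:ℝ) + 1) * β ^ a ≤ (n:ℝ) ^ 2 := by
    have h2 : (a:ℝ) * (((a:ℝ) + 1) * β ^ a) ≤ a * (n:ℝ) ^ 2 := by
      calc (a:ℝ) * (((a:ℝ) + 1) * β ^ a) ≤ (a:ℝ) * ((a + a) * β ^ a) := by gcongr
        _ = 2 * ((a:ℝ) ^ 2 * β ^ a) := by ring
        _ ≤ 2 * (2 * Kc * (n:ℝ) ^ 2) := by gcongr
        _ = (4 * Kc) * (n:ℝ) ^ 2 := by ring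
        _ ≤ a * (n:ℝ) ^ 2 := by
            gcongr
            rw [hCs] at hCa
            linarith
    exact le_of_mul_le_mul_left h2 (by positivity)
  have hV := hhV ?_ ?_
  rotate_left
  · have hb00 : 0 < b0 := by linarith
    have : β ^ fk n k ≤ b0 ^ fk n k * Real.exp (3 * (a:ℝ) ^ 2 * b) := by
      calc β ^ fk n k ≤ (b0 * Real.exp (6 * a * b / n)) ^ fk n k := by gcongr
        _ = b0 ^ fk n k * Real.exp (fk n k * (6 * a * b / n)) := by
            rw [mul_pow, ← Real.exp_nat_mul]
        _ ≤ _ := by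
            refine mul_le_mul_of_nonneg_left (Real.exp_le_exp.2 ?_) (by positivity)
            calc (fk n k : ℝ) * (6 * a * b / n) = (2 * (fk n k : ℝ)) * (3 * a * b / n) := by ring
              _ ≤ (n * a) * (3 * a * b / n) := by gcongr
              _ = _ := by field_simp
    calc β ^ fk n k * (Dk n k : ℝ) ≤ b0 ^ fk n k * Real.exp (3 * (a:ℝ) ^ 2 * b) * (Dk n k : ℝ) := by gcongr
      _ = ((Dk n k : ℝ) * b0 ^ fk n k) * Real.exp (3 * (a:ℝ) ^ 2 * b) := by ring
      _ ≤ _ := by gcongr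
  · have h1 := key (3 * b + 2) (by positivity) (by rw [hCs]; linarith) 2 (by norm_num)
    have h2 : 3 * (a:ℝ) ^ 2 * b ≤ 3 * ((a:ℝ) + 1) ^ 2 * b := by gcongr; linarith
    have h3 : 1 + Real.log n ≤ 2 * ((a:ℝ) + 1) ^ 2 := by
      have q1 := mul_nonneg hε.le hL0
      have q2 : (a:ℝ) + 1 ≤ ((a:ℝ) + 1) ^ 2 := le_self_pow₀ (by linarith) (by norm_num)
      linarith
    linarith
  have hlogn : Real.log ((1:ℝ) / n) = - Real.log n := by rw [one_div, Real.log_inv]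
  have hqs : 2 * Real.log ((a:ℝ) + 1) + 7 + 4 / η ≤ c * Real.log n := by
    have : Real.log ((a:ℝ) + 1) ≤ Real.log (Ku * Real.log n + 1) :=
      Real.log_le_log (by positivity) (by linarith)
    linarith
  have hcl1 : c * Real.log n ≤ ε / 2 * Real.log n := by gcongr; exact min_le_left _ _
  have hcl2 : c * Real.log n ≤ ε0 * Real.log n := by gcongr; exact min_le_right _ _
  have hη4 : 0 < 4 / η := by positivity
  have haL : (1 + ε) * Real.log n ≤ a - Real.log n := by linarith
  have hη1 : 1 - η = (1 + ε / 2) / (1 + ε) := by rw [hη]; field_simp; ring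
  have hεL := mul_nonneg hε.le hL0
  have hS := sumI k n a ε0 η (2 * Real.log ((a:ℝ) + 1) + 3 + 4) (1 / n) hk hη0 (by positivity) (by linarith)
    (by
      rw [hlogn]
      have h1 : (1 + ε / 2) * Real.log n ≤ (1 - η) * (a - Real.log n) := by
        rw [hη1]
        calc (1 + ε / 2) * Real.log n = (1 + ε / 2) / (1 + ε) * ((1 + ε) * Real.log n) := by field_simp
          _ ≤ _ := by gcongr
      linarith)
    (by
      have h1 : ε0 * Real.log n ≤ ε0 * (a - Real.log n) := by gcongr; linarith
      linarith) _ P hP (htI hW0 hWL hV)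
  refine hA.trans ?_
  have hS2 : (1 + 1 / (n:ℝ)) ^ k + Real.exp (-2 * k) ≤ Real.exp δ0 + δ0 := by
    have s1 : (1 + 1 / (n:ℝ)) ^ k ≤ Real.exp δ0 := by
      calc (1 + 1 / (n:ℝ)) ^ k ≤ (Real.exp (1 / n)) ^ k := by
            gcongr
            have := Real.add_one_le_exp (1 / (n:ℝ))
            linarith
        _ = Real.exp (k * (1 / n)) := by rw [← Real.exp_nat_mul]
        _ ≤ Real.exp δ0 := by
            refine Real.exp_le_exp.2 ?_
            have h1 : 1 / δ0 ≤ a := by rw [hCs] at hCa; linarith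
            rw [div_le_iff₀ hδ0] at h1
            have h2 : (k:ℝ) * 1 ≤ k * (a * δ0) := by gcongr
            have h3 : (k:ℝ) * a * δ0 ≤ n * δ0 := by gcongr
            rw [mul_one_div, div_le_iff₀ hn0]
            linarith
    have s2 : Real.exp (-2 * k) ≤ δ0 := by
      have h1 : 1 / δ0 ≤ k := by rw [hCs] at hCz; linarith
      have h2 : (k:ℝ) ≤ Real.exp (2 * k) := by
        have := Real.add_one_le_exp (2 * (k:ℝ))
        linarith
      rw [show -2 * (k:ℝ) = -(2 * k) by ring, Real.exp_neg]
      rw [one_div] at h1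
      exact inv_le_of_inv_le₀ hδ0 (h1.trans h2)
    linarith
  calc (n.factorial : ℝ) * ((Real.exp (3 * δ0) + δ0) * Real.exp lam) * _
      ≤ (n.factorial : ℝ) * ((Real.exp (3 * δ0) + δ0) * Real.exp lam) * (Real.exp δ0 + δ0) := by
        refine mul_le_mul_of_nonneg_left (hS.trans hS2) (by positivity)
    _ = (n.factorial : ℝ) * (((Real.exp (3 * δ0) + δ0) * (Real.exp δ0 + δ0)) * Real.exp lam) := by ring
    _ ≤ _ := by gcongr

theorem exp_neg_lt (n : ℕ) (hn : 9 ≤ n) : (1 / Real.exp 1) ^ n < 1 / (n:ℝ) ^ 2 := by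
  have hn0 : (9:ℝ) ≤ n := by exact_mod_cast hn
  rw [one_div_pow, ← Real.exp_nat_mul, mul_one]
  refine one_div_lt_one_div_of_lt (by positivity) ?_
  have h := Real.pow_div_factorial_le_exp (n:ℝ) (by positivity) 3
  have h2 : (n:ℝ) ^ 3 / (Nat.factorial 3 : ℕ) = n ^ 2 * (n / 6) := by
    simp [Nat.factorial]; ring
  rw [h2] at h
  refine lt_of_lt_of_le ?_ h
  have : (n:ℝ) ^ 2 * 1 < n ^ 2 * (n / 6) := by
    refine mul_lt_mul_of_pos_left ?_ (by positivity)
    linarith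
  linarith

/-- scale of classes from the first moment: upper bound -/
theorem fm_upper (n m k : ℕ) (b b0 : ℝ) (hn : 9 ≤ n) (hk : 0 < k) (hkn : k ≤ n) (hm0 : 0 < m) (hm : m < n.choose 2)
    (hb0 : b0 = 1 / gq (n.choose 2) m 0) (hb01 : 1 ≤ b0) (hb : 1 ≤ b) (hbb : b ≤ b0 * Real.exp (b / n))
    (hE : 1 / (n:ℝ) ^ 2 ≤ Ebar n m k) :
    ((n / k : ℕ):ℝ) ^ 2 * b ^ (n / k) ≤ (b * Real.exp b * Real.exp 4) * (n:ℝ) ^ 2 := by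
  have hg : 0 < gq (n.choose 2) m 0 := gq_pos (by omega)
  have hn0 : (0:ℝ) < n := by exact_mod_cast (by omega : 0 < n)
  set s := Real.sqrt b0 with hs
  have hs2 : s ^ 2 = b0 := Real.sq_sqrt (by linarith)
  have hs1 : 1 ≤ s := by rw [hs, Real.one_le_sqrt]; exact hb01
  have hU := Ebar_upper n m k hk hkn hm0 hm s hs1 (by rw [hs2, hb0]; field_simp)
  have ha1 : 1 ≤ n / k := (Nat.one_le_div_iff hk).2 hkn
  have han : n / k ≤ n := Nat.div_le_self n k
  set a := n / k with ha
  have ha0 : (0:ℝ) < a := by exact_mod_cast ha1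
  have han' : (a:ℝ) ≤ n := by exact_mod_cast han
  have hs0 : 0 < s := by linarith
  have hlt : (a:ℝ) * s ^ (a - 1) < Real.exp 2 * n := by
    by_contra hcon
    push Not at hcon
    have : (n * Real.exp 1 / (a * s ^ (a - 1))) ^ n ≤ (1 / Real.exp 1) ^ n := by
      refine pow_le_pow_left₀ (by positivity) ?_ n
      rw [div_le_div_iff₀ (by positivity) (by positivity)]
      have e2 : Real.exp 2 = Real.exp 1 * Real.exp 1 := by rw [← Real.exp_add]; norm_num
      rw [e2] at hcon
      linarith
    have h3 := exp_neg_lt n hn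
    linarith
  have hsq : ((a:ℝ) * s ^ (a - 1)) ^ 2 ≤ (Real.exp 2 * n) ^ 2 := by gcongr
  have e1 : ((a:ℝ) * s ^ (a - 1)) ^ 2 = (a:ℝ) ^ 2 * b0 ^ (a - 1) := by
    rw [mul_pow, ← pow_mul, mul_comm (a - 1) 2, pow_mul, hs2]
  have e2 : (Real.exp 2 * n) ^ 2 = Real.exp 4 * (n:ℝ) ^ 2 := by
    rw [mul_pow, ← Real.exp_nat_mul]; norm_num
  rw [e1, e2] at hsq
  have hba : b ^ (a - 1) ≤ b0 ^ (a - 1) * Real.exp b := by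
    calc b ^ (a - 1) ≤ (b0 * Real.exp (b / n)) ^ (a - 1) := by gcongr
      _ = b0 ^ (a - 1) * Real.exp (((a - 1 : ℕ):ℝ) * (b / n)) := by rw [mul_pow, ← Real.exp_nat_mul]
      _ ≤ _ := by
          refine mul_le_mul_of_nonneg_left (Real.exp_le_exp.2 ?_) (by positivity)
          have h1 : ((a - 1 : ℕ):ℝ) ≤ n := by
            have : a - 1 ≤ n := by omega
            exact_mod_cast this
          calc ((a - 1 : ℕ):ℝ) * (b / n) ≤ n * (b / n) := by gcongr
            _ = b := by field_simp
  have hb' : b ^ a = b ^ (a - 1) * b := by rw [← pow_succ]; congr 1; omega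
  rw [hb']
  calc (a:ℝ) ^ 2 * (b ^ (a - 1) * b) ≤ (a:ℝ) ^ 2 * (b0 ^ (a - 1) * Real.exp b * b) := by gcongr
    _ = (b * Real.exp b) * ((a:ℝ) ^ 2 * b0 ^ (a - 1)) := by ring
    _ ≤ (b * Real.exp b) * (Real.exp 4 * (n:ℝ) ^ 2) := by gcongr
    _ = _ := by ring

/-- the first moment is at least one a bit above -/
theorem fm_lower_fin (n m k A : ℕ) (b : ℝ) (hk : 0 < k) (hkn : k ≤ n) (hA : A = n / k) (hA1 : 1 ≤ A) (hb : 1 ≤ b)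
    (h : 2 * fk n k + m < n.choose 2) (hbp0 : 0 < bp n m k) (hbp : bp n m k ≤ b * Real.exp (6 * A * b / n))
    (hAL : Real.log n ≤ A) (hA2 : 3 * (A:ℝ) ^ 2 * b ≤ n) (hAb : 4 * ((A:ℝ) ^ 2 * b ^ A) ≤ Real.exp (-6) * (n:ℝ) ^ 2) :
    1 ≤ Ebar n m k := by
  have hL := Ebar_lower n m k hk h
  have hfk := fk_le n k hk
  have hkan : k * (n / k) ≤ n := Nat.mul_div_le n k
  rw [← hA] at hL hfk hkan
  have hn0 : (0:ℝ) < n := by exact_mod_cast (by omega : 0 < n)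
  have hk0 : (0:ℝ) < k := by exact_mod_cast hk
  have hA0 : (1:ℝ) ≤ A := by exact_mod_cast hA1
  have hfr : 2 * (fk n k : ℝ) ≤ n * A := by exact_mod_cast hfk
  have hkan' : (k:ℝ) * A ≤ n := by exact_mod_cast hkan
  have hkn' : (k:ℝ) ≤ n := by exact_mod_cast hkn
  set t := Real.sqrt b with ht
  have ht2 : t ^ 2 = b := Real.sq_sqrt (by linarith)
  have ht1 : 1 ≤ t := by rw [ht, Real.one_le_sqrt]; exact hb
  have ht0 : 0 < t := by linarith
  have q1 : (k:ℝ) ^ k ≤ Real.exp 1 ^ n := by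
    calc (k:ℝ) ^ k ≤ (n:ℝ) ^ k := by gcongr
      _ = Real.exp (k * Real.log n) := by rw [← Real.log_pow, Real.exp_log (by positivity)]
      _ ≤ Real.exp n := by
          refine Real.exp_le_exp.2 (le_trans ?_ hkan')
          gcongr
      _ = _ := by rw [← Real.exp_nat_mul, mul_one]
  have q2 : bp n m k ^ fk n k ≤ (t ^ A) ^ n * Real.exp 1 ^ n := by
    calc bp n m k ^ fk n k ≤ (b * Real.exp (6 * A * b / n)) ^ fk n k := by gcongr
      _ = b ^ fk n k * Real.exp (fk n k * (6 * A * b / n)) := by rw [mul_pow, ← Real.exp_nat_mul]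
      _ ≤ (t ^ A) ^ n * Real.exp n := by
          refine mul_le_mul ?_ (Real.exp_le_exp.2 ?_) (by positivity) (by positivity)
          · rw [← ht2, ← pow_mul, ← pow_mul]
            exact pow_le_pow_right₀ ht1 (by rw [mul_comm A n]; exact hfk)
          · calc (fk n k : ℝ) * (6 * A * b / n) = (2 * (fk n k : ℝ)) * (3 * A * b / n) := by ring
              _ ≤ (n * A) * (3 * A * b / n) := by gcongr
              _ = 3 * (A:ℝ) ^ 2 * b := by field_simp
              _ ≤ n := hA2
      _ = _ := by rw [← Real.exp_nat_mul, mul_one]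
  have q3 : ((A:ℝ) + 1) * t ^ A ≤ n * Real.exp (-3) := by
    refine le_of_sq_le_sq ?_ (by positivity)
    calc (((A:ℝ) + 1) * t ^ A) ^ 2 ≤ (((A:ℝ) + A) * t ^ A) ^ 2 := by gcongr
      _ = 4 * ((A:ℝ) ^ 2 * b ^ A) := by
          rw [← ht2, ← pow_mul, mul_comm 2 A, pow_mul]; ring
      _ ≤ _ := hAb
      _ = _ := by rw [mul_pow, ← Real.exp_nat_mul]; norm_num; ring
  have q4 : ((A:ℝ) + 1) ^ n * (k:ℝ) ^ k * bp n m k ^ fk n k ≤ (n / Real.exp 1) ^ n := by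
    calc ((A:ℝ) + 1) ^ n * (k:ℝ) ^ k * bp n m k ^ fk n k
        ≤ ((A:ℝ) + 1) ^ n * Real.exp 1 ^ n * ((t ^ A) ^ n * Real.exp 1 ^ n) := by gcongr
      _ = (((A:ℝ) + 1) * t ^ A * (Real.exp 1 * Real.exp 1)) ^ n := by
          rw [mul_pow, mul_pow, mul_pow]; ring
      _ ≤ (n * Real.exp (-3) * (Real.exp 1 * Real.exp 1)) ^ n := by gcongr
      _ = _ := by
          congr 1
          rw [mul_assoc, ← Real.exp_add, ← Real.exp_add, div_eq_mul_inv, ← Real.exp_neg]; norm_num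
  have hX : 0 < (n / Real.exp 1) ^ n := by positivity
  have hE0 : 0 ≤ Ebar n m k := by
    by_contra hcon
    push Not at hcon
    have : Ebar n m k * (((A:ℝ) + 1) ^ n * (k:ℝ) ^ k * bp n m k ^ fk n k) ≤ 0 :=
      mul_nonpos_of_nonpos_of_nonneg hcon.le (by positivity)
    linarith
  have h5 : 1 * (n / Real.exp 1) ^ n ≤ Ebar n m k * (n / Real.exp 1) ^ n := by
    rw [one_mul]
    exact hL.trans (mul_le_mul_of_nonneg_left q4 hE0)
  exact le_of_mul_le_mul_right h5 hX

theorem fact_beats (c K4 : ℝ) (hc : 0 < c) : ∃ a0 : ℕ, ∀ a : ℕ, a0 ≤ a →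
    Real.exp (K4 * a) ≤ Real.exp (-a) * ((c / 2) ^ (a + 1) * ((a - 1).factorial : ℕ)) := by
  set D := Real.exp (K4 + 1) * (2 / c) with hD
  have hD0 : 0 < D := by positivity
  have h := FloorSemiring.tendsto_pow_div_factorial_atTop D
  have hE := h.eventually (eventually_le_nhds (show (0:ℝ) < 1 / (D * (2 / c)) by positivity))
  obtain ⟨a0, ha0⟩ := eventually_atTop.1 hE
  refine ⟨a0 + 1, fun a ha => ?_⟩
  obtain ⟨e, rfl⟩ : ∃ e, a = e + 1 := ⟨a - 1, by omega⟩
  have h1 := ha0 e (by omega)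
  rw [div_le_div_iff₀ (by positivity) (by positivity), one_mul] at h1
  simp only [Nat.add_sub_cancel]
  have h2 : D ^ (e + 1) * (c / 2) ^ (e + 1) = Real.exp (K4 * (e + 1 : ℕ)) * Real.exp ((e + 1 : ℕ)) := by
    rw [← mul_pow, hD]
    have : Real.exp (K4 + 1) * (2 / c) * (c / 2) = Real.exp (K4 + 1) := by field_simp
    rw [this, ← Real.exp_nat_mul, ← Real.exp_add]; congr 1; ring
  have h3 : Real.exp (K4 * (e + 1 : ℕ)) = Real.exp (-((e + 1 : ℕ):ℝ)) * (D ^ (e + 1) * (c / 2) ^ (e + 1)) := by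
    rw [h2, Real.exp_neg]; field_simp
  rw [h3]
  refine mul_le_mul_of_nonneg_left ?_ (by positivity)
  calc D ^ (e + 1) * (c / 2) ^ (e + 1) = (D ^ e * (D * (2 / c))) * (c / 2) ^ (e + 1 + 1) := by
        rw [pow_succ D, pow_succ (c / 2) (e + 1)]; field_simp
    _ ≤ (e.factorial : ℝ) * (c / 2) ^ (e + 1 + 1) := by gcongr
    _ = _ := by ring

theorem gmono (b : ℝ) (hb : 1 ≤ b) {x y : ℕ} (h : x ≤ y) : (x:ℝ) ^ 2 * b ^ x ≤ (y:ℝ) ^ 2 * b ^ y := by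
  have : (x:ℝ) ≤ y := by exact_mod_cast h
  have h2 := pow_le_pow_right₀ hb h
  gcongr

set_option maxHeartbeats 1000000 in
theorem fm_lower (p b c : ℝ) (hp0 : 0 < p) (hp1 : p < 1) (hb : b = 1 / (1 - p)) (hb1 : 1 < b) (hbe : b < Real.exp 1)
    (hc : c = Real.exp (-6) / 4) :
    ∀ᶠ n : ℕ in atTop, ∃ k : ℕ, 0 < k ∧ k ≤ n ∧ 1 ≤ Ebar n (mFloor p n) k ∧
      (n:ℝ) ^ 2 ≤ 4 * b / c * (((n / k : ℕ):ℝ) ^ 2 * b ^ (n / k)) := by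
  have hc0 : 0 < c := by rw [hc]; positivity
  have hc1 : c < 1 := by
    rw [hc]
    have : Real.exp (-6) ≤ 1 := Real.exp_le_one_iff.2 (by norm_num)
    linarith
  have hq : 0 < 1 - p := by linarith
  obtain ⟨ε, hε, hlow⟩ := scale_low b (4 * b / c) hb1 hbe (by positivity)
  obtain ⟨K, hK, hup⟩ := scale_up b c hb1 hc0
  have hsm := log_pow_le K (3 * b + 100 / (1 - p))
  have hbb := base_b p hp0 hp1
  rw [← hb] at hbb
  have hbig : ∀ᶠ n : ℕ in atTop, b / c ≤ (n:ℝ) := tendsto_natCast_atTop_atTop.eventually_ge_atTop _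
  filter_upwards [hlow, hup, hsm, hbb, hbig, eventually_ge_atTop 9] with n hlow hup hsm hbb hbig hn
  obtain ⟨hb1', hb2', hb3', hbk⟩ := hbb
  have hn9 : (9:ℝ) ≤ n := by exact_mod_cast hn
  have hn0 : (0:ℝ) < n := by linarith
  set A := Nat.findGreatest (fun A : ℕ => (A:ℝ) ^ 2 * b ^ A ≤ c * (n:ℝ) ^ 2) n with hA
  have hP1 : ((1:ℕ):ℝ) ^ 2 * b ^ 1 ≤ c * (n:ℝ) ^ 2 := by
    rw [div_le_iff₀ hc0] at hbig
    have : c * (n:ℝ) ≤ c * (n:ℝ) ^ 2 := by gcongr; exact le_self_pow₀ (by linarith) (by norm_num)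
    simp only [Nat.cast_one, one_pow, pow_one, one_mul]
    linarith
  have hA1 : 1 ≤ A := Nat.le_findGreatest (by omega) hP1
  have hPA : (A:ℝ) ^ 2 * b ^ A ≤ c * (n:ℝ) ^ 2 :=
    Nat.findGreatest_spec (P := fun A : ℕ => (A:ℝ) ^ 2 * b ^ A ≤ c * (n:ℝ) ^ 2) (by omega : 1 ≤ n) hP1
  have hAn : A ≤ n := Nat.findGreatest_le n
  have hA0 : (1:ℝ) ≤ A := by exact_mod_cast hA1
  have hAlt : A < n := by
    rcases lt_or_eq_of_le hAn with h | h
    · exact h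
    · exfalso
      rw [h] at hPA
      have h1 : (1:ℝ) ≤ b ^ n := one_le_pow₀ hb1.le
      have h2 : (n:ℝ) ^ 2 * 1 ≤ (n:ℝ) ^ 2 * b ^ n := by gcongr
      have h3 : c * (n:ℝ) ^ 2 < 1 * (n:ℝ) ^ 2 := by gcongr
      linarith
  have hPA1 : c * (n:ℝ) ^ 2 < ((A + 1 : ℕ):ℝ) ^ 2 * b ^ (A + 1) := by
    have := Nat.findGreatest_is_greatest (P := fun A : ℕ => (A:ℝ) ^ 2 * b ^ A ≤ c * (n:ℝ) ^ 2) (n := n) (k := A + 1)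
      (by rw [← hA]; omega) (by omega)
    push Not at this
    exact this
  have hA4 : (n:ℝ) ^ 2 ≤ 4 * b / c * ((A:ℝ) ^ 2 * b ^ A) := by
    have h1 : ((A + 1 : ℕ):ℝ) ^ 2 * b ^ (A + 1) ≤ 4 * b * ((A:ℝ) ^ 2 * b ^ A) := by
      calc ((A + 1 : ℕ):ℝ) ^ 2 * b ^ (A + 1) ≤ ((A:ℝ) + A) ^ 2 * b ^ (A + 1) := by
            gcongr; push_cast; linarith
        _ = _ := by ring
    rw [div_mul_eq_mul_div, le_div_iff₀ hc0]
    linarith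
  have hAK := hup A hA1 hPA
  have hAL := hlow A hA1 hA4
  have hL0 : 0 ≤ Real.log n := Real.log_nonneg (by linarith)
  have hεL := mul_nonneg hε.le hL0
  have hroot : (n:ℝ) ^ (1 / 100 : ℝ) ≤ n := by
    calc (n:ℝ) ^ (1 / 100 : ℝ) ≤ (n:ℝ) ^ (1:ℝ) := Real.rpow_le_rpow_of_exponent_le (by linarith) (by norm_num)
      _ = n := Real.rpow_one _
  have hpd : 0 < 100 / (1 - p) := by positivity
  have key : ∀ c', 0 ≤ c' → c' ≤ 3 * b + 100 / (1 - p) → ∀ j : ℕ, j ≤ 20 → c' * (A:ℝ) ^ j ≤ n := by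
    intro c' h0 h1 j hj
    have : (A:ℝ) ^ j ≤ (K * Real.log n + 2) ^ 20 :=
      calc (A:ℝ) ^ j ≤ (A:ℝ) ^ 20 := pow_le_pow_right₀ hA0 hj
        _ ≤ _ := by gcongr; linarith
    have hpos : 0 ≤ (A:ℝ) ^ j := by positivity
    calc c' * (A:ℝ) ^ j ≤ (3 * b + 100 / (1 - p)) * (K * Real.log n + 2) ^ 20 := by gcongr
      _ ≤ n := hsm.trans hroot
  have hAA : A * A ≤ n := by
    have := key 1 (by norm_num) (by linarith) 2 (by norm_num)
    rw [one_mul, pow_two] at this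
    exact_mod_cast this
  have hk : 0 < n / A := Nat.div_pos hAn hA1
  have hAk : A ≤ n / A := (Nat.le_div_iff_mul_le hA1).2 hAA
  have hdiv : n / (n / A) = A := by
    have h1 : A * (n / A) ≤ n := Nat.mul_div_le n A
    have h2 : n < A * (n / A + 1) := Nat.lt_mul_div_succ n hA1
    refine Nat.div_eq_of_lt_le h1 ?_
    have h3 : A * (n / A + 1) = A * (n / A) + A := by ring
    have h4 : (A + 1) * (n / A) = A * (n / A) + n / A := by ring
    omega
  have h100 : ((n / (n / A) : ℕ) : ℝ) * 100 ≤ (1 - p) * n := by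
    rw [hdiv]
    have := key (100 / (1 - p)) hpd.le (by linarith) 1 (by norm_num)
    rw [div_mul_eq_mul_div, div_le_iff₀ hq, pow_one] at this
    linarith
  obtain ⟨k1, k2, k3, k4⟩ := hbk (n / A) hk h100
  refine ⟨n / A, hk, Nat.div_le_self n A, ?_, by rw [hdiv]; exact hA4⟩
  refine fm_lower_fin n (mFloor p n) (n / A) A b hk (Nat.div_le_self n A) hdiv.symm hA1 hb1.le k1 ?_ ?_ ?_ ?_ ?_
  · linarith
  · rw [hdiv] at k4
    refine (k3.trans k4).trans ?_
    gcongr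
  · linarith
  · have := key (3 * b) (by positivity) (by linarith) 2 (by norm_num)
    linarith
  · rw [hc] at hPA
    linarith

set_option maxHeartbeats 1000000 in
theorem fm_choice (p b : ℝ) (hp0 : 0 < p) (hp1 : p < 1) (hb : b = 1 / (1 - p)) (hb1 : 1 < b) (hbe : b < Real.exp 1) :
    ∃ Kc : ℝ, 1 ≤ Kc ∧ ∀ K4 : ℝ, 0 ≤ K4 → ∀ᶠ n : ℕ in atTop, ∃ K : ℕ, 0 < K ∧ K + 1 ≤ n ∧
      (∀ k, 0 < k → k < K → Ebar n (mFloor p n) k ≤ 1 / (n:ℝ) ^ 2) ∧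
      1 ≤ n / (K + 1) ∧ ((n / (K + 1) : ℕ):ℝ) * 100 ≤ (1 - p) * n ∧
      (n:ℝ) ^ 2 ≤ Kc * (((n / (K + 1) : ℕ):ℝ) ^ 2 * b ^ (n / (K + 1))) ∧
      ((n / (K + 1) : ℕ):ℝ) ^ 2 * b ^ (n / (K + 1)) ≤ Kc * (n:ℝ) ^ 2 ∧
      Real.exp (K4 * (n / (K + 1) : ℕ)) ≤ Ebar n (mFloor p n) (K + 1) := by
  have hq : 0 < 1 - p := by linarith
  set c0 := Real.exp (-6) / 4 with hc0d
  have hc0 : 0 < c0 := by rw [hc0d]; positivity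
  have hc01 : c0 ≤ 1 := by
    rw [hc0d]
    have : Real.exp (-6) ≤ 1 := Real.exp_le_one_iff.2 (by norm_num)
    linarith
  set K2 := 4 * b / c0 with hK2
  have hK21 : 1 ≤ K2 := by rw [hK2, le_div_iff₀ hc0]; linarith
  set K1 := b * Real.exp b * Real.exp 4 with hK1
  have hK10 : 0 < K1 := by positivity
  set Kc := 4 * b * K2 + K1 with hKc
  have hKK : K2 ≤ 4 * b * K2 := by
    calc K2 = 1 * K2 := by ring
      _ ≤ 4 * b * K2 := by gcongr; linarith
  have hKc1 : 1 ≤ Kc := by linarith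
  refine ⟨Kc, hKc1, fun K4 hK4 => ?_⟩
  obtain ⟨ε, hε, hlow⟩ := scale_low b K2 hb1 hbe (by positivity)
  obtain ⟨Ku, hKu, hup⟩ := scale_up b K1 hb1 hK10
  set c := Real.sqrt (1 / (K2 * Real.exp b)) with hcd
  have hcs : c ^ 2 = 1 / (K2 * Real.exp b) := Real.sq_sqrt (by positivity)
  have hcp : 0 < c := Real.sqrt_pos.2 (by positivity)
  have hc1 : c ≤ 1 := by
    rw [hcd, Real.sqrt_le_one, div_le_one (by positivity)]
    have h1 : 1 ≤ Real.exp b := Real.one_le_exp (by linarith)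
    calc (1:ℝ) = 1 * 1 := by ring
      _ ≤ _ := by gcongr
  obtain ⟨a0, ha0⟩ := fact_beats c K4 hcp
  have hsm := log_pow_le Ku (100 / (1 - p) + 1)
  have hbb := base_b p hp0 hp1
  rw [← hb] at hbb
  have hlog : Tendsto (fun n : ℕ => Real.log n) atTop atTop :=
    Real.tendsto_log_atTop.comp tendsto_natCast_atTop_atTop
  filter_upwards [hlow, hup, hsm, hbb, base_N p hp0 hp1, fm_lower p b c0 hp0 hp1 hb hb1 hbe rfl,
    hlog.eventually_ge_atTop (a0:ℝ), hlog.eventually_ge_atTop 2, eventually_ge_atTop 9] with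
    n hlow hup hsm hbb hbN hfl hLa hL2 hn
  obtain ⟨hb1', hb2', hb3', hbk⟩ := hbb
  obtain ⟨hN1, hN2, hN3, hm0, hmN, _, _, _⟩ := hbN
  obtain ⟨k2, hk20, hk2n, hE2, hk2s⟩ := hfl
  have hn9 : (9:ℝ) ≤ n := by exact_mod_cast hn
  have hn0 : (0:ℝ) < n := by linarith
  set m := mFloor p n with hm
  have hle1 : 1 / (n:ℝ) ^ 2 ≤ 1 := by
    rw [div_le_one (by positivity)]
    exact one_le_pow₀ (by linarith)
  have hex : ∃ k, 0 < k ∧ 1 / (n:ℝ) ^ 2 ≤ Ebar n m k := ⟨k2, hk20, hle1.trans hE2⟩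
  set K := Nat.find hex with hK
  obtain ⟨hK0, hKE⟩ : 0 < K ∧ 1 / (n:ℝ) ^ 2 ≤ Ebar n m K := Nat.find_spec hex
  have hKk2 : K ≤ k2 := Nat.find_min' hex ⟨hk20, hle1.trans hE2⟩
  have hmin : ∀ k, 0 < k → k < K → Ebar n m k ≤ 1 / (n:ℝ) ^ 2 := by
    intro k hk0 hkK
    have := Nat.find_min hex hkK
    push Not at this
    exact (this hk0).le
  have hKn : K ≤ n := hKk2.trans hk2n
  have hU := fm_upper n m K b _ hn hK0 hKn hm0 hmN rfl hb3' hb1.le hb1' hKE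
  have ha1 : 1 ≤ n / K := (Nat.one_le_div_iff hK0).2 hKn
  have hlowa : (n:ℝ) ^ 2 ≤ K2 * (((n / K : ℕ):ℝ) ^ 2 * b ^ (n / K)) := by
    refine hk2s.trans ?_
    have := gmono b hb1.le (Nat.div_le_div_left hKk2 hK0 : n / k2 ≤ n / K)
    gcongr
  have hkan : K * (n / K) ≤ n := Nat.mul_div_le n K
  have hkan1 : n < K * (n / K + 1) := Nat.lt_mul_div_succ n hK0
  have hmono : n / (K + 1) ≤ n / K := Nat.div_le_div_left (by omega) hK0
  have hJ := jump n m K (n / K) hK0 rfl ha1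
  have hbkK := hbk K hK0
  set a := n / K with ha
  have haL := hlow a ha1 hlowa
  have haK := hup a ha1 hU
  have hL0 : 0 ≤ Real.log n := by linarith
  have hεL := mul_nonneg hε.le hL0
  have ha1' : (1:ℝ) ≤ a := by exact_mod_cast ha1
  have ha2 : 2 ≤ a := by
    have : (2:ℝ) ≤ a := by linarith
    exact_mod_cast this
  have haa0 : a0 ≤ a := by
    have : (a0:ℝ) ≤ a := by linarith
    exact_mod_cast this
  have hroot : (n:ℝ) ^ (1 / 100 : ℝ) ≤ n := by
    calc (n:ℝ) ^ (1 / 100 : ℝ) ≤ (n:ℝ) ^ (1:ℝ) := Real.rpow_le_rpow_of_exponent_le (by linarith) (by norm_num)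
      _ = n := Real.rpow_one _
  have hpd : 0 < 100 / (1 - p) := by positivity
  have key : ∀ c', 0 ≤ c' → c' ≤ 100 / (1 - p) + 1 → ∀ j : ℕ, j ≤ 20 → c' * ((a:ℝ) + 1) ^ j ≤ n := by
    intro c' h0 h1 j hj
    have : ((a:ℝ) + 1) ^ j ≤ (Ku * Real.log n + 2) ^ 20 :=
      calc ((a:ℝ) + 1) ^ j ≤ ((a:ℝ) + 1) ^ 20 := pow_le_pow_right₀ (by linarith) hj
        _ ≤ _ := by gcongr <;> linarith
    have hpos : 0 ≤ ((a:ℝ) + 1) ^ j := by positivity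
    calc c' * ((a:ℝ) + 1) ^ j ≤ (100 / (1 - p) + 1) * (Ku * Real.log n + 2) ^ 20 := by gcongr
      _ ≤ n := hsm.trans hroot
  have ha13 : (a + 1) ^ 3 ≤ n := by
    have := key 1 (by norm_num) (by linarith) 3 (by norm_num)
    rw [one_mul] at this
    exact_mod_cast this
  have haK' : a ≤ K := by
    by_contra hcon
    push Not at hcon
    have h1 : K * (a + 1) ≤ (a + 1) * (a + 1) := Nat.mul_le_mul_right _ (by omega)
    have h2 : (a + 1) * (a + 1) ≤ (a + 1) ^ 3 := by
      calc (a + 1) * (a + 1) = (a + 1) ^ 2 := by ring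
        _ ≤ (a + 1) ^ 3 := Nat.pow_le_pow_right (by omega) (by norm_num)
    omega
  have ha3 : a ^ 3 ≤ n := (Nat.pow_le_pow_left (by omega) 3).trans ha13
  have h100a : (a:ℝ) * 100 ≤ (1 - p) * n := by
    have := key (100 / (1 - p)) hpd.le (by linarith) 1 (by norm_num)
    rw [div_mul_eq_mul_div, div_le_iff₀ hq, pow_one] at this
    linarith
  obtain ⟨k1, -, -, -⟩ := hbkK h100a
  have hKn1 : K + 1 ≤ n := by
    have : K * 2 ≤ K * a := Nat.mul_le_mul_left _ ha2
    omega
  have ha' : a - 1 ≤ n / (K + 1) := by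
    rw [Nat.le_div_iff_mul_le (by omega)]
    obtain ⟨e, he⟩ : ∃ e, a = e + 1 := ⟨a - 1, by omega⟩
    rw [he] at hkan haK' ⊢
    simp only [Nat.add_sub_cancel]
    have e1 : e * (K + 1) = e * K + e := by ring
    have e2 : K * (e + 1) = e * K + K := by ring
    omega
  set a' := n / (K + 1) with ha'd
  have ha'a : (a':ℝ) ≤ a := by exact_mod_cast hmono
  have ha'1 : 1 ≤ a' := by omega
  have ha'a2 : (a:ℝ) ≤ 2 * a' := by
    have : a ≤ 2 * a' := by omega
    exact_mod_cast this
  refine ⟨K, hK0, hKn1, hmin, ha'1, ?_, ?_, ?_, ?_⟩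
  · linarith
  · refine hlowa.trans ?_
    have h1 : b ^ a ≤ b ^ a' * b := by
      rw [← pow_succ]; exact pow_le_pow_right₀ hb1.le (by omega)
    calc K2 * ((a:ℝ) ^ 2 * b ^ a) ≤ K2 * ((2 * (a':ℝ)) ^ 2 * (b ^ a' * b)) := by gcongr
      _ = (4 * b * K2) * ((a':ℝ) ^ 2 * b ^ a') := by ring
      _ ≤ Kc * ((a':ℝ) ^ 2 * b ^ a') := by gcongr; linarith
  · refine (gmono b hb1.le hmono).trans (hU.trans ?_)
    gcongr
    have : 0 ≤ 4 * b * K2 := by positivity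
    linarith
  · -- jump
    set b0 := 1 / gq (n.choose 2) m 0 with hb0
    have hg : 0 < gq (n.choose 2) m 0 := gq_pos (by omega)
    set s := Real.sqrt b0 with hs
    have hs2 : s ^ 2 = b0 := Real.sq_sqrt (by linarith)
    have hs1 : 1 ≤ s := by rw [hs, Real.one_le_sqrt]; exact hb3'
    have hs0 : 0 < s := by linarith
    have hb00 : 0 < b0 := by linarith
    have han : (a:ℝ) ≤ n := by
      have : a ≤ n := Nat.div_le_self n K
      exact_mod_cast this
    have hba : b ^ a ≤ b0 ^ a * Real.exp b := by
      calc b ^ a ≤ (b0 * Real.exp (b / n)) ^ a := by gcongr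
        _ = b0 ^ a * Real.exp ((a:ℝ) * (b / n)) := by rw [mul_pow, ← Real.exp_nat_mul]
        _ ≤ _ := by
            refine mul_le_mul_of_nonneg_left (Real.exp_le_exp.2 ?_) (by positivity)
            calc (a:ℝ) * (b / n) ≤ n * (b / n) := by gcongr
              _ = b := by field_simp
    have hcn : c * n ≤ a * s ^ a := by
      refine le_of_sq_le_sq ?_ (by positivity)
      rw [mul_pow, mul_pow, hcs, ← pow_mul, mul_comm a 2, pow_mul, hs2, div_mul_eq_mul_div, one_mul,
        div_le_iff₀ (by positivity)]
      calc (n:ℝ) ^ 2 ≤ K2 * ((a:ℝ) ^ 2 * b ^ a) := hlowa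
        _ ≤ K2 * ((a:ℝ) ^ 2 * (b0 ^ a * Real.exp b)) := by gcongr
        _ = _ := by ring
    have hJ2 := hJ haK' ha3 (by omega) s c hs1 (by rw [hs2, hb0]; field_simp) hcp hc1 hcn
    refine le_trans ?_ hJ2
    have h1 := ha0 a haa0
    calc Real.exp (K4 * a') ≤ Real.exp (K4 * a) := by
          refine Real.exp_le_exp.2 ?_
          gcongr
      _ ≤ Real.exp (-a) * ((c / 2) ^ (a + 1) * ((a - 1).factorial : ℕ)) := h1
      _ ≤ Ebar n m K * ((c / 2) ^ (a + 1) * ((a - 1).factorial : ℕ)) := by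
          refine mul_le_mul_of_nonneg_right (le_trans ?_ hKE) (by positivity)
          rw [Real.exp_neg, ← one_div]
          refine one_div_le_one_div_of_le (by positivity) ?_
          calc (n:ℝ) ^ 2 = Real.exp (2 * Real.log n) := by
                rw [two_mul, Real.exp_add, Real.exp_log hn0]; ring
            _ ≤ _ := Real.exp_le_exp.2 (by linarith)

/-- the second moment sum for a fixed `n` -/
theorem second_moment_bound (n m k : ℕ) (hk : 0 < k) (δ b0 X ε0 : ℝ) (cut : ℕ)
    (h2 : 2 * fk n k + m < n.choose 2) (hm0 : 0 < m)
    (hb0 : b0 = 1 / gq (n.choose 2) m 0) (hbp : 0 < bp n m k)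
    (h1 : ∑ σ ∈ Finset.univ.filter (fun σ : Equiv.Perm (Fin n) =>
        ε0 * k ≤ (k:ℝ) - (((domD (dat (C0 n k hk) cut σ)).card : ℕ) : ℝ)),
        bB n m k ^ sC (C0 n k hk) σ ≤
      (n.factorial : ℝ) * ((1 + δ) * Real.exp ((b0 - 1) * (fk n k : ℝ) ^ 2 / (n.choose 2 : ℕ))))
    (h3 : ∑ σ ∈ Finset.univ.filter (fun σ : Equiv.Perm (Fin n) =>
        ¬ (ε0 * k ≤ (k:ℝ) - (((domD (dat (C0 n k hk) cut σ)).card : ℕ) : ℝ))),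
        bp n m k ^ sC (C0 n k hk) σ ≤ bp n m k ^ fk n k * Dk n k * X)
    (hX : X ≤ δ * Ebar n m k) :
    (∑ σ : Equiv.Perm (Fin n), Rk n m k (sC (C0 n k hk) σ)) ≤ (1 + 2 * δ) * n.factorial := by
  have hs : ∀ σ, sC (C0 n k hk) σ ≤ fk n k := fun σ => by
    have := sC_le (C0 n k hk) σ
    rwa [fC_C0] at this
  have hN : (m:ℝ) < (n.choose 2 : ℕ) := by exact_mod_cast (by omega : m < n.choose 2)
  have hm0' : (0:ℝ) < m := by exact_mod_cast hm0
  have hPk : 0 < Pk n m k := by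
    unfold Pk
    have a1 : 0 < (n.choose 2 - fk n k).choose m := choose_pos' (by omega)
    have a2 : 0 < (n.choose 2).choose m := Nat.choose_pos (by omega)
    have a1' : (0:ℝ) < ((n.choose 2 - fk n k).choose m : ℕ) := by exact_mod_cast a1
    have a2' : (0:ℝ) < ((n.choose 2).choose m : ℕ) := by exact_mod_cast a2
    positivity
  have hDk : (0:ℝ) < Dk n k := by exact_mod_cast Dk_pos n k
  have hf : (0:ℝ) < n.factorial := by exact_mod_cast n.factorial_pos
  have hmu : mu n m k * fk n k = (b0 - 1) * (fk n k : ℝ) ^ 2 / (n.choose 2 : ℕ) := by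
    rw [hb0, mu, gq]
    have e1 : ((n.choose 2 : ℕ) : ℝ) - m ≠ 0 := by linarith
    have e2 : ((n.choose 2 : ℕ) : ℝ) ≠ 0 := by linarith
    simp only [Nat.cast_zero, sub_zero]
    field_simp
    ring
  rw [← Finset.sum_filter_add_sum_filter_not Finset.univ (fun σ : Equiv.Perm (Fin n) =>
        ε0 * k ≤ (k:ℝ) - (((domD (dat (C0 n k hk) cut σ)).card : ℕ) : ℝ))]
  have A : ∑ σ ∈ Finset.univ.filter (fun σ : Equiv.Perm (Fin n) =>
        ε0 * k ≤ (k:ℝ) - (((domD (dat (C0 n k hk) cut σ)).card : ℕ) : ℝ)),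
        Rk n m k (sC (C0 n k hk) σ) ≤ (1 + δ) * n.factorial := by
    calc _ ≤ ∑ σ ∈ Finset.univ.filter (fun σ : Equiv.Perm (Fin n) =>
        ε0 * k ≤ (k:ℝ) - (((domD (dat (C0 n k hk) cut σ)).card : ℕ) : ℝ)),
          Real.exp (-(mu n m k * fk n k)) * bB n m k ^ sC (C0 n k hk) σ :=
            Finset.sum_le_sum fun σ _ => Rk_le1 n m k _ h2 (hs σ)
      _ ≤ Real.exp (-(mu n m k * fk n k)) * ((n.factorial : ℝ) * ((1 + δ) * Real.exp ((b0 - 1) * (fk n k : ℝ) ^ 2 / (n.choose 2 : ℕ)))) := by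
            rw [← Finset.mul_sum]
            exact mul_le_mul_of_nonneg_left h1 (Real.exp_pos _).le
      _ = _ := by
            rw [← hmu, Real.exp_neg]
            field_simp
  have B : ∑ σ ∈ Finset.univ.filter (fun σ : Equiv.Perm (Fin n) =>
        ¬ (ε0 * k ≤ (k:ℝ) - (((domD (dat (C0 n k hk) cut σ)).card : ℕ) : ℝ))),
        Rk n m k (sC (C0 n k hk) σ) ≤ δ * n.factorial := by
    calc _ ≤ ∑ σ ∈ Finset.univ.filter (fun σ : Equiv.Perm (Fin n) =>
        ¬ (ε0 * k ≤ (k:ℝ) - (((domD (dat (C0 n k hk) cut σ)).card : ℕ) : ℝ))),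
          bp n m k ^ sC (C0 n k hk) σ / (Pk n m k * bp n m k ^ fk n k) :=
            Finset.sum_le_sum fun σ _ => Rk_le2 n m k _ h2 (hs σ)
      _ ≤ (bp n m k ^ fk n k * Dk n k * X) / (Pk n m k * bp n m k ^ fk n k) := by
            rw [← Finset.sum_div]
            exact div_le_div_of_nonneg_right h3 (by positivity)
      _ ≤ (bp n m k ^ fk n k * Dk n k * (δ * Ebar n m k)) / (Pk n m k * bp n m k ^ fk n k) := by
            gcongr
      _ = _ := by
            unfold Ebar
            field_simp
  linarith

theorem second_moment_asym (p b Kc : ℝ) (hp0 : 0 < p) (hp1 : p < 1) (hb : b = 1 / (1 - p))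
    (hb1 : 1 < b) (hbe : b < Real.exp 1) (hK : 1 ≤ Kc) (δ : ℝ) (hδ : 0 < δ) :
    ∀ᶠ n : ℕ in atTop, ∀ k : ℕ, 0 < k → k ≤ n →
      1 ≤ n / k → ((n / k : ℕ):ℝ) * 100 ≤ (1 - p) * n →
      (n:ℝ) ^ 2 ≤ Kc * (((n / k : ℕ):ℝ) ^ 2 * b ^ (n / k)) →
      ((n / k : ℕ):ℝ) ^ 2 * b ^ (n / k) ≤ Kc * (n:ℝ) ^ 2 →
      Real.exp ((12 * Kc + 1) * (n / k : ℕ)) ≤ Ebar n (mFloor p n) k →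
      1 - 2 * δ ≤ Pm n (mFloor p n) (fun G => HasEquitableColouring G k) := by
  obtain ⟨ε0, hε0, -, hR2⟩ := R2_asym b Kc hb1 hbe hK
  have hR1 := R1_asym b Kc ε0 δ hb1 hbe hK hε0 hδ
  obtain ⟨ε, hε, hreg⟩ := reg_facts b Kc hb1 hbe hK
  have hbb := base_b p hp0 hp1
  rw [← hb] at hbb
  filter_upwards [hR1, hR2, hreg (Real.log (2 * Real.exp 1 / δ)), hbb, base_N p hp0 hp1] with
    n hR1 hR2 hreg ⟨B1, B2, B3, B4⟩ ⟨N1, N2, N3, N4, N5, N6, N7, N8⟩ k hk hkn ha h100 H1 H2 HE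
  obtain ⟨C1, C2, C3, C4⟩ := B4 k hk h100
  set m := mFloor p n with hm
  set b0 := 1 / gq (n.choose 2) m 0 with hb0
  set a := n / k with hadef
  have hbp1 : 1 ≤ bp n m k := B3.trans C2
  have hup : b0 * Real.exp (6 * a * b / n) ≤ b * Real.exp (6 * a * b / n) :=
    mul_le_mul_of_nonneg_right B2 (Real.exp_pos _).le
  have reg1 : Reg b Kc n a (bp n m k) := ⟨ha, H1, H2,
    B1.trans (mul_le_mul_of_nonneg_right C2 (Real.exp_pos _).le), (C3.trans C4).trans hup⟩
  have reg2 : Reg b Kc n a (bB n m k) := ⟨ha, H1, H2,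
    B1.trans (mul_le_mul_of_nonneg_right (C2.trans C3) (Real.exp_pos _).le), C4.trans hup⟩
  obtain ⟨-, -, -, -, -, hCa, -⟩ := hreg a _ reg1
  have hDk : (0:ℝ) < Dk n k := by exact_mod_cast Dk_pos n k
  have hE1 : 1 ≤ Ebar n m k := by
    refine le_trans (Real.one_le_exp ?_) HE
    positivity
  have hg : 0 < gq (n.choose 2) m 0 := gq_pos (by omega)
  have hD : (Dk n k : ℝ) * b0 ^ fk n k ≤ (n.factorial : ℝ) := by
    have e1 : (Dk n k : ℝ) ≤ n.factorial * gq (n.choose 2) m 0 ^ fk n k := by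
      rw [Ebar, le_div_iff₀ hDk, one_mul] at hE1
      refine hE1.trans ?_
      exact mul_le_mul_of_nonneg_left (Pk_le' n m k N4 N5) (Nat.cast_nonneg _)
    rw [hb0, one_div, inv_pow, ← div_eq_mul_inv, div_le_iff₀ (by positivity)]
    exact e1
  have S1 := hR1 k hk hkn (bB n m k) b0 ((n.choose 2 : ℕ) : ℝ) reg2 B3 B2 C4 N1 N2 hD
    (fun I => ε0 * k ≤ (k:ℝ) - ((I.card : ℕ) : ℝ)) (fun I h => h)
  have S2 := hR2 k hk hkn (bp n m k) reg1
    (fun I => ¬ (ε0 * k ≤ (k:ℝ) - ((I.card : ℕ) : ℝ))) (fun I h => (not_le.1 h).le)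
  refine Pm_ge n m k hk (choose_pos' (by omega)) (2 * δ) ?_
  refine second_moment_bound n m k hk δ b0 (2 * Real.exp (1 + 12 * Kc * a)) ε0 (19 * a / 20) C1 N4 hb0
    (by linarith) ?_ ?_ ?_
  · refine le_trans (le_of_eq ?_) S1
    exact Finset.sum_congr (by ext; simp [hadef]) (fun _ _ => rfl)
  · refine le_trans (le_of_eq ?_) S2
    exact Finset.sum_congr (by ext; simp [hadef]) (fun _ _ => rfl)
  · have hea : 2 * Real.exp 1 / δ ≤ Real.exp a := by
      rw [← Real.log_le_iff_le_exp (by positivity)]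
      exact hCa
    rw [div_le_iff₀ hδ] at hea
    calc 2 * Real.exp (1 + 12 * Kc * a) = (2 * Real.exp 1) * Real.exp (12 * Kc * a) := by
          rw [Real.exp_add]; ring
      _ ≤ (Real.exp a * δ) * Real.exp (12 * Kc * a) := by gcongr
      _ = δ * Real.exp ((12 * Kc + 1) * a) := by
          rw [add_mul, Real.exp_add, one_mul]; ring
      _ ≤ _ := by gcongr


/-- Theorem 1.3: two-point concentration of the equitable chromatic number of `G_{n,m}`
with `m = ⌊pN⌋` for fixed `0 < p < 1 − 1/e`. -/
theorem twopoint_equitable (p : ℝ) (hp0 : 0 < p) (hp1 : p < 1 - (Real.exp 1)⁻¹) :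
    ∃ k : ℕ → ℕ, Tendsto
      (fun n : ℕ => Pm n (mFloor p n) fun G =>
        chiEquitable G = k n ∨ chiEquitable G = k n + 1)
      atTop (nhds 1) := by
  have hei : 0 < (Real.exp 1)⁻¹ := by positivity
  have hp1' : p < 1 := by linarith
  have hq : 0 < 1 - p := by linarith
  obtain ⟨b, hb⟩ : ∃ b, b = 1 / (1 - p) := ⟨_, rfl⟩
  have hb1 : 1 < b := by rw [hb, lt_div_iff₀ hq]; linarith
  have hbe : b < Real.exp 1 := by
    rw [hb, one_div]
    exact inv_lt_of_inv_lt₀ (Real.exp_pos 1) (by linarith)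
  obtain ⟨Kc, hKc, hfm⟩ := fm_choice p b hp0 hp1' hb hb1 hbe
  have hfm := hfm (12 * Kc + 1) (by positivity)
  obtain ⟨n0, hn0⟩ := eventually_atTop.1 hfm
  choose! K hK using hn0
  refine ⟨K, ?_⟩
  rw [Metric.tendsto_atTop']
  intro ε hε
  have hsm := second_moment_asym p b Kc hp0 hp1' hb hb1 hbe hKc (ε / 8) (by positivity)
  have h1 : ∀ᶠ n : ℕ in atTop, 4 / ε ≤ (n:ℝ) := tendsto_natCast_atTop_atTop.eventually_ge_atTop _
  obtain ⟨n1, hn1⟩ := eventually_atTop.1 (hsm.and (h1.and ((eventually_ge_atTop n0).and (eventually_ge_atTop 1))))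
  refine ⟨n1, fun n hn => ?_⟩
  obtain ⟨A1, A2, A3, A4⟩ := hn1 n hn.le
  obtain ⟨k1, k2, k3, k4, k5, k6, k7, k8⟩ := hK n A3
  have hn0 : (0:ℝ) < n := by exact_mod_cast A4
  have P := A1 (K n + 1) (by omega) k2 k4 k5 k6 k7 k8
  have T := two_point_finite n (mFloor p n) (K n) A4 (by omega) (1 / (n:ℝ) ^ 2) (2 * (ε / 8))
    (by positivity) k3 P
  have U := Pm_le_one n (mFloor p n) (fun G => chiEquitable G = K n ∨ chiEquitable G = K n + 1)
  have hinv : n * (1 / (n:ℝ) ^ 2) ≤ ε / 4 := by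
    rw [div_le_iff₀ hε] at A2
    have : n * (1 / (n:ℝ) ^ 2) = 1 / n := by field_simp
    rw [this, div_le_iff₀ hn0]
    linarith
  rw [Real.dist_eq, abs_lt]
  constructor <;> linarith
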